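/- Let s ∈ (1/2, 1]. There exists a constant C, depending only on s, such that for all coprime integers p, q with q ≥ 1, all 0 < H ≤ q^{−2}, all δ with |δ| ≤ √H/q and all integers N ≥ 1, the function g_{s,N}(h) = F_{s,N}(p/q + δ + 2h) − F_{s,N}(p/q + δ + h) − (θ_0/√q) f_{s,N}(h) satisfies ‖g_{s,N}‖_{L²(μ̃_H)} ≤ C H^{(s−1/2)/2}, where f_{s,N}(h) = ∫_0^N t^{−s} (e^{2πi t²(δ + 2h)} − e^{2πi t²(δ + h)}) dt. -/

import Mathlib

open MeasureTheory Filter Set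
open scoped Real BigOperators ENNReal

/-- Partial sum `F_{s,N}(x) = ∑_{n=1}^N n^{-s} e^{2πi n² x}`. -/
noncomputable def FsN (s : ℝ) (N : ℕ) (x : ℝ) : ℂ :=
  ∑ n ∈ Finset.Icc 1 N,
    (((n : ℝ) ^ (-s) : ℝ) : ℂ) * Complex.exp (2 * Real.pi * Complex.I * (n : ℂ) ^ 2 * (x : ℂ))

/-- The Gauss sum `τ_m = ∑_{b=0}^{q-1} e^{2πi (p b² + m b)/q}`. -/
noncomputable def gaussTau (p : ℤ) (q : ℕ) (m : ℤ) : ℂ :=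
  ∑ b ∈ Finset.range q,
    Complex.exp (2 * Real.pi * Complex.I * ((p : ℂ) * (b : ℂ) ^ 2 + (m : ℂ) * (b : ℂ)) / (q : ℂ))

/-- `θ_m = τ_m / √q`. -/
noncomputable def gaussTheta (p : ℤ) (q : ℕ) (m : ℤ) : ℂ :=
  gaussTau p q m / (Real.sqrt q : ℂ)

/-- `G_{s,N}(h) = (2hq)^{s-1/2} e^{iπ/4} ∑_{m=1}^{⌊2Nhq⌋} (θ_m/m^s) e^{-iπm²/(q²h)}`
(this quantity depends on `p` and `q`). -/
noncomputable def GsN (s : ℝ) (p : ℤ) (q : ℕ) (N : ℕ) (h : ℝ) : ℂ :=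
  (((2 * h * q) ^ (s - 1/2) : ℝ) : ℂ) * Complex.exp (Complex.I * Real.pi / 4) *
    ∑ m ∈ Finset.Icc 1 (⌊2 * (N : ℝ) * h * q⌋.toNat),
      gaussTheta p q m * (((m : ℝ) ^ (-s) : ℝ) : ℂ) *
        Complex.exp (-(Complex.I * Real.pi * (m : ℂ) ^ 2 / ((q : ℂ) ^ 2 * (h : ℂ))))

/-- The probability measure `μ̃_H`: normalized Lebesgue measure `dh/(2H)` on the annulus
`C(H) = [-2H,-H] ∪ [H,2H]`. -/
noncomputable def annMeasure (H : ℝ) : Measure ℝ :=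
  (ENNReal.ofReal (2 * H))⁻¹ •
    (volume.restrict (Set.Icc (-(2 * H)) (-H) ∪ Set.Icc H (2 * H)))

/-- `f_{s,N}(h) = ∫_0^N t^{-s} (e^{2πit²(δ+2h)} - e^{2πit²(δ+h)}) dt`. -/
noncomputable def fMain (s δ Nr : ℝ) (h : ℝ) : ℂ :=
  ∫ t in (0 : ℝ)..Nr,
    (((t ^ (-s) : ℝ)) : ℂ) *
      (Complex.exp (2 * Real.pi * Complex.I * (t : ℂ) ^ 2 * ((δ : ℂ) + 2 * (h : ℂ))) -
        Complex.exp (2 * Real.pi * Complex.I * (t : ℂ) ^ 2 * ((δ : ℂ) + (h : ℂ))))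

section Helpers
open Complex (I)


/-- slanted line -/
noncomputable def slw (a u : ℝ) : ℂ := (a : ℂ) + (1 + I) * (u : ℂ)

lemma slw_im (a u : ℝ) : (slw a u).im = u := by simp [slw]
lemma slw_re (a u : ℝ) : (slw a u).re = a + u := by simp [slw]

lemma para_cauchy (φ : ℂ → ℂ) (Ω : Set ℂ) (hΩ : IsOpen Ω) (hφ : DifferentiableOn ℂ φ Ω)
    (hs : ∀ a u : ℝ, a ∈ Set.Icc (-(1/2) : ℝ) (1/2) → slw a u ∈ Ω) (U : ℝ) :
    (∫ u in (-U)..U, (1 + I) * φ (slw (1/2) u)) - (∫ u in (-U)..U, (1 + I) * φ (slw (-(1/2)) u))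
      = (∫ a in (-(1/2) : ℝ)..(1/2), φ (slw a U)) - ∫ a in (-(1/2) : ℝ)..(1/2), φ (slw a (-U)) := by
  let L : ℝ × ℝ →L[ℝ] ℂ :=
    Complex.ofRealCLM.comp (ContinuousLinearMap.fst ℝ ℝ ℝ) +
      (1 + I) • Complex.ofRealCLM.comp (ContinuousLinearMap.snd ℝ ℝ ℝ)
  have hL : ∀ x : ℝ × ℝ, L x = slw x.1 x.2 := by intro x; simp [L, slw]
  have hmem : ∀ x ∈ (uIcc (-(1/2 : ℝ)) (1/2)) ×ˢ (uIcc (-U) U), L x ∈ Ω := by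
    intro x hx
    rw [hL]
    apply hs
    have := hx.1
    rwa [uIcc_of_le (by norm_num)] at this
  have hd : ∀ x : ℝ × ℝ, L x ∈ Ω → HasFDerivAt (fun x => φ (L x))
      (((ContinuousLinearMap.toSpanSingleton ℂ (deriv φ (L x))).restrictScalars ℝ).comp L) x := by
    intro x hx
    have h1 : HasDerivAt φ (deriv φ (L x)) (L x) :=
      ((hφ _ hx).differentiableAt (hΩ.mem_nhds hx)).hasDerivAt
    exact (h1.hasFDerivAt.restrictScalars ℝ).comp x L.hasFDerivAt
  have hc : ContinuousOn (fun x => φ (L x)) ((uIcc (-(1/2 : ℝ)) (1/2)) ×ˢ (uIcc (-U) U)) := by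
    intro x hx
    exact (hd x (hmem x hx)).continuousAt.continuousWithinAt
  have key := integral2_divergence_prod_of_hasFDerivAt_off_countable
    (fun x => (1 + I) * φ (L x)) (fun x => - φ (L x))
    (fun x => (1 + I) • (((ContinuousLinearMap.toSpanSingleton ℂ (deriv φ (L x))).restrictScalars ℝ).comp L))
    (fun x => - (((ContinuousLinearMap.toSpanSingleton ℂ (deriv φ (L x))).restrictScalars ℝ).comp L))
    (-(1/2)) (-U) (1/2) U ∅ Set.countable_empty
    (continuousOn_const.mul hc) hc.neg ?_ ?_ ?_
  · have h0 : ∀ x : ℝ × ℝ, ((1 + I) • (((ContinuousLinearMap.toSpanSingleton ℂ (deriv φ (L x))).restrictScalars ℝ).comp L)) (1, 0) + (- (((ContinuousLinearMap.toSpanSingleton ℂ (deriv φ (L x))).restrictScalars ℝ).comp L)) (0, 1) = 0 := by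
      intro x
      simp [L]
    simp only [h0] at key
    simp only [hL, intervalIntegral.integral_zero, intervalIntegral.integral_neg] at key
    linear_combination -key
  · intro x hx
    have hx' : x ∈ (uIcc (-(1/2 : ℝ)) (1/2)) ×ˢ (uIcc (-U) U) :=
      ⟨Ioo_subset_Icc_self hx.1.1, Ioo_subset_Icc_self hx.1.2⟩
    exact (hd x (hmem x hx')).const_mul (1 + I)
  · intro x hx
    have hx' : x ∈ (uIcc (-(1/2 : ℝ)) (1/2)) ×ˢ (uIcc (-U) U) :=
      ⟨Ioo_subset_Icc_self hx.1.1, Ioo_subset_Icc_self hx.1.2⟩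
    exact (hd x (hmem x hx')).neg
  · have h0 : ∀ x : ℝ × ℝ, ((1 + I) • (((ContinuousLinearMap.toSpanSingleton ℂ (deriv φ (L x))).restrictScalars ℝ).comp L)) (1, 0) + (- (((ContinuousLinearMap.toSpanSingleton ℂ (deriv φ (L x))).restrictScalars ℝ).comp L)) (0, 1) = 0 := by
      intro x
      simp [L]
    simp only [h0]
    exact integrableOn_zero

/-- the logarithmic integral along the two slanted lines -/
lemma log_limit : Tendsto (fun U : ℝ => (∫ u in (-U)..U, (1 + I) * (slw (1/2) u)⁻¹)
    - (∫ u in (-U)..U, (1 + I) * (slw (-(1/2)) u)⁻¹)) atTop (nhds (2 * π * I)) := by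
  have hslit : ∀ u : ℝ, slw (1/2) u ∈ Complex.slitPlane := by
    intro u
    rw [Complex.mem_slitPlane_iff, slw_re, slw_im]
    by_cases h : u = 0
    · left; subst h; norm_num
    · right; exact h
  have hslit' : ∀ u : ℝ, -slw (-(1/2)) u ∈ Complex.slitPlane := by
    intro u
    rw [Complex.mem_slitPlane_iff, Complex.neg_re, Complex.neg_im, slw_re, slw_im]
    by_cases h : u = 0
    · left; subst h; norm_num
    · right; simpa using h
  have hcont : ∀ a : ℝ, Continuous (slw a) := by intro a; unfold slw; fun_prop
  have hder : ∀ a u : ℝ, HasDerivAt (slw a) (1 + I) u := by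
    intro a u
    have := ((Complex.ofRealCLM.hasDerivAt (x := u)).const_mul (1 + I)).const_add (a : ℂ)
    have e : slw a = fun y : ℝ => (a : ℂ) + (1 + I) * Complex.ofRealCLM y := by
      funext y; simp [slw]
    rw [e]
    simpa using this
  have h1 : ∀ U : ℝ, (∫ u in (-U)..U, (1 + I) * (slw (1/2) u)⁻¹)
      = Complex.log (slw (1/2) U) - Complex.log (slw (1/2) (-U)) := by
    intro U
    apply intervalIntegral.integral_eq_sub_of_hasDerivAt
      (f := fun u => Complex.log (slw (1/2) u))
    · intro u _
      simpa [div_eq_mul_inv] using (hder (1/2) u).clog_real (hslit u)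
    · apply Continuous.intervalIntegrable
      exact continuous_const.mul ((hcont _).inv₀ (fun u => Complex.slitPlane_ne_zero (hslit u)))
  have h2 : ∀ U : ℝ, (∫ u in (-U)..U, (1 + I) * (slw (-(1/2)) u)⁻¹)
      = Complex.log (-slw (-(1/2)) U) - Complex.log (-slw (-(1/2)) (-U)) := by
    intro U
    apply intervalIntegral.integral_eq_sub_of_hasDerivAt
      (f := fun u => Complex.log (-slw (-(1/2)) u))
    · intro u _
      have := (hder (-(1/2)) u).neg.clog_real (hslit' u)
      have e : -(1 + I) / (-slw (-(1/2))) u = (1 + I) * (slw (-(1/2)) u)⁻¹ := by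
        rw [Pi.neg_apply, neg_div_neg_eq, div_eq_mul_inv]
      rw [e] at this
      exact this
    · apply Continuous.intervalIntegrable
      exact continuous_const.mul ((hcont _).inv₀ (fun u => by
        have hne := Complex.slitPlane_ne_zero (hslit' u)
        simpa using hne))
  have h3 : ∀ U : ℝ, -slw (-(1/2)) U = slw (1/2) (-U) := by intro U; simp [slw]; ring
  have h4 : ∀ U : ℝ, 0 < U → Complex.log (slw (1/2) U) - Complex.log (slw (1/2) (-U))
      = Complex.log ((1 / (2 * U) : ℝ) + (1 + I)) - Complex.log ((1 / (2 * U) : ℝ) - (1 + I)) := by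
    intro U hU
    have e1 : slw (1/2) U = (U : ℂ) * ((1 / (2 * U) : ℝ) + (1 + I)) := by
      have : (U : ℂ) ≠ 0 := by exact_mod_cast hU.ne'
      simp [slw]; field_simp
    have e2 : slw (1/2) (-U) = (U : ℂ) * ((1 / (2 * U) : ℝ) - (1 + I)) := by
      have : (U : ℂ) ≠ 0 := by exact_mod_cast hU.ne'
      simp [slw]; field_simp; ring
    rw [e1, e2, Complex.log_ofReal_mul hU, Complex.log_ofReal_mul hU]
    · ring
    · intro h; have := congrArg Complex.im h; simp at this
    · intro h; have := congrArg Complex.im h; simp at this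
  have hinv : Tendsto (fun U : ℝ => ((1 / (2 * U) : ℝ) : ℂ)) atTop (nhds 0) := by
    have : Tendsto (fun U : ℝ => (1 / (2 * U) : ℝ)) atTop (nhds 0) := by
      have := (tendsto_inv_atTop_zero (𝕜 := ℝ)).const_mul (1/2)
      simp only [mul_zero] at this
      refine this.congr (fun U => ?_)
      simp; ring
    have h := (Complex.continuous_ofReal.tendsto 0).comp this
    rw [Complex.ofReal_zero] at h
    exact h
  have l1 : Complex.log (1 + I) - Complex.log (-(1 + I)) = π * I := by
    rw [Complex.log, Complex.log, Complex.arg_neg_eq_arg_sub_pi_of_im_pos (by simp), norm_neg]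
    push_cast
    ring
  have hlim : Tendsto (fun U : ℝ => Complex.log ((1 / (2 * U) : ℝ) + (1 + I)) - Complex.log ((1 / (2 * U) : ℝ) - (1 + I)))
      atTop (nhds (π * I)) := by
    rw [← l1]
    refine Tendsto.sub ?_ ?_
    · have hs : (1 + I) ∈ Complex.slitPlane := by rw [Complex.mem_slitPlane_iff]; simp
      have := (continuousAt_clog hs).tendsto.comp (f := fun U : ℝ => ((1 / (2 * U) : ℝ) : ℂ) + (1 + I)) (x := atTop) (by simpa using hinv.add_const (1 + I))
      exact this
    · have hs : -(1 + I) ∈ Complex.slitPlane := by rw [Complex.mem_slitPlane_iff]; simp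
      have := (continuousAt_clog hs).tendsto.comp (f := fun U : ℝ => ((1 / (2 * U) : ℝ) : ℂ) - (1 + I)) (x := atTop) (by simpa using hinv.sub_const (1 + I))
      exact this
  have hfin := hlim.const_mul (2 : ℂ)
  rw [show (2 : ℂ) * (π * I) = 2 * π * I by ring] at hfin
  refine hfin.congr' ?_
  filter_upwards [eventually_gt_atTop 0] with U hU
  rw [h1, h2, h3, h3, neg_neg, ← h4 U hU]
  ring


/-- `e(z) = exp(2πiz)` -/
noncomputable def ee (z : ℂ) : ℂ := Complex.exp (2 * π * I * z)

lemma ee_add (a b : ℂ) : ee (a + b) = ee a * ee b := by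
  simp only [ee]; rw [← Complex.exp_add]; congr 1; ring
lemma ee_zero : ee 0 = 1 := by simp [ee]
lemma ee_int (n : ℤ) : ee n = 1 := by
  simp only [ee]; rw [Complex.exp_eq_one_iff]; exact ⟨n, by ring⟩
lemma ee_nat (n : ℕ) : ee n = 1 := by
  have := ee_int n
  simpa using this
lemma ee_one : ee 1 = 1 := by simpa using ee_nat 1
lemma norm_ee (z : ℂ) : ‖ee z‖ = Real.exp (-2 * π * z.im) := by
  simp only [ee]; rw [Complex.norm_exp]; congr 1; simp
lemma norm_ee_real (t : ℝ) : ‖ee t‖ = 1 := by rw [norm_ee]; simp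
lemma ee_ne_zero (z : ℂ) : ee z ≠ 0 := Complex.exp_ne_zero _
lemma ee_neg_mul (z : ℂ) : ee (-z) * ee z = 1 := by rw [← ee_add]; simp [ee_zero]
lemma differentiable_ee : Differentiable ℂ ee := by unfold ee; fun_prop
lemma continuous_ee : Continuous ee := differentiable_ee.continuous
lemma hasDerivAt_ee (z : ℂ) : HasDerivAt ee (2 * π * I * ee z) z := by
  unfold ee
  have h : HasDerivAt (fun z : ℂ => 2 * π * I * z) (2 * π * I) z := by
    simpa using (hasDerivAt_id z).const_mul (2 * π * I : ℂ)
  have := h.cexp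
  rwa [mul_comm (Complex.exp _)] at this

/-- The integrand -/
noncomputable def Wg (x z : ℝ) (w : ℂ) : ℂ := ee (x * w ^ 2 / 2 + z * w) / (1 - ee w)

noncomputable def Wf (x z : ℝ) : ℂ := ∫ u : ℝ, (1 + I) * Wg x z (slw (-(1/2)) u)

lemma norm_num_part (x z a u : ℝ) :
    ‖ee (x * (slw a u) ^ 2 / 2 + z * slw a u)‖ = Real.exp (-2 * π * (x * (u ^ 2 + a * u) + z * u)) := by
  rw [norm_ee]
  congr 2
  simp [slw, pow_two]
  ring

lemma exp_pi_half : (2 : ℝ) ≤ Real.exp (π / 2) := by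
  have h1 := Real.pi_gt_three
  have := Real.add_one_le_exp (π/2)
  linarith

lemma den_lower (u : ℝ) : (1/2 : ℝ) ≤ ‖1 - ee (slw (-(1/2)) u)‖ ∧
    1/2 * Real.exp (-2 * π * u) ≤ ‖1 - ee (slw (-(1/2)) u)‖ := by
  set ρ := Real.exp (-2 * π * u) with hρ
  have hρ0 : 0 < ρ := Real.exp_pos _
  have hn : ‖ee (slw (-(1/2)) u)‖ = ρ := by rw [norm_ee, slw_im]
  have hpi := Real.pi_gt_three
  rcases lt_or_ge (1/4) u with h | h
  · have : ρ ≤ 1/2 := by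
      have h2 : ρ * Real.exp (π/2) ≤ 1 := by
        rw [hρ, ← Real.exp_add, ← Real.exp_zero]
        apply Real.exp_le_exp.2; nlinarith
      nlinarith [exp_pi_half]
    have h3 := norm_sub_norm_le (1:ℂ) (ee (slw (-(1/2)) u))
    rw [hn, norm_one] at h3
    constructor <;> linarith
  rcases lt_or_ge u (-(1/4)) with h' | h'
  · have : 2 ≤ ρ := by
      refine exp_pi_half.trans ?_
      apply Real.exp_le_exp.2; nlinarith
    have h3 := norm_sub_norm_le (ee (slw (-(1/2)) u)) (1:ℂ)
    rw [hn, norm_one, norm_sub_rev] at h3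
    constructor <;> linarith
  · have hc : 0 ≤ Real.cos (2 * π * u) := by
      apply Real.cos_nonneg_of_neg_pi_div_two_le_of_le <;> nlinarith
    have hre : (ee (slw (-(1/2)) u)).re = - (ρ * Real.cos (2 * π * u)) := by
      have h1 : slw (-(1/2)) u = ((u - 1/2 : ℝ) : ℂ) + (u : ℝ) * I := by
        simp [slw]; ring
      rw [h1]
      simp only [ee]
      rw [Complex.exp_re]
      have : Real.cos (2 * π * u - π) = - Real.cos (2 * π * u) := Real.cos_sub_pi _
      have e1 : (2 * π * I * (((u - 1/2 : ℝ) : ℂ) + (u : ℝ) * I)).re = -2 * π * u := by simp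
      have e2 : (2 * π * I * (((u - 1/2 : ℝ) : ℂ) + (u : ℝ) * I)).im = 2 * π * u - π := by
        simp; ring
      rw [e1, e2, this]; ring
    have hsq : ‖1 - ee (slw (-(1/2)) u)‖ ^ 2 = 1 + 2 * (ρ * Real.cos (2 * π * u)) + ρ ^ 2 := by
      rw [← Complex.normSq_eq_norm_sq, Complex.normSq_sub, Complex.normSq_eq_norm_sq (ee _), hn]
      rw [one_mul, Complex.conj_re, hre]
      simp
      ring
    have hm : 0 ≤ ρ * Real.cos (2 * π * u) := by positivity
    constructor <;> apply le_of_sq_le_sq _ (norm_nonneg _) <;> rw [hsq] <;> nlinarith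

lemma den_ne (u : ℝ) : 1 - ee (slw (-(1/2)) u) ≠ 0 := by
  have := (den_lower u).1
  intro h; rw [h] at this; norm_num at this

lemma cont_slw (a : ℝ) : Continuous (slw a) := by unfold slw; fun_prop

lemma cont_Wg (x z : ℝ) : Continuous fun u : ℝ => Wg x z (slw (-(1/2)) u) := by
  unfold Wg
  have := cont_slw (-(1/2))
  have h2 := continuous_ee
  refine Continuous.div ?_ ?_ den_ne
  · exact h2.comp (by fun_prop)
  · exact continuous_const.sub (h2.comp this)

lemma norm_Wg_le (x z u : ℝ) : ‖Wg x z (slw (-(1/2)) u)‖ ≤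
    2 * Real.exp (-2 * π * (x * (u ^ 2 - u / 2) + z * u)) := by
  unfold Wg
  rw [norm_div, norm_num_part, div_le_iff₀ (norm_pos_iff.2 (den_ne u))]
  have := (den_lower u).1
  have h0 := Real.exp_pos (-2 * π * (x * (u ^ 2 - u / 2) + z * u))
  have e : x * (u ^ 2 + -(1/2) * u) + z * u = x * (u ^ 2 - u / 2) + z * u := by ring
  rw [e]; nlinarith

lemma integrable_quad (b c d : ℝ) (hb : 0 < b) : Integrable fun u : ℝ => Real.exp (-b * u ^ 2 + c * u + d) := by
  have h := (integrable_cexp_quadratic (b := (b:ℂ)) (by simpa using hb) (c:ℂ) (d:ℂ)).norm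
  refine h.congr (Eventually.of_forall fun u => ?_)
  simp only [Complex.norm_exp]
  congr 1
  simp [pow_two]

lemma integrable_Wg (x z : ℝ) (hx : 0 < x) : Integrable fun u : ℝ => (1 + I) * Wg x z (slw (-(1/2)) u) := by
  apply Integrable.const_mul
  have h := (integrable_quad (2 * π * x) (π * x - 2 * π * z) 0 (by positivity)).const_mul 2
  refine h.mono' (cont_Wg x z).aestronglyMeasurable (Eventually.of_forall fun u => ?_)
  refine (norm_Wg_le x z u).trans (le_of_eq ?_)
  congr 2; ring

lemma slw_shift (u : ℝ) : slw (1/2) u = slw (-(1/2)) u + 1 := by simp [slw]; ring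

lemma Wg_shift (x z : ℝ) (w : ℂ) : Wg x z (w + 1) = ee (x/2 + z) * Wg x (z + x) w := by
  unfold Wg
  rw [ee_add w 1, ee_one, mul_one, ← mul_div_assoc, ← ee_add]
  congr 2; push_cast; ring

lemma integral_half (x z : ℝ) : ∫ u : ℝ, (1 + I) * Wg x z (slw (1/2) u) = ee (x/2 + z) * Wf x (z + x) := by
  unfold Wf
  rw [← integral_const_mul]
  congr 1; ext u
  rw [slw_shift, Wg_shift]; ring

lemma norm_one_I : ‖(1 + I : ℂ)‖ ≤ 2 := by
  refine (norm_add_le _ _).trans ?_; simp; norm_num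

noncomputable def kap (x : ℝ) : ℂ := (1 + I) * (Real.sqrt (1 / (2 * x)) : ℝ)

lemma norm_kap (x : ℝ) (hx : 0 < x) : ‖kap x‖ = Real.sqrt (1 / x) := by
  unfold kap
  have h1 : ‖(1 + I : ℂ)‖ = Real.sqrt 2 := by
    rw [Complex.norm_def]; congr 1; simp [Complex.normSq_apply]; norm_num
  rw [norm_mul, h1, Complex.norm_real, Real.norm_of_nonneg (Real.sqrt_nonneg _),
    ← Real.sqrt_mul (by norm_num)]
  congr 1; field_simp

/-- (E2) -/
lemma Wf_E2 (x z : ℝ) (hx : 0 < x) : Wf x z - Wf x (z + 1) = kap x * ee ((-(z^2/(2*x)) : ℝ)) := by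
  unfold Wf
  rw [← integral_sub (integrable_Wg x z hx) (integrable_Wg x (z+1) hx)]
  have e1 : ∀ u : ℝ, (1 + I) * Wg x z (slw (-(1/2)) u) - (1 + I) * Wg x (z+1) (slw (-(1/2)) u)
      = (1 + I) * Complex.exp ((-(2 * π * x) : ℂ) * (u:ℂ)^2 + (2 * π * I * (1 + I) * (z - x/2)) * u
        + 2 * π * I * (x/8 - z/2)) := by
    intro u
    have h1 : ee (x * (slw (-(1/2)) u)^2/2 + (z+1 : ℝ) * slw (-(1/2)) u) =
      ee (x * (slw (-(1/2)) u)^2/2 + z * slw (-(1/2)) u) * ee (slw (-(1/2)) u) := by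
      rw [← ee_add]; congr 1; push_cast; ring
    unfold Wg
    rw [h1, ← mul_sub, ← sub_div, ← mul_one_sub, mul_div_assoc, div_self (den_ne u), mul_one]
    congr 1
    unfold ee slw
    congr 1
    push_cast
    linear_combination (π * x * u ^ 2 * (I + 2)) * Complex.I_sq
  simp_rw [e1]
  rw [integral_const_mul, integral_cexp_quadratic (by simp; positivity)]
  unfold kap
  have hp : (π:ℂ) ≠ 0 := by exact_mod_cast Real.pi_ne_zero
  have hxx : (x:ℂ) ≠ 0 := by exact_mod_cast hx.ne'
  have e2 : (π / - -(2 * π * x) : ℂ) ^ (1/2 : ℂ) = (Real.sqrt (1 / (2 * x)) : ℝ) := by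
    rw [Real.sqrt_eq_rpow, Complex.ofReal_cpow (by positivity)]
    congr 1
    · push_cast; field_simp
    · push_cast; rfl
  rw [e2, ← mul_assoc]
  congr 1
  unfold ee
  congr 1
  have e3 : (2 * π * I * (1 + I) * (z - x/2) : ℂ)^2 = - (8 * π ^ 2 * I * (z - x/2)^2) := by
    have : (1 + I)^2 = 2 * I := by linear_combination Complex.I_sq
    rw [mul_pow, mul_pow, this]; linear_combination (8 * π ^ 2 * I * (z - x/2)^2) * Complex.I_sq
  rw [e3]
  push_cast
  field_simp
  ring


lemma Wg_bound (x z u : ℝ) (hx : 0 < x) (hz : 0 ≤ z) (hz' : z ≤ 1 + x) :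
    ‖Wg x z (slw (-(1/2)) u)‖ ≤ 2 * Real.exp (π * x) * Real.exp (-(π * x) * u ^ 2) := by
  unfold Wg
  rw [norm_div, norm_num_part, div_le_iff₀ (norm_pos_iff.2 (den_ne u)), mul_assoc 2, ← Real.exp_add]
  have hp := Real.pi_pos
  have hpx : 0 < π * x := by positivity
  rcases le_or_gt 0 u with h | h
  · have h1 := (den_lower u).1
    have h2 : Real.exp (-2 * π * (x * (u ^ 2 + -(1/2) * u) + z * u)) ≤ Real.exp (π * x + -(π * x) * u^2) := by
      apply Real.exp_le_exp.2
      have h3 : 0 ≤ π * (z * u) := by positivity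
      nlinarith [mul_nonneg hpx.le (by nlinarith [sq_nonneg (u - 1/2)] : 0 ≤ u^2 - u + 1)]
    have := Real.exp_pos (π * x + -(π * x) * u^2)
    nlinarith
  · have h1 := (den_lower u).2
    have h2 : Real.exp (-2 * π * (x * (u ^ 2 + -(1/2) * u) + z * u)) ≤
        Real.exp (π * x + -(π * x) * u^2) * Real.exp (-2 * π * u) := by
      rw [← Real.exp_add]
      apply Real.exp_le_exp.2
      have h3 : 0 ≤ π * ((1 + x - z) * (-u)) := mul_nonneg hp.le (mul_nonneg (by linarith) (by linarith))
      nlinarith [mul_nonneg hpx.le (by nlinarith [sq_nonneg (u + 1/2)] : 0 ≤ u^2 + u + 1)]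
    have := Real.exp_pos (π * x + -(π * x) * u^2)
    nlinarith

lemma integral_gauss (x : ℝ) : ∫ u : ℝ, Real.exp (-(π * x) * u ^ 2) = Real.sqrt (1 / x) := by
  rw [integral_gaussian]
  congr 1
  rw [← div_div, div_self Real.pi_ne_zero]

lemma exp_pix (x : ℝ) (hx : x ≤ 10) : Real.exp (π * x) ≤ Real.exp (10 * π) :=
  Real.exp_le_exp.2 (by nlinarith [Real.pi_pos])

lemma Wf_B0 : ∃ C : ℝ, 0 < C ∧ ∀ x z : ℝ, 0 < x → x ≤ 10 → 0 ≤ z → z ≤ 1 + x →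
    ‖Wf x z‖ ≤ C * Real.sqrt (1 / x) := by
  refine ⟨4 * Real.exp (10 * π), by positivity, fun x z hx hx' hz hz' => ?_⟩
  unfold Wf
  have h : ‖∫ u : ℝ, (1 + I) * Wg x z (slw (-(1/2)) u)‖ ≤
      ∫ u : ℝ, (4 * Real.exp (10 * π)) * Real.exp (-(π * x) * u ^ 2) := by
    apply norm_integral_le_of_norm_le
    · exact (integrable_exp_neg_mul_sq (by positivity)).const_mul _
    · refine Eventually.of_forall fun u => ?_
      rw [norm_mul]
      have h1 := Wg_bound x z u hx hz hz'
      have h2 := exp_pix x hx'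
      have h3 := Real.exp_pos (-(π * x) * u ^ 2)
      calc _ ≤ 2 * (2 * Real.exp (10 * π) * Real.exp (-(π * x) * u ^ 2)) := by
            apply mul_le_mul norm_one_I (h1.trans (by gcongr)) (norm_nonneg _) (by norm_num)
        _ = _ := by ring
  rwa [integral_const_mul (4 * Real.exp (10 * π)), integral_gauss] at h

lemma Wg_hasDeriv (x z : ℝ) (w : ℂ) : HasDerivAt (fun z : ℝ => Wg x z w) (2 * π * I * w * Wg x z w) z := by
  unfold Wg
  have h1 : HasDerivAt (fun z : ℝ => (x * w ^ 2 / 2 + z * w : ℂ)) w z := by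
    have : HasDerivAt (fun z : ℝ => (z : ℂ)) 1 z := Complex.ofRealCLM.hasDerivAt
    simpa using (this.mul_const w).const_add (x * w ^ 2 / 2 : ℂ)
  have h2 := (hasDerivAt_ee (x * w ^ 2 / 2 + z * w)).scomp z h1
  have h3 := h2.div_const (1 - ee w)
  refine h3.congr_deriv ?_
  simp; ring

lemma absorb (x u : ℝ) (hx : 0 < x) : |u| * Real.exp (-(π * x) * u ^ 2) ≤ Real.sqrt (1/x) * Real.exp (-(π * (x/2)) * u ^ 2) := by
  have h1 : Real.exp (-(π * x) * u ^ 2) * Real.exp (π * (x/2) * u^2) = Real.exp (-(π * (x/2)) * u ^ 2) := by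
    rw [← Real.exp_add]; congr 1; ring
  have h2 : Real.sqrt x * |u| ≤ Real.exp (π * (x/2) * u^2) := by
    refine le_trans ?_ (Real.add_one_le_exp _)
    have h3 : (Real.sqrt x * |u|)^2 = x * u^2 := by rw [mul_pow, Real.sq_sqrt hx.le, sq_abs]
    have h4 : 0 ≤ x * u^2 := by positivity
    nlinarith [sq_nonneg (Real.sqrt x * |u| - 1), Real.pi_gt_three]
  have h5 : |u| ≤ Real.sqrt (1/x) * Real.exp (π * (x/2) * u^2) := by
    have : |u| = Real.sqrt (1/x) * (Real.sqrt x * |u|) := by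
      rw [← mul_assoc, ← Real.sqrt_mul (by positivity), one_div_mul_cancel hx.ne', Real.sqrt_one, one_mul]
    rw [this]; gcongr
  calc |u| * Real.exp (-(π * x) * u ^ 2) ≤ Real.sqrt (1/x) * Real.exp (π * (x/2) * u^2) * Real.exp (-(π * x) * u ^ 2) := by gcongr
    _ = _ := by rw [← h1]; ring

lemma Wf_B1 : ∃ C : ℝ, 0 < C ∧ ∀ x z z' : ℝ, 0 < x → x ≤ 10 → z ∈ Icc 0 (1 + x) → z' ∈ Icc 0 (1 + x) →
    ‖Wf x z - Wf x z'‖ ≤ C * (|z - z'| / x) := by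
  refine ⟨8 * π * Real.exp (10 * π) * 8, by positivity, fun x z z' hx hx' hz hz' => ?_⟩
  unfold Wf
  rw [← integral_sub (integrable_Wg x z hx) (integrable_Wg x z' hx)]
  set K := (8 * π * Real.exp (10 * π)) * (4 * Real.sqrt (1/x)) * |z - z'| with hK
  have h : ‖∫ u : ℝ, ((1 + I) * Wg x z (slw (-(1/2)) u) - (1 + I) * Wg x z' (slw (-(1/2)) u))‖ ≤
      ∫ u : ℝ, K * Real.exp (-(π * (x/2)) * u ^ 2) := by
    apply norm_integral_le_of_norm_le
    · exact (integrable_exp_neg_mul_sq (by positivity)).const_mul _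
    · refine Eventually.of_forall fun u => ?_
      rw [← mul_sub, norm_mul]
      set w := slw (-(1/2)) u with hw
      have hmv := (convex_Icc (0:ℝ) (1+x)).norm_image_sub_le_of_norm_hasDerivWithin_le
        (f := fun z : ℝ => Wg x z w) (f' := fun z : ℝ => 2 * π * I * w * Wg x z w)
        (C := 2 * π * ‖w‖ * (2 * Real.exp (10 * π) * Real.exp (-(π * x) * u ^ 2)))
        (fun t _ => (Wg_hasDeriv x t w).hasDerivWithinAt) (fun t ht => by
          rw [norm_mul, norm_mul]
          have e : ‖(2 * π * I : ℂ)‖ = 2 * π := by simp [abs_of_pos Real.pi_pos]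
          rw [e]
          have := Wg_bound x t u hx ht.1 ht.2
          have h2 := exp_pix x hx'
          have := Real.pi_pos
          refine mul_le_mul_of_nonneg_left ((Wg_bound x t u hx ht.1 ht.2).trans ?_) (by positivity)
          gcongr) hz' hz
      have hwn : ‖w‖ ≤ 1/2 + 2 * |u| := by
        rw [hw]; unfold slw
        refine (norm_add_le _ _).trans ?_
        rw [norm_mul]
        have := norm_one_I
        have h3 : ‖(u:ℂ)‖ = |u| := by simp
        have h4 : ‖((-(1/2) : ℝ) : ℂ)‖ = 1/2 := by rw [Complex.norm_real]; norm_num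
        rw [h3, h4]
        have := mul_le_mul_of_nonneg_right norm_one_I (abs_nonneg u)
        linarith
      have hs : (1/2 : ℝ) ≤ 2 * Real.sqrt (1/x) := by
        have : Real.sqrt (1/16) ≤ Real.sqrt (1/x) := Real.sqrt_le_sqrt (by
          apply one_div_le_one_div_of_le hx; linarith)
        have h4 : Real.sqrt (1/16) = 1/4 := by
          rw [show (1/16 : ℝ) = (1/4)^2 by norm_num]; exact Real.sqrt_sq (by norm_num)
        linarith
      have hab := absorb x u hx
      have hee : Real.exp (-(π * x) * u ^ 2) ≤ Real.exp (-(π * (x/2)) * u ^ 2) := by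
        apply Real.exp_le_exp.2
        have : 0 ≤ π * x * u^2 := by have := Real.pi_pos; positivity
        linarith
      have hwe : ‖w‖ * Real.exp (-(π * x) * u ^ 2) ≤ 4 * Real.sqrt (1/x) * Real.exp (-(π * (x/2)) * u ^ 2) := by
        have h5 := Real.exp_pos (-(π * x) * u ^ 2)
        have h6 := Real.exp_pos (-(π * (x/2)) * u ^ 2)
        calc _ ≤ (1/2 + 2 * |u|) * Real.exp (-(π * x) * u ^ 2) := by gcongr
          _ = 1/2 * Real.exp (-(π * x) * u ^ 2) + 2 * (|u| * Real.exp (-(π * x) * u ^ 2)) := by ring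
          _ ≤ 2 * Real.sqrt (1/x) * Real.exp (-(π * (x/2)) * u ^ 2) + 2 * (Real.sqrt (1/x) * Real.exp (-(π * (x/2)) * u ^ 2)) := by gcongr
          _ = _ := by ring
      rw [Real.norm_eq_abs] at hmv
      have hp := Real.pi_pos
      calc _ ≤ 2 * (2 * π * ‖w‖ * (2 * Real.exp (10 * π) * Real.exp (-(π * x) * u ^ 2)) * |z - z'|) :=
            mul_le_mul norm_one_I hmv (norm_nonneg _) (by norm_num)
        _ = (8 * π * Real.exp (10 * π)) * |z - z'| * (‖w‖ * Real.exp (-(π * x) * u ^ 2)) := by ring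
        _ ≤ (8 * π * Real.exp (10 * π)) * |z - z'| * (4 * Real.sqrt (1/x) * Real.exp (-(π * (x/2)) * u ^ 2)) := by gcongr
        _ = _ := by rw [hK]; ring
  rw [integral_const_mul, integral_gauss] at h
  refine h.trans ?_
  have h7 : Real.sqrt (1/(x/2)) ≤ 2 * Real.sqrt (1/x) := by
    rw [show 2 * Real.sqrt (1/x) = Real.sqrt (4 * (1/x)) by
      rw [Real.sqrt_mul (by norm_num), show (4:ℝ) = 2^2 by norm_num, Real.sqrt_sq (by norm_num)]]
    apply Real.sqrt_le_sqrt
    have : 0 < 1/x := by positivity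
    have e : 1/(x/2) = 2 * (1/x) := by field_simp
    rw [e]; linarith
  have hp := Real.pi_pos
  calc K * Real.sqrt (1/(x/2)) ≤ K * (2 * Real.sqrt (1/x)) := by
        apply mul_le_mul_of_nonneg_left h7; rw [hK]; positivity
    _ = (8 * π * Real.exp (10 * π)) * 8 * |z - z'| * (Real.sqrt (1/x) * Real.sqrt (1/x)) := by rw [hK]; ring
    _ = _ := by rw [Real.mul_self_sqrt (by positivity)]; ring


noncomputable def kk : ℂ → ℂ := dslope (fun w => 1 - ee w) 0

lemma kk_zero : kk 0 = -(2 * π * I) := by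
  unfold kk
  rw [dslope_same]
  have := ((hasDerivAt_ee 0).const_sub 1).deriv
  rw [this, ee_zero, mul_one]

lemma kk_ne {w : ℂ} (hw : w ≠ 0) : kk w * w = 1 - ee w := by
  unfold kk
  rw [dslope_of_ne _ hw, slope_def_field, ee_zero, sub_self, sub_zero, sub_zero, div_mul_cancel₀ _ hw]

lemma kk_diff : Differentiable ℂ kk := by
  unfold kk
  rw [← differentiableOn_univ, Complex.differentiableOn_dslope univ_mem]
  exact (differentiable_ee.const_sub 1).differentiableOn

lemma two_pi_I_ne : (2 * π * I : ℂ) ≠ 0 := by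
  simp [Real.pi_ne_zero]

lemma kk_slw (a u : ℝ) (ha : a ∈ Icc (-(1/2) : ℝ) (1/2)) : kk (slw a u) ≠ 0 := by
  by_cases hw : slw a u = 0
  · rw [hw, kk_zero]; exact neg_ne_zero.2 two_pi_I_ne
  · intro h
    have h2 := kk_ne hw
    rw [h, zero_mul] at h2
    have h3 : ee (slw a u) = 1 := by linear_combination h2
    unfold ee at h3
    rw [Complex.exp_eq_one_iff] at h3
    obtain ⟨n, hn⟩ := h3
    have h4 : slw a u = n := by
      have := two_pi_I_ne
      apply mul_left_cancel₀ this
      rw [hn]; ring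
    have h5 : u = 0 := by have := congrArg Complex.im h4; simpa [slw_im] using this
    have h6 : a = n := by have := congrArg Complex.re h4; simpa [slw_re, h5] using this
    have h7 : n = 0 := by
      have h8 : (n:ℝ) < 1 := by linarith [ha.2]
      have h9 : (-1:ℝ) < n := by linarith [ha.1]
      have : n < 1 := by exact_mod_cast h8
      have : -1 < n := by exact_mod_cast h9
      omega
    apply hw; rw [h4, h7]; simp

lemma slw_ne (a u : ℝ) (ha : a ≠ 0) : slw a u ≠ 0 := by
  intro h
  have h5 : u = 0 := by have := congrArg Complex.im h; simpa [slw_im] using this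
  have h6 : a = 0 := by have := congrArg Complex.re h; simpa [slw_re, h5] using this
  exact ha h6

lemma slw_ne' (a u : ℝ) (hu : u ≠ 0) : slw a u ≠ 0 := by
  intro h
  have h5 : u = 0 := by have := congrArg Complex.im h; simpa [slw_im] using this
  exact hu h5

lemma Wg_end (x z a U : ℝ) (hx : 0 < x) (ha : a ∈ Icc (-(1/2) : ℝ) (1/2)) (hU : 1 ≤ |U|) :
    ‖Wg x z (slw a U)‖ ≤ 2 * Real.exp (-(2 * π * x) * |U|^2 + 2 * π * (x + |z|) * |U|) := by
  have hp := Real.pi_gt_three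
  have hd : 1/2 ≤ ‖1 - ee (slw a U)‖ := by
    have hn : ‖ee (slw a U)‖ = Real.exp (-2 * π * U) := by rw [norm_ee, slw_im]
    rcases le_or_gt 0 U with h | h
    · rw [abs_of_nonneg h] at hU
      have : Real.exp (-2 * π * U) ≤ 1/2 := by
        have h2 : Real.exp (-2 * π * U) * Real.exp (π/2) ≤ 1 := by
          rw [← Real.exp_add, ← Real.exp_zero]
          apply Real.exp_le_exp.2; nlinarith
        nlinarith [exp_pi_half, Real.exp_pos (-2 * π * U)]
      have h3 := norm_sub_norm_le (1:ℂ) (ee (slw a U))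
      rw [hn, norm_one] at h3
      linarith
    · rw [abs_of_neg h] at hU
      have : 2 ≤ Real.exp (-2 * π * U) := by
        refine exp_pi_half.trans ?_
        apply Real.exp_le_exp.2; nlinarith
      have h3 := norm_sub_norm_le (ee (slw a U)) (1:ℂ)
      rw [hn, norm_one, norm_sub_rev] at h3
      linarith
  unfold Wg
  rw [norm_div, norm_num_part, div_le_iff₀ (by linarith)]
  have h2 : Real.exp (-2 * π * (x * (U ^ 2 + a * U) + z * U)) ≤
      Real.exp (-(2 * π * x) * |U|^2 + 2 * π * (x + |z|) * |U|) := by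
    apply Real.exp_le_exp.2
    rw [sq_abs]
    have h3 : -(a * U) ≤ |U| := by
      refine (neg_le_abs _).trans ?_
      rw [abs_mul]
      have : |a| ≤ 1 := abs_le.2 ⟨by linarith [ha.1], by linarith [ha.2]⟩
      nlinarith [abs_nonneg U]
    have h4 : -(z * U) ≤ |z| * |U| := by rw [← abs_mul]; exact neg_le_abs _
    have h5 := mul_le_mul_of_nonneg_left h3 (by positivity : 0 ≤ π * x)
    have h6 := mul_le_mul_of_nonneg_left h4 (by positivity : 0 ≤ π)
    linarith
  have := Real.exp_pos (-(2 * π * x) * |U|^2 + 2 * π * (x + |z|) * |U|)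
  nlinarith

lemma quad_tendsto (b c : ℝ) (hb : 0 < b) : Tendsto (fun U : ℝ => Real.exp (-b * U^2 + c * U)) atTop (nhds 0) := by
  apply Real.tendsto_exp_atBot.comp
  have h1 : Tendsto (fun U : ℝ => U * (c + -b * U)) atTop atBot := by
    apply Tendsto.atTop_mul_atBot₀ tendsto_id
    apply tendsto_atBot_add_const_left
    exact tendsto_id.const_mul_atTop_of_neg (by linarith)
  refine h1.congr fun U => ?_
  ring

/-- (E1) -/
lemma Wf_E1 (x z : ℝ) (hx : 0 < x) : Wf x z = 1 + ee (x/2 + z) * Wf x (z + x) := by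
  set F : ℂ → ℂ := fun w => ee (x * w ^ 2 / 2 + z * w) with hF
  have hFd : Differentiable ℂ F := differentiable_ee.comp (by fun_prop)
  set Ω : Set ℂ := {w | kk w ≠ 0} with hΩ
  have hΩo : IsOpen Ω := isOpen_ne_fun kk_diff.continuous continuous_const
  set r : ℂ → ℂ := fun w => F w / kk w with hr
  have hrd : DifferentiableOn ℂ r Ω := hFd.differentiableOn.div kk_diff.differentiableOn (fun w hw => hw)
  have h0 : (0:ℂ) ∈ Ω := by simp only [hΩ, mem_ofPred_eq, kk_zero]; exact neg_ne_zero.2 two_pi_I_ne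
  set φ := dslope r 0 with hφ
  have hφd : DifferentiableOn ℂ φ Ω := (Complex.differentiableOn_dslope (hΩo.mem_nhds h0)).2 hrd
  have hsl : ∀ a u : ℝ, a ∈ Icc (-(1/2) : ℝ) (1/2) → slw a u ∈ Ω := fun a u ha => kk_slw a u ha
  have hr0 : r 0 = -(2 * π * I)⁻¹ := by
    simp only [hr, hF, kk_zero]; simp [ee_zero]
  have hφv : ∀ w : ℂ, w ≠ 0 → φ w = Wg x z w - r 0 * w⁻¹ := by
    intro w hw
    rw [hφ, dslope_of_ne _ hw, slope_def_field, sub_zero, sub_div, div_eq_mul_inv (r 0)]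
    congr 1
    simp only [hr]
    rw [div_div, kk_ne hw]; rfl
  have hpc := para_cauchy φ Ω hΩo hφd hsl
  -- side integrals
  have hWint : Integrable fun u : ℝ => (1 + I) * Wg x z (slw (1/2) u) := by
    refine ((integrable_Wg x (z+x) hx).const_mul (ee (x/2+z))).congr (Eventually.of_forall fun u => ?_)
    simp only
    rw [slw_shift, Wg_shift]; ring
  have hWint' := integrable_Wg x z hx
  have hinv : ∀ a : ℝ, a ≠ 0 → Continuous fun u : ℝ => (1 + I) * (slw a u)⁻¹ := fun a ha =>
    continuous_const.mul ((cont_slw a).inv₀ fun u => slw_ne a u ha)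
  have hside : ∀ a : ℝ, a ≠ 0 → Integrable (fun u : ℝ => (1 + I) * Wg x z (slw a u)) → ∀ U : ℝ,
      ∫ u in (-U)..U, (1 + I) * φ (slw a u) = (∫ u in (-U)..U, (1 + I) * Wg x z (slw a u)) -
        r 0 * ∫ u in (-U)..U, (1 + I) * (slw a u)⁻¹ := by
    intro a ha hi U
    rw [← intervalIntegral.integral_const_mul, ← intervalIntegral.integral_sub hi.intervalIntegrable
      (((hinv a ha).intervalIntegrable _ _).const_mul (r 0))]
    apply intervalIntegral.integral_congr
    intro u _
    simp only
    rw [hφv _ (slw_ne a u ha)]; ring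
  have hlim1 : Tendsto (fun U : ℝ => (∫ u in (-U)..U, (1 + I) * φ (slw (1/2) u)) -
      (∫ u in (-U)..U, (1 + I) * φ (slw (-(1/2)) u))) atTop
      (nhds (ee (x/2+z) * Wf x (z+x) - Wf x z - r 0 * (2 * π * I))) := by
    have t1 := intervalIntegral_tendsto_integral hWint tendsto_neg_atTop_atBot tendsto_id
    have t2 := intervalIntegral_tendsto_integral hWint' tendsto_neg_atTop_atBot tendsto_id
    rw [integral_half] at t1
    have t3 := (t1.sub t2).sub (log_limit.const_mul (r 0))
    refine t3.congr fun U => ?_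
    rw [hside _ (by norm_num) hWint, hside _ (by norm_num) hWint']
    simp only [id]
    ring
  have hseg : ∀ U : ℝ, 1 ≤ |U| → ‖∫ a in (-(1/2) : ℝ)..(1/2), φ (slw a U)‖ ≤
      2 * Real.exp (-(2 * π * x) * |U|^2 + 2 * π * (x + |z|) * |U|) + ‖r 0‖ * |U|⁻¹ := by
    intro U hU
    have hU0 : U ≠ 0 := by rintro rfl; norm_num at hU
    have := intervalIntegral.norm_integral_le_of_norm_le_const (a := (-(1/2):ℝ)) (b := 1/2)
      (f := fun a => φ (slw a U)) (C := 2 * Real.exp (-(2 * π * x) * |U|^2 + 2 * π * (x + |z|) * |U|) + ‖r 0‖ * |U|⁻¹)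
      (by
        intro a ha
        rw [uIoc_of_le (by norm_num)] at ha
        rw [hφv _ (slw_ne' a U hU0)]
        refine (norm_sub_le _ _).trans ?_
        apply add_le_add (Wg_end x z a U hx ⟨ha.1.le, ha.2⟩ hU)
        rw [norm_mul, norm_inv]
        have : |U| ≤ ‖slw a U‖ := by
          have := Complex.abs_im_le_norm (slw a U)
          rwa [slw_im] at this
        have : 0 < |U| := by positivity
        gcongr)
    refine this.trans (le_of_eq ?_)
    norm_num
  have hg : Tendsto (fun U : ℝ => 2 * Real.exp (-(2 * π * x) * U^2 + 2 * π * (x + |z|) * U) + ‖r 0‖ * U⁻¹) atTop (nhds 0) := by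
    have a1 := (quad_tendsto (2 * π * x) (2 * π * (x + |z|)) (by have := Real.pi_pos; positivity)).const_mul 2
    have a2 := (tendsto_inv_atTop_zero (𝕜 := ℝ)).const_mul ‖r 0‖
    simpa using a1.add a2
  have hlim2 : Tendsto (fun U : ℝ => (∫ a in (-(1/2) : ℝ)..(1/2), φ (slw a U)) -
      ∫ a in (-(1/2) : ℝ)..(1/2), φ (slw a (-U))) atTop (nhds 0) := by
    have := hg.add hg
    rw [add_zero] at this
    apply squeeze_zero_norm' _ this
    filter_upwards [eventually_ge_atTop 1] with U hU
    refine (norm_sub_le _ _).trans ?_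
    have e : |U| = U := abs_of_nonneg (by linarith)
    have b1 := hseg U (by rw [e]; exact hU)
    have b2 := hseg (-U) (by rw [abs_neg, e]; exact hU)
    rw [abs_neg] at b2
    rw [e] at b1 b2
    exact add_le_add b1 b2
  have hfin := tendsto_nhds_unique (hlim1.congr hpc) hlim2
  rw [hr0] at hfin
  have h5 := inv_mul_cancel₀ two_pi_I_ne
  linear_combination -hfin + h5


/-- real-argument version -/
noncomputable def er (t : ℝ) : ℂ := ee (t : ℂ)
lemma er_add (a b : ℝ) : er (a + b) = er a * er b := by simp [er, ee_add]
lemma er_zero : er 0 = 1 := by simp [er, ee_zero]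
lemma norm_er (t : ℝ) : ‖er t‖ = 1 := norm_ee_real t
lemma er_int (n : ℤ) : er n = 1 := by have := ee_int n; simpa [er] using this
lemma er_nat (n : ℕ) : er n = 1 := by have := er_int n; simpa using this
lemma er_neg (t : ℝ) : er (-t) = (starRingEnd ℂ) (er t) := by
  unfold er ee
  rw [← Complex.exp_conj]; congr 1; simp [Complex.conj_ofNat]
lemma continuous_er : Continuous er := continuous_ee.comp Complex.continuous_ofReal
lemma er_add_int (t : ℝ) (n : ℤ) : er (t + n) = er t := by rw [er_add, er_int, mul_one]
lemma er_congr (a b : ℝ) (n : ℤ) (h : a = b + n) : er a = er b := by rw [h, er_add_int]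
lemma hasDerivAt_er (t : ℝ) : HasDerivAt er (2 * π * I * er t) t := by
  have h1 : HasDerivAt (fun z : ℝ => (z : ℂ)) 1 t := Complex.ofRealCLM.hasDerivAt
  have := (hasDerivAt_ee (t:ℂ)).scomp t h1
  refine this.congr_deriv ?_
  simp [er]

lemma W_tele1 (x z : ℝ) (hx : 0 < x) (N : ℕ) :
    ∑ n ∈ Finset.range N, er (x * n ^ 2 / 2 + z * n) = Wf x z - er (x * N ^ 2 / 2 + z * N) * Wf x (z + N * x) := by
  induction N with
  | zero => simp [er_zero]
  | succ N ih =>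
    rw [Finset.sum_range_succ, ih, Wf_E1 x (z + N * x) hx]
    have e1 : er (x * (N + 1 : ℕ) ^ 2 / 2 + z * (N + 1 : ℕ)) = er (x * N ^ 2 / 2 + z * N) * er (x/2 + (z + N * x)) := by
      rw [← er_add]; congr 1; push_cast; ring
    have e2 : z + (N + 1 : ℕ) * x = z + N * x + x := by push_cast; ring
    rw [e1, e2]
    have e3 : ee (x/2 + (z + N * x : ℝ)) = er (x/2 + (z + N * x)) := by simp [er]
    rw [e3]; ring

lemma W_tele2 (x z : ℝ) (hx : 0 < x) (k : ℕ) :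
    Wf x (z + k) = Wf x z - ∑ i ∈ Finset.range k, kap x * er (-((z + i) ^ 2 / (2 * x))) := by
  induction k with
  | zero => simp
  | succ k ih =>
    rw [Finset.sum_range_succ]
    have := Wf_E2 x (z + k) hx
    rw [ih] at this
    have e2 : z + (k + 1 : ℕ) = z + k + 1 := by push_cast; ring
    rw [e2]
    unfold er
    unfold er at this
    linear_combination -this

/-- quadratic sum -/
noncomputable def QS (P : ℤ) (Q : ℕ) (θ : ℝ) (N : ℕ) : ℂ :=
  ∑ n ∈ Finset.range N, er (P * n ^ 2 / (2 * Q) + θ * n)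

lemma QS_fract (P : ℤ) (Q : ℕ) (θ : ℝ) (N : ℕ) : QS P Q θ N = QS P Q (Int.fract θ) N := by
  unfold QS
  apply Finset.sum_congr rfl
  intro n _
  apply er_congr _ _ (⌊θ⌋ * n)
  have := Int.floor_add_fract θ
  push_cast
  linear_combination -(n:ℝ) * this

lemma QS_shift (P m : ℤ) (Q : ℕ) (hQ : 1 ≤ Q) (θ : ℝ) (N : ℕ) : QS (P + Q * m) Q θ N = QS P Q (θ + m/2) N := by
  unfold QS
  apply Finset.sum_congr rfl
  intro n _
  obtain ⟨j, hj⟩ : (2:ℤ) ∣ n * (n - 1) := by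
    have := Int.even_mul_pred_self n
    exact this.two_dvd
  apply er_congr _ _ (m * j)
  have hj' : (n:ℝ) * (n - 1) = 2 * j := by exact_mod_cast hj
  have : (Q:ℝ) ≠ 0 := by positivity
  push_cast
  field_simp
  linear_combination (Q:ℝ) * (m:ℝ) * hj'

lemma QS_conj (P : ℤ) (Q : ℕ) (θ : ℝ) (N : ℕ) : ‖QS (-P) Q θ N‖ = ‖QS P Q (-θ) N‖ := by
  have : QS (-P) Q θ N = (starRingEnd ℂ) (QS P Q (-θ) N) := by
    unfold QS
    rw [map_sum]
    apply Finset.sum_congr rfl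
    intro n _
    rw [← er_neg]; congr 1; push_cast; ring
  rw [this, RCLike.norm_conj]

lemma QS_core (C0 Bd : ℝ) (hC0 : ∀ x z : ℝ, 0 < x → x ≤ 10 → 0 ≤ z → z ≤ 1 + x → ‖Wf x z‖ ≤ C0 * Real.sqrt (1 / x))
    (P Q : ℕ) (hP : 1 ≤ P) (hPQ : 2 * P ≤ Q)
    (ih : ∀ θ : ℝ, ∀ N ≤ P, ‖QS (-Q) P θ N‖ ≤ Bd) (θ : ℝ) (N : ℕ) (hN : N ≤ Q) :
    ‖QS P Q θ N‖ ≤ Real.sqrt (Q / P) * (2 * C0 + Bd) := by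
  rw [QS_fract]
  set t := Int.fract θ with ht
  have ht0 : 0 ≤ t := Int.fract_nonneg θ
  have ht1 : t < 1 := Int.fract_lt_one θ
  have hP0 : (0:ℝ) < P := by positivity
  have hQ0 : (0:ℝ) < Q := by
    have : 0 < Q := by omega
    positivity
  set x : ℝ := P / Q with hx
  have hx0 : 0 < x := by positivity
  have hPQ' : (2 * P : ℝ) ≤ Q := by exact_mod_cast hPQ
  have hx1 : x ≤ 1/2 := by rw [hx, div_le_iff₀ hQ0]; linarith
  have hxinv : 1 / x = Q / P := by rw [hx]; field_simp
  have e1 : QS P Q t N = ∑ n ∈ Finset.range N, er (x * n ^ 2 / 2 + t * n) := by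
    unfold QS
    apply Finset.sum_congr rfl
    intro n _
    congr 1; rw [hx]; push_cast; field_simp
  rw [e1, W_tele1 x t hx0 N]
  set y := t + N * x with hy
  have hy0 : 0 ≤ y := by positivity
  obtain ⟨k, hk⟩ : ∃ k : ℕ, ⌊y⌋ = k := ⟨⌊y⌋.toNat, by rw [Int.toNat_of_nonneg (Int.floor_nonneg.2 hy0)]⟩
  set f := Int.fract y with hf
  have hf0 : 0 ≤ f := Int.fract_nonneg y
  have hf1 : f < 1 := Int.fract_lt_one y
  have hyk : y = f + k := by
    have := Int.floor_add_fract y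
    rw [hk] at this; push_cast at this; linarith
  have hkP : k ≤ P := by
    have hN' : (N:ℝ) ≤ Q := by exact_mod_cast hN
    have : (N:ℝ) * x ≤ P := by
      calc (N:ℝ) * x ≤ Q * x := by gcongr
        _ = P := by rw [hx]; field_simp
    have : (k:ℝ) < P + 1 := by linarith
    have : k < P + 1 := by exact_mod_cast this
    omega
  rw [hyk, W_tele2 x f hx0 k]
  have hdual : ‖∑ i ∈ Finset.range k, kap x * er (-((f + i) ^ 2 / (2 * x)))‖ ≤ Real.sqrt (Q/P) * Bd := by
    rw [← Finset.mul_sum, norm_mul, norm_kap x hx0, hxinv]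
    apply mul_le_mul_of_nonneg_left _ (Real.sqrt_nonneg _)
    have e2 : ∑ i ∈ Finset.range k, er (-((f + i) ^ 2 / (2 * x))) = er (-(f ^ 2 * Q / (2 * P))) * QS (-Q) P (-(f * Q / P)) k := by
      unfold QS
      rw [Finset.mul_sum]
      apply Finset.sum_congr rfl
      intro i _
      rw [← er_add]; congr 1; rw [hx]; push_cast; field_simp; ring
    rw [e2, norm_mul, norm_er, one_mul]
    exact ih _ k hkP
  have h1 := hC0 x t hx0 (by linarith) ht0 (by linarith)
  have h2 := hC0 x f hx0 (by linarith) hf0 (by linarith)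
  rw [hxinv] at h1 h2
  calc _ ≤ ‖Wf x t‖ + ‖er (x * N ^ 2 / 2 + t * N) * (Wf x f - ∑ i ∈ Finset.range k, kap x * er (-((f + i) ^ 2 / (2 * x))))‖ := norm_sub_le _ _
    _ ≤ ‖Wf x t‖ + (‖Wf x f‖ + ‖∑ i ∈ Finset.range k, kap x * er (-((f + i) ^ 2 / (2 * x)))‖) := by
      rw [norm_mul, norm_er, one_mul]
      gcongr; exact norm_sub_le _ _
    _ ≤ _ := by linarith

lemma QS_bound : ∃ C : ℝ, 1 ≤ C ∧ ∀ Q : ℕ, 1 ≤ Q → ∀ P : ℤ, IsCoprime P Q → ∀ θ : ℝ, ∀ N ≤ Q,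
    ‖QS P Q θ N‖ ≤ C * Real.sqrt Q := by
  obtain ⟨C0, hC0, hW⟩ := Wf_B0
  set B := 8 * C0 with hB
  suffices h : ∀ Q : ℕ, 1 ≤ Q → ∀ P : ℤ, IsCoprime P Q → ∀ θ : ℝ, ∀ N ≤ Q,
      ‖QS P Q θ N‖ ≤ (1 + B) * Real.sqrt Q - B by
    refine ⟨1 + B, by linarith, fun Q hQ P hP θ N hN => (h Q hQ P hP θ N hN).trans (by linarith)⟩
  intro Q
  induction Q using Nat.strong_induction_on with
  | _ Q ih =>
  intro hQ P hPQ θ N hN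
  -- positive small case
  have hpos : ∀ P : ℕ, 1 ≤ P → 2 * P ≤ Q → IsCoprime (P:ℤ) Q → ∀ θ : ℝ, ‖QS P Q θ N‖ ≤ (1 + B) * Real.sqrt Q - B := by
    intro P hP1 hP2 hc θ
    have hP0 : (0:ℝ) < P := by positivity
    have := QS_core C0 ((1 + B) * Real.sqrt P - B) hW P Q hP1 hP2 (fun θ' N' hN' =>
      ih P (by omega) hP1 (-Q) (hc.symm.neg_left) θ' N' hN') θ N hN
    refine this.trans ?_
    have e : Real.sqrt (Q/P) * Real.sqrt P = Real.sqrt Q := by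
      rw [← Real.sqrt_mul (by positivity)]; congr 1; field_simp
    have h2 : (4/3 : ℝ) ≤ Real.sqrt (Q/P) := by
      apply Real.le_sqrt_of_sq_le
      have : (2 * P : ℝ) ≤ Q := by exact_mod_cast hP2
      rw [le_div_iff₀ hP0]; nlinarith
    have : Real.sqrt (Q/P) * (2 * C0 + ((1 + B) * Real.sqrt P - B)) = (1 + B) * Real.sqrt Q - 6 * C0 * Real.sqrt (Q/P) := by
      rw [← e, hB]; ring
    rw [this]
    nlinarith
  rcases Nat.lt_or_ge 1 Q with h1 | h1
  · set P' := P % Q with hP'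
    have hPe : P = P' + Q * (P / Q) := (Int.emod_add_mul_ediv P Q).symm
    have hc' : IsCoprime P' (Q:ℤ) := by
      rw [hPe] at hPQ
      exact IsCoprime.of_add_mul_left_left hPQ
    have hP'0 : 0 ≤ P' := Int.emod_nonneg _ (by omega)
    have hP'1 : P' < Q := Int.emod_lt_of_pos _ (by omega)
    have hne : P' ≠ 0 := by
      intro h
      rw [h] at hc'
      rw [isCoprime_zero_left, Int.isUnit_iff] at hc'
      omega
    rw [hPe, QS_shift _ _ _ hQ]
    rcases le_or_gt (2 * P') Q with h3 | h3
    · have h4 := hpos P'.toNat (by omega) (by omega) (by rw [Int.toNat_of_nonneg hP'0]; exact hc')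
      rw [Int.toNat_of_nonneg hP'0] at h4
      exact h4 _
    · have h5 : P' = -(Q - P') + Q * 1 := by ring
      rw [h5, QS_shift _ _ _ hQ, QS_conj]
      have h6 : IsCoprime ((Q:ℤ) - P') Q := by
        have := hc'.neg_left.add_mul_left_left 1
        have e : (Q:ℤ) - P' = -P' + Q * 1 := by ring
        rwa [e]
      have h7 : ((Q - P' : ℤ).toNat : ℤ) = Q - P' := Int.toNat_of_nonneg (by omega)
      have h4 := hpos (Q - P' : ℤ).toNat (by omega) (by omega) (by rw [h7]; exact h6)
      rw [h7] at h4
      exact h4 _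
  · have hQ1 : Q = 1 := by omega
    subst hQ1
    have : ‖QS P 1 θ N‖ ≤ N := by
      unfold QS
      refine (norm_sum_le _ _).trans ?_
      simp [norm_er]
    have h8 : (N:ℝ) ≤ 1 := by exact_mod_cast hN
    simp
    linarith


lemma LF : ∃ C : ℝ, 1 ≤ C ∧ ∀ (q : ℕ) (p : ℤ), 1 ≤ q → IsCoprime p (q:ℤ) → ∀ θ : ℝ, ∀ N ≤ q,
    ‖∑ n ∈ Finset.range N, er (p * n ^ 2 / q + θ * n)‖ ≤ C * Real.sqrt q := by
  obtain ⟨C, hC, h⟩ := QS_bound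
  refine ⟨2 * C, by linarith, fun q p hq hc θ N hN => ?_⟩
  have hq0 : (q:ℝ) ≠ 0 := by positivity
  rcases Nat.even_or_odd q with he | ho
  · obtain ⟨Q, hQ⟩ := he.two_dvd
    have hQ1 : 1 ≤ Q := by omega
    have hQ0 : (Q:ℝ) ≠ 0 := by positivity
    have hcQ : IsCoprime p (Q:ℤ) := by
      rw [hQ] at hc; push_cast at hc
      exact IsCoprime.of_mul_right_right hc
    have e : ∀ θ N, ∑ n ∈ Finset.range N, er (p * n ^ 2 / q + θ * n) = QS p Q θ N := by
      intro θ N; unfold QS; rw [hQ]; push_cast; rfl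
    have hsq : Real.sqrt Q ≤ Real.sqrt q := Real.sqrt_le_sqrt (by rw [hQ]; push_cast; linarith [Nat.cast_nonneg (α := ℝ) Q])
    rcases le_or_gt N Q with h1 | h1
    · rw [e]
      have := h Q hQ1 p hcQ θ N h1
      have h3 := Real.sqrt_nonneg (q:ℝ)
      nlinarith
    · obtain ⟨N', rfl⟩ := Nat.exists_eq_add_of_le h1.le
      rw [Finset.sum_range_add, e]
      have e2 : ∑ n ∈ Finset.range N', er (p * (Q + n : ℕ) ^ 2 / q + θ * (Q + n : ℕ)) =
          er (p * Q ^ 2 / q + θ * Q) * QS p Q (θ + p * (2 * Q) / q) N' := by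
        rw [← e, Finset.mul_sum]
        apply Finset.sum_congr rfl
        intro n _
        rw [← er_add]; congr 1; push_cast; field_simp; ring
      rw [e2]
      refine (norm_add_le _ _).trans ?_
      rw [norm_mul, norm_er, one_mul]
      have a1 := h Q hQ1 p hcQ θ Q le_rfl
      have a2 := h Q hQ1 p hcQ (θ + p * (2 * Q) / q) N' (by omega)
      nlinarith
  · have hc2 : IsCoprime (2 * p) (q:ℤ) := by
      apply IsCoprime.mul_left _ hc
      obtain ⟨m, hm⟩ := ho
      exact ⟨-m, 1, by rw [hm]; push_cast; ring⟩
    have := h q hq (2 * p) hc2 θ N hN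
    have e : ∑ n ∈ Finset.range N, er (p * n ^ 2 / q + θ * n) = QS (2 * p) q θ N := by
      unfold QS
      apply Finset.sum_congr rfl
      intro n _
      congr 1; push_cast; field_simp
    rw [e]
    have h3 := Real.sqrt_nonneg (q:ℝ)
    nlinarith

/-- Abel summation -/
lemma abel_bound (f g : ℕ → ℂ) (B M V : ℝ) (hB : 0 ≤ B) (N : ℕ)
    (hf : ∀ n ≤ N, ‖∑ i ∈ Finset.range n, f i‖ ≤ B)
    (hM : 0 ≤ M) (hg : ∀ n < N, ‖g n‖ ≤ M) (hV : ∑ i ∈ Finset.range (N - 1), ‖g (i + 1) - g i‖ ≤ V) :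
    ‖∑ i ∈ Finset.range N, f i * g i‖ ≤ B * (M + V) := by
  have h := Finset.sum_range_by_parts g f N
  simp only [smul_eq_mul] at h
  have e : ∑ i ∈ Finset.range N, f i * g i = ∑ i ∈ Finset.range N, g i * f i :=
    Finset.sum_congr rfl fun i _ => mul_comm _ _
  rw [e, h]
  rcases Nat.eq_zero_or_pos N with rfl | hN
  · simp at hV ⊢; positivity
  refine (norm_sub_le _ _).trans ?_
  rw [norm_mul]
  have h1 : ‖g (N - 1)‖ * ‖∑ i ∈ Finset.range N, f i‖ ≤ M * B :=
    mul_le_mul (hg _ (by omega)) (hf _ le_rfl) (norm_nonneg _) hM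
  have h2 : ‖∑ i ∈ Finset.range (N - 1), (g (i + 1) - g i) * ∑ i ∈ Finset.range (i + 1), f i‖ ≤ V * B := by
    refine (norm_sum_le _ _).trans ?_
    refine le_trans ?_ (mul_le_mul_of_nonneg_right hV hB)
    rw [Finset.sum_mul]
    apply Finset.sum_le_sum
    intro i hi
    rw [norm_mul]
    have : i + 1 ≤ N := by have := Finset.mem_range.1 hi; omega
    exact mul_le_mul_of_nonneg_left (hf _ this) (norm_nonneg _)
  linarith

lemma gaussTau_eq (p : ℤ) (q : ℕ) (m : ℤ) : gaussTau p q m = ∑ b ∈ Finset.range q, er (p * b ^ 2 / q + m / q * b) := by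
  unfold gaussTau
  apply Finset.sum_congr rfl
  intro b _
  unfold er ee
  congr 1; push_cast; ring

/-- The functional `T(Ψ) = ∑_b c_b Ψ(b/q) - τ_0 ∫_0^1 Ψ`. -/
noncomputable def TT (p : ℤ) (q : ℕ) (Ψ : ℝ → ℂ) : ℂ :=
  ∑ b ∈ Finset.range q, er (p * b ^ 2 / q) * Ψ (b / q) - gaussTau p q 0 * ∫ β in (0:ℝ)..1, Ψ β

lemma TT_bound : ∃ C : ℝ, 1 ≤ C ∧ ∀ (q : ℕ) (p : ℤ), 1 ≤ q → IsCoprime p (q:ℤ) → ∀ (m : ℤ) (Ψ : ℝ → ℂ) (M L : ℝ),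
    0 ≤ M → 0 ≤ L →
    (∀ β ∈ Icc (0:ℝ) 1, ‖Ψ β‖ ≤ M) → (∀ β ∈ Icc (0:ℝ) 1, ∀ γ ∈ Icc (0:ℝ) 1, ‖Ψ β - Ψ γ‖ ≤ L * |β - γ|) →
    ‖TT p q (fun β => er (m * β) * Ψ β)‖ ≤ C * Real.sqrt q * (M + L) := by
  obtain ⟨C, hC, h⟩ := LF
  refine ⟨2 * C, by linarith, fun q p hq hc m Ψ M L hM hL hb hlip => ?_⟩
  have hq0 : (0:ℝ) < q := by positivity
  have hs := Real.sqrt_nonneg (q:ℝ)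
  unfold TT
  refine (norm_sub_le _ _).trans ?_
  have h1 : ‖∑ b ∈ Finset.range q, er (p * b ^ 2 / q) * (er (m * (b / q)) * Ψ (b / q))‖ ≤ C * Real.sqrt q * (M + L) := by
    have := abel_bound (fun b => er (p * b ^ 2 / q + m / q * b)) (fun b => Ψ (b / q)) (C * Real.sqrt q) M L (by positivity) q
      (fun n hn => h q p hq hc _ n hn) hM (fun n hn => hb _ ⟨by positivity, by
        rw [div_le_one hq0]; exact_mod_cast hn.le⟩) (by
        refine (Finset.sum_le_card_nsmul _ _ (L / q) ?_).trans ?_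
        · intro i hi
          have hi' : i + 1 < q := by have := Finset.mem_range.1 hi; omega
          have hi'' : ((i + 1 : ℕ) : ℝ) ≤ q := by exact_mod_cast hi'.le
          push_cast at hi''
          refine (hlip _ ⟨by positivity, ?_⟩ _ ⟨by positivity, ?_⟩).trans ?_
          · rw [div_le_one hq0]; push_cast; exact hi''
          · rw [div_le_one hq0]; linarith
          · rw [← sub_div]; push_cast; rw [add_sub_cancel_left, abs_of_pos (by positivity)]
            apply le_of_eq; ring
        · rw [Finset.card_range, nsmul_eq_mul, mul_div_assoc']
          rw [div_le_iff₀ hq0, mul_comm]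
          have : ((q - 1 : ℕ) : ℝ) ≤ q := by exact_mod_cast Nat.sub_le _ _
          gcongr)
    refine le_trans (le_of_eq ?_) this
    congr 1
    apply Finset.sum_congr rfl
    intro b _
    rw [← mul_assoc, ← er_add]; congr 2; ring
  have h2 : ‖gaussTau p q 0 * ∫ β in (0:ℝ)..1, er (m * β) * Ψ β‖ ≤ C * Real.sqrt q * M := by
    rw [norm_mul, gaussTau_eq]
    have a1 := h q p hq hc ((0:ℤ)/q) q le_rfl
    have a2 := intervalIntegral.norm_integral_le_of_norm_le_const (a := (0:ℝ)) (b := 1) (f := fun β => er (m * β) * Ψ β) (C := M) (by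
      intro β hβ
      rw [uIoc_of_le (by norm_num)] at hβ
      rw [norm_mul, norm_er, one_mul]
      exact hb β ⟨hβ.1.le, hβ.2⟩)
    norm_num at a2
    exact mul_le_mul a1 a2 (norm_nonneg _) (by positivity)
  have h3 : 0 ≤ C * Real.sqrt q * L := by positivity
  linarith

lemma TT_const (p : ℤ) (q : ℕ) (c : ℂ) : TT p q (fun _ => c) = 0 := by
  unfold TT
  rw [gaussTau_eq, ← Finset.sum_mul]
  simp

lemma er_integral (l : ℤ) (hl : l ≠ 0) : ∫ β in (0:ℝ)..1, er (l * β) = 0 := by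
  have hl' : (l:ℂ) ≠ 0 := by exact_mod_cast hl
  have hd : ∀ β ∈ uIcc (0:ℝ) 1, HasDerivAt (fun β : ℝ => (2 * π * I * l)⁻¹ * er (l * β)) (er (l * β)) β := by
    intro β _
    have h1 : HasDerivAt (fun β : ℝ => (l:ℝ) * β) l β := by simpa using (hasDerivAt_id β).const_mul (l:ℝ)
    have h2 := ((hasDerivAt_er (l * β)).scomp β h1).const_mul ((2 * π * I * l : ℂ)⁻¹)
    refine h2.congr_deriv ?_
    have := two_pi_I_ne
    simp only [Complex.real_smul, Complex.ofReal_intCast]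
    field_simp
  rw [intervalIntegral.integral_eq_sub_of_hasDerivAt hd ((continuous_er.comp (by fun_prop)).intervalIntegrable _ _)]
  simp [er_int, er_zero]

lemma TT_er (p : ℤ) (q : ℕ) (l : ℤ) (hl : l ≠ 0) : TT p q (fun β => er (l * β)) = gaussTau p q l := by
  unfold TT
  rw [er_integral l hl, mul_zero, sub_zero, gaussTau_eq]
  apply Finset.sum_congr rfl
  intro b _
  rw [← er_add]; congr 1; ring

lemma TT_add (p : ℤ) (q : ℕ) (f g : ℝ → ℂ) (hf : IntervalIntegrable f volume 0 1) (hg : IntervalIntegrable g volume 0 1) :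
    TT p q (fun β => f β + g β) = TT p q f + TT p q g := by
  unfold TT
  rw [intervalIntegral.integral_add hf hg]
  simp only [mul_add, Finset.sum_add_distrib]
  ring

lemma TT_smul (p : ℤ) (q : ℕ) (c : ℂ) (f : ℝ → ℂ) :
    TT p q (fun β => c * f β) = c * TT p q f := by
  unfold TT
  rw [intervalIntegral.integral_const_mul, mul_sub, Finset.mul_sum]
  congr 1
  · apply Finset.sum_congr rfl; intro b _; ring
  · ring


noncomputable def DD (p : ℤ) (q : ℕ) (n : ℕ) (y : ℝ) : ℂ :=
  ∑ j ∈ Finset.range n, er ((j + 1) ^ 2 * (p / q + y)) - gaussTau p q 0 / q * ∫ u in (0:ℝ)..n, er (u ^ 2 * y)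

noncomputable def D0 (p : ℤ) (q : ℕ) (n : ℕ) (y : ℝ) : ℂ :=
  ∑ j ∈ Finset.range n, er (j ^ 2 * (p / q + y)) - gaussTau p q 0 / q * ∫ u in (0:ℝ)..n, er (u ^ 2 * y)

lemma DD_D0 (p : ℤ) (q : ℕ) (n : ℕ) (y : ℝ) : ‖DD p q n y - D0 p q n y‖ ≤ 2 := by
  have h := Finset.sum_range_succ (fun j : ℕ => er (j ^ 2 * (p / q + y))) n
  rw [Finset.sum_range_succ'] at h
  push_cast at h
  have : DD p q n y - D0 p q n y = er (n ^ 2 * (p / q + y)) - er (0 ^ 2 * (p/q + y)) := by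
    unfold DD D0
    linear_combination h
  rw [this]
  refine (norm_sub_le _ _).trans ?_
  rw [norm_er, norm_er]; norm_num

lemma cont_sq (y : ℝ) : Continuous fun u : ℝ => er (u ^ 2 * y) := continuous_er.comp (by fun_prop)

noncomputable def Phi (x : ℝ) (J : ℕ) (β : ℝ) : ℂ := ∑ j ∈ Finset.range J, er (x * (j + β) ^ 2 / 2)

lemma cont_ph (x c : ℝ) : Continuous fun β : ℝ => er (x * (c + β) ^ 2 / 2) := continuous_er.comp (by fun_prop)

lemma cont_Phi (x : ℝ) (J : ℕ) : Continuous (Phi x J) := by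
  unfold Phi
  exact continuous_finsetSum _ fun j _ => cont_ph x j

lemma D0_add (p : ℤ) (q : ℕ) (n m : ℕ) (y : ℝ) : D0 p q (n + m) y = D0 p q n y +
    (∑ b ∈ Finset.range m, er ((n + b) ^ 2 * (p / q + y)) - gaussTau p q 0 / q * ∫ u in (n:ℝ)..(n + m : ℝ), er (u ^ 2 * y)) := by
  unfold D0
  rw [Finset.sum_range_add]
  have := intervalIntegral.integral_add_adjacent_intervals ((cont_sq y).intervalIntegrable (μ := volume) 0 n)
    ((cont_sq y).intervalIntegrable (μ := volume) n (n + m))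
  push_cast
  rw [← this]
  ring

lemma er_block (p : ℤ) (q : ℕ) (hq : 1 ≤ q) (y : ℝ) (J b : ℕ) :
    er (((J * q : ℕ) + b) ^ 2 * (p / q + y)) = er (p * b ^ 2 / q) * er (y * ((J * q : ℕ) + b) ^ 2) := by
  have hq0 : (q:ℝ) ≠ 0 := by positivity
  rw [← er_add]
  apply er_congr _ _ (p * (J ^ 2 * q + 2 * J * b))
  push_cast
  field_simp
  ring

lemma D0_mul (p : ℤ) (q : ℕ) (hq : 1 ≤ q) (J : ℕ) (y : ℝ) : D0 p q (J * q) y = TT p q (Phi (2 * y * q ^ 2) J) := by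
  have hq0 : (q:ℝ) ≠ 0 := by positivity
  have hq0' : (q:ℂ) ≠ 0 := by exact_mod_cast hq0
  induction J with
  | zero => simp [D0, TT, Phi]
  | succ J ih =>
    have e : (J + 1) * q = J * q + q := by ring
    rw [e, D0_add, ih]
    have e2 : Phi (2 * y * q ^ 2) (J + 1) = fun β => Phi (2 * y * q ^ 2) J β + er (2 * y * q ^ 2 * (J + β) ^ 2 / 2) := by
      ext β; unfold Phi; rw [Finset.sum_range_succ]
    rw [e2, TT_add _ _ _ _ ((cont_Phi _ _).intervalIntegrable _ _) ((cont_ph _ _).intervalIntegrable _ _)]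
    congr 1
    unfold TT
    congr 1
    · apply Finset.sum_congr rfl
      intro b _
      rw [er_block p q hq]
      congr 2
      push_cast; field_simp
    · have := intervalIntegral.smul_integral_comp_add_mul (a := 0) (b := 1) (fun u : ℝ => er (u ^ 2 * y)) (q:ℝ) ((J * q : ℕ) : ℝ)
      rw [mul_zero, add_zero, mul_one, Complex.real_smul] at this
      rw [← this, Complex.ofReal_natCast, ← mul_assoc, div_mul_cancel₀ _ hq0']
      congr 1
      apply intervalIntegral.integral_congr
      intro β _
      simp only
      congr 1
      push_cast; ring

lemma er_lip (a b : ℝ) : ‖er a - er b‖ ≤ 2 * π * |a - b| := by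
  have := convex_univ.norm_image_sub_le_of_norm_hasDerivWithin_le (s := (univ : Set ℝ))
    (f := er) (f' := fun t => 2 * π * I * er t) (C := 2 * π) (x := b) (y := a)
    (fun t _ => (hasDerivAt_er t).hasDerivWithinAt) (fun t _ => by
      rw [norm_mul, norm_er]; simp [abs_of_pos Real.pi_pos]) (mem_univ _) (mem_univ _)
  simpa using this

/-- remainder block -/
lemma rem_bound : ∃ C : ℝ, 1 ≤ C ∧ ∀ (q : ℕ) (p : ℤ), 1 ≤ q → IsCoprime p (q:ℤ) → ∀ (y : ℝ), |y| ≤ 5 / q ^ 2 →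
    ∀ n : ℕ, ‖DD p q n y - TT p q (Phi (2 * y * q ^ 2) (n / q))‖ ≤ C * Real.sqrt q := by
  obtain ⟨C, hC, h⟩ := LF
  refine ⟨C * (1 + 20 * π) + C + 2, by have := Real.pi_pos; nlinarith, fun q p hq hc y hy n => ?_⟩
  have hp := Real.pi_pos
  have hq0 : (0:ℝ) < q := by positivity
  have hs1 : 1 ≤ Real.sqrt q := Real.one_le_sqrt.2 (by exact_mod_cast hq)
  set J := n / q with hJ
  set r := n % q with hr
  have hrq : r < q := Nat.mod_lt _ hq
  have hn : n = J * q + r := by rw [hJ, hr]; exact (Nat.div_add_mod' n q).symm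
  have h1 := DD_D0 p q n y
  have h2 : D0 p q n y - TT p q (Phi (2 * y * q ^ 2) J) =
      ∑ b ∈ Finset.range r, er (((J * q : ℕ) + b) ^ 2 * (p / q + y)) - gaussTau p q 0 / q * ∫ u in ((J * q : ℕ):ℝ)..((J * q : ℕ) + r : ℝ), er (u ^ 2 * y) := by
    rw [← D0_mul p q hq]
    conv_lhs => rw [hn]
    rw [D0_add]; ring
  have h3 : ‖∑ b ∈ Finset.range r, er (((J * q : ℕ) + b) ^ 2 * (p / q + y))‖ ≤ C * Real.sqrt q * (1 + 20 * π) := by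
    have e : ∑ b ∈ Finset.range r, er (((J * q : ℕ) + b) ^ 2 * (p / q + y)) =
        er (y * (J * q) ^ 2) * ∑ b ∈ Finset.range r, er (p * b ^ 2 / q + (2 * y * J * q) * b) * er (y * b ^ 2) := by
      rw [Finset.mul_sum]
      apply Finset.sum_congr rfl
      intro b _
      rw [er_block p q hq, ← er_add, ← er_add, ← er_add]
      congr 1; push_cast; ring
    rw [e, norm_mul, norm_er, one_mul]
    apply abel_bound _ _ _ _ _ (by positivity)
    · intro m hm
      exact h q p hq hc _ m (by omega)
    · norm_num
    · intro m _; rw [norm_er]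
    · refine (Finset.sum_le_card_nsmul _ _ (20 * π / q) ?_).trans ?_
      · intro i hi
        have hi' : i + 1 < q := by have := Finset.mem_range.1 hi; omega
        have hi'' : ((i + 1 : ℕ) : ℝ) ≤ q := by exact_mod_cast hi'.le
        push_cast at hi''
        refine (er_lip _ _).trans ?_
        have e3 : y * ((i + 1 : ℕ) : ℝ) ^ 2 - y * (i:ℝ) ^ 2 = y * (2 * i + 1) := by push_cast; ring
        rw [e3, abs_mul, abs_of_nonneg (by positivity : (0:ℝ) ≤ 2 * i + 1)]
        calc 2 * π * (|y| * (2 * i + 1)) ≤ 2 * π * (5 / q ^ 2 * (2 * q)) := by gcongr; linarith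
          _ = _ := by field_simp; ring
      · rw [Finset.card_range, nsmul_eq_mul, mul_div_assoc']
        rw [div_le_iff₀ hq0, mul_comm]
        have : ((r - 1 : ℕ) : ℝ) ≤ q := by exact_mod_cast (by omega : r - 1 ≤ q)
        gcongr
  have h4 : ‖gaussTau p q 0 / q * ∫ u in ((J * q : ℕ):ℝ)..((J * q : ℕ) + r : ℝ), er (u ^ 2 * y)‖ ≤ C * Real.sqrt q := by
    have a1 := h q p hq hc ((0:ℤ)/q) q le_rfl
    rw [← gaussTau_eq] at a1
    have a2 := intervalIntegral.norm_integral_le_of_norm_le_const (a := ((J * q : ℕ):ℝ)) (b := ((J * q : ℕ) + r : ℝ)) (f := fun u => er (u ^ 2 * y)) (C := 1) (by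
      intro β hβ; rw [norm_er])
    rw [add_sub_cancel_left, one_mul, Nat.abs_cast] at a2
    rw [norm_mul, norm_div, Complex.norm_natCast, div_mul_eq_mul_div, div_le_iff₀ hq0]
    apply mul_le_mul a1 (a2.trans _) (norm_nonneg _) (by positivity)
    exact_mod_cast hrq.le
  calc _ = ‖(DD p q n y - D0 p q n y) + (D0 p q n y - TT p q (Phi (2 * y * q ^ 2) J))‖ := by congr 1; ring
    _ ≤ 2 + (C * Real.sqrt q * (1 + 20 * π) + C * Real.sqrt q) := by
      refine (norm_add_le _ _).trans (add_le_add h1 ?_)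
      rw [h2]
      exact (norm_sub_le _ _).trans (add_le_add h3 h4)
    _ ≤ _ := by nlinarith


noncomputable def psi (ξ : ℝ) : ℂ := -(kk (ξ : ℂ))⁻¹

lemma kk_real (ξ : ℝ) (h : ξ ∈ Icc (-(1/2):ℝ) (1/2)) : kk (ξ:ℂ) ≠ 0 := by
  have := kk_slw ξ 0 h
  simpa [slw] using this

lemma psi_eq (ξ : ℝ) (h : ξ ∈ Icc (-(1/2):ℝ) (1/2)) : (ξ:ℂ) = psi ξ * (er ξ - 1) := by
  by_cases h0 : ξ = 0
  · subst h0; simp [er_zero]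
  · have h1 : (ξ:ℂ) ≠ 0 := by exact_mod_cast h0
    have h2 := kk_ne h1
    have h3 := kk_real ξ h
    unfold psi er
    field_simp
    linear_combination h2

lemma psi_bound : ∃ K : ℝ, 0 < K ∧ (∀ ξ ∈ Icc (-(1/2):ℝ) (1/2), ‖psi ξ‖ ≤ K) ∧
    ∀ ξ ∈ Icc (-(1/2):ℝ) (1/2), ∀ η ∈ Icc (-(1/2):ℝ) (1/2), ‖psi ξ - psi η‖ ≤ K * |ξ - η| := by
  have hkc : ContDiff ℂ 1 kk := kk_diff.contDiff
  have hdc : Continuous (deriv kk) := hkc.continuous_deriv (by norm_num)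
  have hk : Continuous fun ξ : ℝ => kk (ξ:ℂ) := kk_diff.continuous.comp Complex.continuous_ofReal
  have hd : Continuous fun ξ : ℝ => deriv kk (ξ:ℂ) := hdc.comp Complex.continuous_ofReal
  have c1 : ContinuousOn psi (Icc (-(1/2):ℝ) (1/2)) := by
    unfold psi
    exact (hk.continuousOn.inv₀ fun ξ hξ => kk_real ξ hξ).neg
  have c2 : ContinuousOn (fun ξ : ℝ => deriv kk (ξ:ℂ) / (kk ξ) ^ 2) (Icc (-(1/2):ℝ) (1/2)) :=
    hd.continuousOn.div (hk.pow 2).continuousOn fun ξ hξ => pow_ne_zero 2 (kk_real ξ hξ)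
  obtain ⟨K1, h1⟩ := isCompact_Icc.exists_bound_of_continuousOn c1
  obtain ⟨K2, h2⟩ := isCompact_Icc.exists_bound_of_continuousOn c2
  refine ⟨max (max K1 K2) 1, by positivity, fun ξ hξ => (h1 ξ hξ).trans ((le_max_left _ _).trans (le_max_left _ _)), ?_⟩
  intro ξ hξ η hη
  have := (convex_Icc (-(1/2):ℝ) (1/2)).norm_image_sub_le_of_norm_hasDerivWithin_le
    (f := psi) (f' := fun ξ : ℝ => deriv kk (ξ:ℂ) / (kk ξ) ^ 2) (C := max (max K1 K2) 1) (x := η) (y := ξ)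
    (fun t ht => by
      have a1 : HasDerivAt (fun z : ℝ => (z : ℂ)) 1 t := Complex.ofRealCLM.hasDerivAt
      have a2 := (kk_diff (t:ℂ)).hasDerivAt.scomp t a1
      have a3 := (a2.inv (kk_real t ht)).neg
      refine (a3.congr_deriv ?_).hasDerivWithinAt
      simp [neg_div]) (fun t ht => (h2 t ht).trans ((le_max_right _ _).trans (le_max_left _ _))) hη hξ
  simpa using this

lemma Phi_deriv_bound : ∃ K : ℝ, 0 < K ∧ ∀ (x : ℝ) (J : ℕ), |x| * J ≤ 1/4 → ∀ β ∈ Icc (0:ℝ) 1,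
    ‖∑ j ∈ Finset.range J, ((x * (j + β) : ℝ) : ℂ) * er (x * (j + β) ^ 2 / 2)‖ ≤ K := by
  obtain ⟨K, hK, hb, hl⟩ := psi_bound
  refine ⟨2 * (K + K) + 1, by positivity, fun x J hxJ β hβ => ?_⟩
  rcases Nat.eq_zero_or_pos J with rfl | hJ
  · simp; positivity
  have hJ1 : (1:ℝ) ≤ J := by exact_mod_cast hJ
  have hx0 := abs_nonneg x
  have hx : |x| ≤ 1/4 := by nlinarith
  set E : ℕ → ℂ := fun j => er (x * (j + β) ^ 2 / 2) with hE
  set ξ : ℕ → ℝ := fun j => x * (j + β) + x / 2 with hξ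
  have hmem : ∀ j < J, ξ j ∈ Icc (-(1/2):ℝ) (1/2) := by
    intro j hj
    rw [mem_Icc, ← abs_le]
    have e : ξ j = x * (j + β + 1/2) := by simp only [hξ]; ring
    rw [e, abs_mul, abs_of_nonneg (by have := hβ.1; positivity : (0:ℝ) ≤ j + β + 1/2)]
    have : ((j + 1 : ℕ):ℝ) ≤ J := by exact_mod_cast hj
    push_cast at this
    have h3 : (j:ℝ) + β + 1/2 ≤ J + 1/2 := by linarith [hβ.2]
    nlinarith [mul_le_mul_of_nonneg_left h3 hx0]
  have hkey : ∀ j < J, ((ξ j : ℝ) : ℂ) * E j = (E (j+1) - E j) * psi (ξ j) := by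
    intro j hj
    have h1 := psi_eq _ (hmem j hj)
    have h2 : E (j+1) = er (ξ j) * E j := by
      simp only [hE, hξ]; rw [← er_add]; congr 1; push_cast; ring
    rw [h2]
    linear_combination (E j) * h1
  have hsum : ∑ j ∈ Finset.range J, ((x * (j + β) : ℝ) : ℂ) * er (x * (j + β) ^ 2 / 2) =
      ∑ j ∈ Finset.range J, (E (j+1) - E j) * psi (ξ j) - (x/2) * ∑ j ∈ Finset.range J, E j := by
    rw [Finset.mul_sum, ← Finset.sum_sub_distrib]
    apply Finset.sum_congr rfl
    intro j hj
    rw [← hkey j (Finset.mem_range.1 hj)]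
    simp only [hE, hξ]; push_cast; ring
  rw [hsum]
  refine (norm_sub_le _ _).trans ?_
  have hEn : ∀ j, ‖E j‖ = 1 := fun j => norm_er _
  have a1 : ‖∑ j ∈ Finset.range J, (E (j+1) - E j) * psi (ξ j)‖ ≤ 2 * (K + K) := by
    apply abel_bound _ _ _ _ _ (by norm_num)
    · intro n _
      rw [Finset.sum_range_sub]
      refine (norm_sub_le _ _).trans ?_
      rw [hEn, hEn]; norm_num
    · exact hK.le
    · intro n hn; exact hb _ (hmem n hn)
    · refine (Finset.sum_le_card_nsmul _ _ (K * |x|) ?_).trans ?_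
      · intro i hi
        have hi' : i + 1 < J := by have := Finset.mem_range.1 hi; omega
        refine (hl _ (hmem _ hi') _ (hmem _ (by omega))).trans (le_of_eq ?_)
        congr 2; simp only [hξ]; push_cast; ring
      · rw [Finset.card_range, nsmul_eq_mul]
        have : ((J - 1 : ℕ) : ℝ) ≤ J := by exact_mod_cast Nat.sub_le _ _
        calc ((J - 1 : ℕ) : ℝ) * (K * |x|) ≤ J * (K * |x|) := by gcongr
          _ = K * (|x| * J) := by ring
          _ ≤ K := by nlinarith
  have a2 : ‖(x/2 : ℂ) * ∑ j ∈ Finset.range J, E j‖ ≤ 1 := by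
    have b1 : ‖∑ j ∈ Finset.range J, E j‖ ≤ J := by
      refine (norm_sum_le _ _).trans ?_
      simp [hEn]
    have b2 : ‖(x/2 : ℂ)‖ = |x|/2 := by simp
    rw [norm_mul, b2]
    nlinarith [norm_nonneg (∑ j ∈ Finset.range J, E j)]
  linarith

lemma Phi_lip : ∃ K : ℝ, 0 < K ∧ ∀ (x : ℝ) (J : ℕ), |x| * J ≤ 1/4 → ∀ β ∈ Icc (0:ℝ) 1, ∀ γ ∈ Icc (0:ℝ) 1,
    ‖Phi x J β - Phi x J γ‖ ≤ K * |β - γ| := by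
  obtain ⟨K, hK, h⟩ := Phi_deriv_bound
  refine ⟨2 * π * K, by have := Real.pi_pos; positivity, fun x J hxJ β hβ γ hγ => ?_⟩
  have := (convex_Icc (0:ℝ) 1).norm_image_sub_le_of_norm_hasDerivWithin_le
    (f := Phi x J) (f' := fun β : ℝ => 2 * π * I * ∑ j ∈ Finset.range J, ((x * (j + β) : ℝ) : ℂ) * er (x * (j + β) ^ 2 / 2))
    (C := 2 * π * K) (x := γ) (y := β)
    (fun t ht => by
      apply HasDerivAt.hasDerivWithinAt
      unfold Phi
      rw [Finset.mul_sum]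
      apply HasDerivAt.fun_sum
      intro j _
      have b1 : HasDerivAt (fun β : ℝ => x * (j + β) ^ 2 / 2) (x * (j + t)) t := by
        have := ((((hasDerivAt_id t).const_add (j:ℝ)).pow 2).const_mul x).div_const 2
        refine this.congr_deriv ?_
        simp; ring
      have b2 := (hasDerivAt_er (x * (j + t) ^ 2 / 2)).scomp t b1
      refine b2.congr_deriv ?_
      simp only [Complex.real_smul]; ring) (fun t ht => by
      rw [norm_mul]
      have e : ‖(2 * π * I : ℂ)‖ = 2 * π := by simp [abs_of_pos Real.pi_pos]
      rw [e]
      have := Real.pi_pos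
      exact mul_le_mul_of_nonneg_left (h x J hxJ t ht) (by positivity)) hγ hβ
  simpa using this

lemma DD_small : ∃ C : ℝ, 1 ≤ C ∧ ∀ (q : ℕ) (p : ℤ), 1 ≤ q → IsCoprime p (q:ℤ) → ∀ (y : ℝ), |y| ≤ 5 / q ^ 2 →
    ∀ n : ℕ, 8 * |y| * n * q ≤ 1 → ‖DD p q n y‖ ≤ C * Real.sqrt q := by
  obtain ⟨C1, hC1, h1⟩ := rem_bound
  obtain ⟨C2, hC2, h2⟩ := TT_bound
  obtain ⟨K, hK, h3⟩ := Phi_lip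
  refine ⟨C1 + C2 * (K + K), by nlinarith, fun q p hq hc y hy n hn => ?_⟩
  have hq0 : (0:ℝ) < q := by positivity
  have hs := Real.sqrt_nonneg (q:ℝ)
  set x := 2 * y * q ^ 2 with hx
  set J := n / q with hJ
  have hxJ : |x| * J ≤ 1/4 := by
    have e : |x| = 2 * |y| * q ^ 2 := by
      rw [hx, abs_mul, abs_mul, abs_of_pos (by positivity : (0:ℝ) < (q:ℝ)^2)]; norm_num
    have : (J:ℝ) * q ≤ n := by exact_mod_cast Nat.div_mul_le_self n q
    rw [e]
    have h5 : 0 ≤ |y| * q := by positivity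
    nlinarith [mul_le_mul_of_nonneg_left this h5]
  have hlip := h3 x J hxJ
  have e1 : TT p q (Phi x J) = TT p q (fun β => er ((0:ℤ) * β) * (Phi x J β - Phi x J 0)) := by
    have e2 : (fun β => er ((0:ℤ) * β) * (Phi x J β - Phi x J 0)) = fun β => Phi x J β + (- Phi x J 0) := by
      ext β; simp [er_zero]; ring
    rw [e2, TT_add _ _ _ _ ((cont_Phi _ _).intervalIntegrable _ _) (continuous_const.intervalIntegrable _ _), TT_const, add_zero]
  have a1 := h2 q p hq hc 0 (fun β => Phi x J β - Phi x J 0) K K hK.le hK.le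
    (fun β hβ => (hlip β hβ 0 ⟨le_rfl, zero_le_one⟩).trans (by
      rw [sub_zero, abs_of_nonneg hβ.1]; nlinarith [hβ.2]))
    (fun β hβ γ hγ => by simpa using hlip β hβ γ hγ)
  rw [← e1] at a1
  have a2 := h1 q p hq hc y hy n
  calc ‖DD p q n y‖ = ‖(DD p q n y - TT p q (Phi x J)) + TT p q (Phi x J)‖ := by congr 1; ring
    _ ≤ C1 * Real.sqrt q + C2 * Real.sqrt q * (K + K) := (norm_add_le _ _).trans (add_le_add a2 a1)
    _ = _ := by ring


noncomputable def Gz (x ζ β : ℝ) : ℂ := er (ζ * β + x * β ^ 2 / 2) * Wf x (x * β + ζ)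

lemma Phi_dual (x ζ β : ℝ) (J k : ℕ) (hx : 0 < x) (h : J * x = k + ζ) :
    Phi x J β = Gz x 0 β + (- er (x * J ^ 2 / 2)) * (er ((k:ℤ) * β) * Gz x ζ β) +
      kap x * ∑ i ∈ Finset.range k, er (-((i + 1) ^ 2 / (2 * x))) * er (((i + 1 : ℕ) : ℤ) * β) := by
  have h1 := W_tele1 x (x * β) hx J
  have h2 := W_tele2 x (x * β + ζ) hx k
  have e0 : x * β + J * x = x * β + ζ + k := by rw [h]; ring
  rw [e0, h2] at h1
  have e1 : Phi x J β = er (x * β ^ 2 / 2) * ∑ n ∈ Finset.range J, er (x * n ^ 2 / 2 + x * β * n) := by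
    unfold Phi
    rw [Finset.mul_sum]
    apply Finset.sum_congr rfl
    intro j _
    rw [← er_add]; congr 1; ring
  rw [e1, h1]
  have e2 : ∑ i ∈ Finset.range k, er (-((i + 1) ^ 2 / (2 * x))) * er (((i + 1 : ℕ) : ℤ) * β) =
      ∑ i ∈ Finset.range k, er (x * β ^ 2 / 2) * er (x * J ^ 2 / 2 + x * β * J) * er (-((x * β + ζ + i) ^ 2 / (2 * x))) := by
    rw [← Finset.sum_range_reflect]
    apply Finset.sum_congr rfl
    intro i hi
    have hik : i < k := Finset.mem_range.1 hi
    obtain ⟨m, hm⟩ : ∃ m : ℕ, k = i + 1 + m := Nat.exists_eq_add_of_lt hik |>.imp fun m hm => by omega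
    have e3 : k - 1 - i = m := by omega
    rw [e3, ← er_add, ← er_add, ← er_add]
    symm
    apply er_congr _ _ ((m + 1) * J)
    have hk : (k:ℝ) = i + 1 + m := by rw [hm]; push_cast; ring
    have hz : ζ = J * x - (i + 1 + m) := by rw [← hk]; linarith
    rw [hz]
    push_cast
    field_simp
    ring
  rw [e2]
  unfold Gz
  rw [mul_sub, add_zero, zero_mul, zero_add]
  have e4 : er (ζ * β + x * β ^ 2 / 2) * er ((k:ℤ) * β) = er (x * β ^ 2 / 2) * er (x * β * J) := by
    rw [← er_add, ← er_add]; congr 1; push_cast; linear_combination -β * h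
  have e5 : er (x * J ^ 2 / 2 + x * β * J) = er (x * J ^ 2 / 2) * er (x * β * J) := er_add _ _
  rw [← Finset.mul_sum, e5]
  rw [← Finset.mul_sum]
  linear_combination (-er (x * J ^ 2 / 2) * Wf x (x * β + ζ)) * (-e4)

lemma Gz_bound : ∃ K : ℝ, 0 < K ∧ ∀ x ζ : ℝ, 0 < x → x ≤ 10 → 0 ≤ ζ → ζ ≤ 1 →
    (∀ β ∈ Icc (0:ℝ) 1, ‖Gz x ζ β‖ ≤ K * Real.sqrt (1/x)) ∧
    (∀ β ∈ Icc (0:ℝ) 1, ∀ γ ∈ Icc (0:ℝ) 1, ‖Gz x ζ β - Gz x ζ γ‖ ≤ K * Real.sqrt (1/x) * |β - γ|) := by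
  obtain ⟨C0, hC0, h0⟩ := Wf_B0
  obtain ⟨C1, hC1, h1⟩ := Wf_B1
  have hp := Real.pi_pos
  refine ⟨C0 + 22 * π * C0 + 4 * C1, by positivity, fun x ζ hx hx' hz hz' => ?_⟩
  have hs : 0 ≤ Real.sqrt (1/x) := Real.sqrt_nonneg _
  have hs1 : (1:ℝ) ≤ 4 * Real.sqrt (1/x) := by
    have : Real.sqrt (1/16) ≤ Real.sqrt (1/x) := Real.sqrt_le_sqrt (by
      apply one_div_le_one_div_of_le hx; linarith)
    have h4 : Real.sqrt (1/16) = 1/4 := by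
      rw [show (1/16 : ℝ) = (1/4)^2 by norm_num]; exact Real.sqrt_sq (by norm_num)
    linarith
  have hm : ∀ β ∈ Icc (0:ℝ) 1, x * β + ζ ∈ Icc 0 (1 + x) := fun β hβ =>
    ⟨by have := hβ.1; positivity, by nlinarith [hβ.2]⟩
  have hW : ∀ β ∈ Icc (0:ℝ) 1, ‖Wf x (x * β + ζ)‖ ≤ C0 * Real.sqrt (1/x) := fun β hβ =>
    h0 x _ hx hx' (hm β hβ).1 (hm β hβ).2
  constructor
  · intro β hβ
    unfold Gz
    rw [norm_mul, norm_er, one_mul]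
    refine (hW β hβ).trans ?_
    have : 0 ≤ (22 * π * C0 + 4 * C1) * Real.sqrt (1/x) := by positivity
    linarith
  · intro β hβ γ hγ
    unfold Gz
    have e : er (ζ * β + x * β ^ 2 / 2) * Wf x (x * β + ζ) - er (ζ * γ + x * γ ^ 2 / 2) * Wf x (x * γ + ζ) =
        (er (ζ * β + x * β ^ 2 / 2) - er (ζ * γ + x * γ ^ 2 / 2)) * Wf x (x * β + ζ) +
        er (ζ * γ + x * γ ^ 2 / 2) * (Wf x (x * β + ζ) - Wf x (x * γ + ζ)) := by ring
    rw [e]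
    refine (norm_add_le _ _).trans ?_
    rw [norm_mul, norm_mul, norm_er, one_mul]
    have a1 : ‖er (ζ * β + x * β ^ 2 / 2) - er (ζ * γ + x * γ ^ 2 / 2)‖ ≤ 22 * π * |β - γ| := by
      refine (er_lip _ _).trans ?_
      have e2 : ζ * β + x * β ^ 2 / 2 - (ζ * γ + x * γ ^ 2 / 2) = (ζ + x * (β + γ) / 2) * (β - γ) := by ring
      rw [e2, abs_mul, abs_of_nonneg (by have := hβ.1; have := hγ.1; positivity)]
      have : ζ + x * (β + γ) / 2 ≤ 11 := by nlinarith [hβ.2, hγ.2, hβ.1, hγ.1]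
      calc 2 * π * ((ζ + x * (β + γ) / 2) * |β - γ|) ≤ 2 * π * (11 * |β - γ|) := by gcongr
        _ = _ := by ring
    have a2 : ‖Wf x (x * β + ζ) - Wf x (x * γ + ζ)‖ ≤ C1 * |β - γ| := by
      refine (h1 x _ _ hx hx' (hm β hβ) (hm γ hγ)).trans (le_of_eq ?_)
      have e3 : x * β + ζ - (x * γ + ζ) = x * (β - γ) := by ring
      rw [e3, abs_mul, abs_of_pos hx, mul_div_cancel_left₀ _ hx.ne']
    have hab := abs_nonneg (β - γ)
    calc _ ≤ 22 * π * |β - γ| * (C0 * Real.sqrt (1/x)) + C1 * |β - γ| := by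
          apply add_le_add _ a2
          exact mul_le_mul a1 (hW β hβ) (norm_nonneg _) (by positivity)
      _ ≤ 22 * π * |β - γ| * (C0 * Real.sqrt (1/x)) + C1 * |β - γ| * (4 * Real.sqrt (1/x)) := by
          have : 0 ≤ C1 * |β - γ| := by positivity
          nlinarith
      _ ≤ _ := by
          have : 0 ≤ C0 * Real.sqrt (1/x) * |β - γ| := by positivity
          linarith

lemma Gz_cont (x ζ : ℝ) (hx : 0 < x) (hx' : x ≤ 10) (hz : 0 ≤ ζ) (hz' : ζ ≤ 1) : ContinuousOn (Gz x ζ) (Icc 0 1) := by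
  obtain ⟨K, hK, h⟩ := Gz_bound
  have h2 := (h x ζ hx hx' hz hz').2
  have : LipschitzOnWith (Real.toNNReal (K * Real.sqrt (1/x))) (Gz x ζ) (Icc 0 1) := by
    apply LipschitzOnWith.of_dist_le_mul
    intro β hβ γ hγ
    rw [dist_eq_norm, Real.dist_eq, Real.coe_toNNReal _ (by positivity)]
    exact h2 β hβ γ hγ
  exact this.continuousOn

lemma TT_sum (p : ℤ) (q : ℕ) (k : ℕ) (c : ℕ → ℂ) :
    TT p q (fun β => ∑ i ∈ Finset.range k, c i * er (((i + 1 : ℕ) : ℤ) * β)) =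
    ∑ i ∈ Finset.range k, c i * gaussTau p q ((i + 1 : ℕ) : ℤ) := by
  induction k with
  | zero => simp [TT_const]
  | succ k ih =>
    simp_rw [Finset.sum_range_succ]
    have hc : ∀ i : ℕ, Continuous fun β : ℝ => c i * er (((i + 1 : ℕ) : ℤ) * β) := fun i =>
      continuous_const.mul (continuous_er.comp (by fun_prop))
    rw [TT_add _ _ _ _ ((continuous_finsetSum _ fun i _ => hc i).intervalIntegrable _ _) ((hc k).intervalIntegrable _ _), ih, TT_smul, TT_er]
    exact_mod_cast Nat.succ_ne_zero k

/-- The dual sum -/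
noncomputable def dual (p : ℤ) (q : ℕ) (n : ℕ) (y : ℝ) : ℂ :=
  kap (2 * y * q ^ 2) * ∑ i ∈ Finset.range ⌊(n / q : ℕ) * (2 * y * q ^ 2)⌋₊,
    er (-((i + 1) ^ 2 / (2 * (2 * y * q ^ 2)))) * gaussTau p q ((i + 1 : ℕ) : ℤ)

lemma DD_dual0 : ∃ C : ℝ, 1 ≤ C ∧ ∀ (q : ℕ) (p : ℤ), 1 ≤ q → IsCoprime p (q:ℤ) → ∀ (y : ℝ), 0 < y → y ≤ 5 / q ^ 2 →
    ∀ n : ℕ, ‖DD p q n y - dual p q n y‖ ≤ C * (Real.sqrt q + Real.sqrt q * Real.sqrt (1/(2 * y * q ^ 2))) := by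
  obtain ⟨C1, hC1, h1⟩ := rem_bound
  obtain ⟨C2, hC2, h2⟩ := TT_bound
  obtain ⟨K, hK, h3⟩ := Gz_bound
  refine ⟨C1 + 4 * C2 * K, by nlinarith [mul_pos (by linarith : 0 < C2) hK], fun q p hq hc y hy hy' n => ?_⟩
  have hq0 : (0:ℝ) < q := by positivity
  have hs := Real.sqrt_nonneg (q:ℝ)
  have a0 := h1 q p hq hc y (by rwa [abs_of_pos hy]) n
  unfold dual
  set x := 2 * y * q ^ 2 with hx
  have hx0 : 0 < x := by positivity
  have hx10 : x ≤ 10 := by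
    rw [le_div_iff₀ (by positivity)] at hy'; rw [hx]; linarith
  set J := n / q with hJ
  set k := ⌊(J:ℝ) * x⌋₊ with hk
  set ζ := (J:ℝ) * x - k with hζ
  have hz0 : 0 ≤ ζ := by rw [hζ, sub_nonneg]; exact Nat.floor_le (by positivity)
  have hz1 : ζ ≤ 1 := by rw [hζ]; have := Nat.lt_floor_add_one ((J:ℝ) * x); linarith
  have hfun : Phi x J = fun β => (Gz x 0 β + (- er (x * J ^ 2 / 2)) * (er ((k:ℤ) * β) * Gz x ζ β)) +
      kap x * ∑ i ∈ Finset.range k, er (-((i + 1) ^ 2 / (2 * x))) * er (((i + 1 : ℕ) : ℤ) * β) := by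
    ext β; exact Phi_dual x ζ β J k hx0 (by rw [hζ]; ring)
  have i1 : IntervalIntegrable (Gz x 0) volume 0 1 := by
    apply ContinuousOn.intervalIntegrable
    rw [uIcc_of_le zero_le_one]; exact Gz_cont x 0 hx0 hx10 le_rfl zero_le_one
  have i2 : IntervalIntegrable (fun β => er ((k:ℤ) * β) * Gz x ζ β) volume 0 1 := by
    apply ContinuousOn.intervalIntegrable
    rw [uIcc_of_le zero_le_one]
    exact (continuous_er.comp (by fun_prop)).continuousOn.mul (Gz_cont x ζ hx0 hx10 hz0 hz1)
  have i3 : Continuous fun β : ℝ => kap x * ∑ i ∈ Finset.range k, er (-((i + 1) ^ 2 / (2 * x))) * er (((i + 1 : ℕ) : ℤ) * β) :=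
    continuous_const.mul (continuous_finsetSum _ fun i _ => continuous_const.mul (continuous_er.comp (by fun_prop)))
  have hT : TT p q (Phi x J) = (TT p q (Gz x 0) + (- er (x * J ^ 2 / 2)) * TT p q (fun β => er ((k:ℤ) * β) * Gz x ζ β)) +
      kap x * ∑ i ∈ Finset.range k, er (-((i + 1) ^ 2 / (2 * x))) * gaussTau p q ((i + 1 : ℕ) : ℤ) := by
    rw [hfun, TT_add _ _ _ _ (i1.add (i2.const_mul _)) (i3.intervalIntegrable _ _), TT_add _ _ _ _ i1 (i2.const_mul _), TT_smul, TT_smul,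
      TT_sum p q k (fun i => er (-((i + 1) ^ 2 / (2 * x))))]
  set S := Real.sqrt (1/x) with hS
  have hS0 : 0 ≤ S := Real.sqrt_nonneg _
  have b1 := h2 q p hq hc 0 (Gz x 0) (K * S) (K * S) (by positivity) (by positivity)
    (h3 x 0 hx0 hx10 le_rfl zero_le_one).1 (h3 x 0 hx0 hx10 le_rfl zero_le_one).2
  have b2 := h2 q p hq hc k (Gz x ζ) (K * S) (K * S) (by positivity) (by positivity)
    (h3 x ζ hx0 hx10 hz0 hz1).1 (h3 x ζ hx0 hx10 hz0 hz1).2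
  simp only [Int.cast_zero, zero_mul, er_zero, one_mul] at b1
  have e : ∀ d t : ℂ, DD p q n y - d = (DD p q n y - t) + (t - d) := fun d t => by ring
  rw [e _ (TT p q (Phi x J))]
  refine (norm_add_le _ _).trans ?_
  rw [hT] at a0 ⊢
  rw [add_sub_cancel_right]
  have b3 : ‖TT p q (Gz x 0) + (- er (x * J ^ 2 / 2)) * TT p q (fun β => er ((k:ℤ) * β) * Gz x ζ β)‖ ≤
      C2 * Real.sqrt q * (K * S + K * S) + C2 * Real.sqrt q * (K * S + K * S) := by
    refine (norm_add_le _ _).trans (add_le_add b1 ?_)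
    rw [norm_mul, norm_neg, norm_er, one_mul]
    exact b2
  have b4 : 0 ≤ C1 * (Real.sqrt q * S) := by positivity
  have b5 : 0 ≤ C2 * K * Real.sqrt q := by positivity
  calc _ ≤ C1 * Real.sqrt q + (C2 * Real.sqrt q * (K * S + K * S) + C2 * Real.sqrt q * (K * S + K * S)) := add_le_add a0 b3
    _ ≤ _ := by linarith

lemma DD_dual : ∃ C : ℝ, 1 ≤ C ∧ ∀ (q : ℕ) (p : ℤ), 1 ≤ q → IsCoprime p (q:ℤ) → ∀ (y : ℝ), 0 < y → y ≤ 5 / q ^ 2 →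
    ∀ n : ℕ, (q:ℝ) ≤ 8 * n → ‖DD p q n y - dual p q n y‖ ≤ C * Real.sqrt n := by
  obtain ⟨C1, hC1, h1⟩ := DD_small
  obtain ⟨C2, hC2, h2⟩ := DD_dual0
  refine ⟨3 * C1 + 6 * C2, by linarith, fun q p hq hc y hy hy' n hqn => ?_⟩
  have hq0 : (0:ℝ) < q := by positivity
  have hs : Real.sqrt q ≤ 3 * Real.sqrt n := by
    calc Real.sqrt q ≤ Real.sqrt (9 * n) := Real.sqrt_le_sqrt (by linarith [Nat.cast_nonneg (α := ℝ) n])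
      _ = _ := by
        rw [Real.sqrt_mul (by norm_num), show (9:ℝ) = 3^2 by norm_num, Real.sqrt_sq (by norm_num)]
  have hsn := Real.sqrt_nonneg (n:ℝ)
  rcases le_or_gt (8 * y * n * q) 1 with h | h
  · have hd : dual p q n y = 0 := by
      unfold dual
      have : ⌊((n / q : ℕ):ℝ) * (2 * y * q ^ 2)⌋₊ = 0 := by
        rw [Nat.floor_eq_zero]
        have h3 : ((n / q : ℕ):ℝ) * q ≤ n := by exact_mod_cast Nat.div_mul_le_self n q
        nlinarith [mul_le_mul_of_nonneg_left h3 (by positivity : 0 ≤ y * q)]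
      rw [this]; simp
    rw [hd, sub_zero]
    have := h1 q p hq hc y (by rwa [abs_of_pos hy]) n (by rwa [abs_of_pos hy])
    nlinarith
  · have := h2 q p hq hc y hy hy' n
    have e : Real.sqrt q * Real.sqrt (1/(2 * y * q ^ 2)) ≤ 3 * Real.sqrt n := by
      rw [← Real.sqrt_mul hq0.le]
      calc _ ≤ Real.sqrt (9 * n) := by
            apply Real.sqrt_le_sqrt
            rw [mul_one_div, div_le_iff₀ (by positivity)]
            have : 0 ≤ y * n * q ^ 2 := by positivity
            nlinarith
        _ = _ := by
          rw [Real.sqrt_mul (by norm_num), show (9:ℝ) = 3^2 by norm_num, Real.sqrt_sq (by norm_num)]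
    nlinarith


lemma osc_core (A c b : ℝ) (hA : A ≠ 0) (hc : 0 < c) (hcb : c ≤ b) :
    ‖∫ y in c..b, (y:ℂ)⁻¹ * er (-(A / y))‖ ≤ b / |A| := by
  have hA' : (A:ℂ) ≠ 0 := by exact_mod_cast hA
  have hne := two_pi_I_ne
  set κ : ℂ := (2 * π * I * A)⁻¹ with hκ
  have hpos : ∀ y ∈ uIcc c b, 0 < y := by
    intro y hy; rw [uIcc_of_le hcb] at hy; linarith [hy.1]
  have hE : ContinuousOn (fun y : ℝ => er (-(A / y))) (uIcc c b) := by
    apply continuous_er.comp_continuousOn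
    exact (continuousOn_const.div continuousOn_id fun y hy => (hpos y hy).ne').neg
  have hinv : ContinuousOn (fun y : ℝ => (y:ℂ)⁻¹) (uIcc c b) := by
    apply ContinuousOn.inv₀ Complex.continuous_ofReal.continuousOn
    intro y hy; exact_mod_cast (hpos y hy).ne'
  have i1 : IntervalIntegrable (fun y : ℝ => (y:ℂ)⁻¹ * er (-(A / y))) volume c b :=
    (hinv.mul hE).intervalIntegrable
  have i2 : IntervalIntegrable (fun y : ℝ => κ * er (-(A / y))) volume c b :=
    (continuousOn_const.mul hE).intervalIntegrable
  have hd : ∀ y ∈ uIcc c b, HasDerivAt (fun y : ℝ => κ * ((y:ℂ) * er (-(A / y))))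
      ((y:ℂ)⁻¹ * er (-(A / y)) + κ * er (-(A / y))) y := by
    intro y hy
    have hy0 := (hpos y hy).ne'
    have hy0' : (y:ℂ) ≠ 0 := by exact_mod_cast hy0
    have b0 : HasDerivAt (fun y : ℝ => -(A / y)) (A / y ^ 2) y := by
      have := (((hasDerivAt_inv hy0).const_mul A)).neg
      refine (this.congr_deriv ?_)
      field_simp
    have b1 := (hasDerivAt_er (-(A / y))).scomp y b0
    have b2 : HasDerivAt (fun z : ℝ => (z : ℂ)) 1 y := Complex.ofRealCLM.hasDerivAt
    have b3 := (b2.mul b1).const_mul κ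
    refine b3.congr_deriv ?_
    simp only [Complex.real_smul, Function.comp, hκ]
    push_cast
    field_simp
    ring
  have hF := intervalIntegral.integral_eq_sub_of_hasDerivAt hd (i1.add i2)
  rw [intervalIntegral.integral_add i1 i2] at hF
  have hκn : ‖κ‖ = (2 * π * |A|)⁻¹ := by
    rw [hκ, norm_inv]; simp [abs_of_pos Real.pi_pos]
  have n1 : ‖∫ y in c..b, κ * er (-(A / y))‖ ≤ ‖κ‖ * (b - c) := by
    have := intervalIntegral.norm_integral_le_of_norm_le_const (a := c) (b := b) (f := fun y : ℝ => κ * er (-(A / y))) (C := ‖κ‖)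
      (fun y _ => by rw [norm_mul, norm_er, mul_one])
    rwa [abs_of_nonneg (by linarith)] at this
  have n2 : ‖κ * ((b:ℂ) * er (-(A / b)))‖ = ‖κ‖ * b := by
    rw [norm_mul, norm_mul, norm_er, mul_one, Complex.norm_real, Real.norm_of_nonneg (by linarith)]
  have n3 : ‖κ * ((c:ℂ) * er (-(A / c)))‖ = ‖κ‖ * c := by
    rw [norm_mul, norm_mul, norm_er, mul_one, Complex.norm_real, Real.norm_of_nonneg (by linarith)]
  have e : ∫ y in c..b, (y:ℂ)⁻¹ * er (-(A / y)) = (κ * ((b:ℂ) * er (-(A / b))) - κ * ((c:ℂ) * er (-(A / c)))) - ∫ y in c..b, κ * er (-(A / y)) := by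
    rw [← hF]; ring
  rw [e]
  have hA0 : 0 < |A| := abs_pos.2 hA
  calc _ ≤ (‖κ‖ * b + ‖κ‖ * c) + ‖κ‖ * (b - c) := by
        refine (norm_sub_le _ _).trans (add_le_add ((norm_sub_le _ _).trans (le_of_eq ?_)) n1)
        rw [n2, n3]
    _ = b * (2 * ‖κ‖) := by ring
    _ ≤ b * |A|⁻¹ := by
        apply mul_le_mul_of_nonneg_left _ (by linarith)
        rw [hκn, mul_inv, mul_inv]
        have : π⁻¹ ≤ 1 := inv_le_one_of_one_le₀ (by linarith [Real.pi_gt_three])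
        have : 0 < |A|⁻¹ := by positivity
        nlinarith
    _ = _ := by rw [div_eq_mul_inv]

lemma osc_ind (A Y a b : ℝ) (hA : A ≠ 0) (hY : 0 < Y) (ha : 0 ≤ a) (hab : a ≤ b) :
    IntegrableOn (indicator (Ici Y) fun y : ℝ => (y:ℂ)⁻¹ * er (-(A / y))) (Ioc a b) ∧
    ‖∫ y in Ioc a b, indicator (Ici Y) (fun y : ℝ => (y:ℂ)⁻¹ * er (-(A / y))) y‖ ≤ b / |A| := by
  have hcont : ContinuousOn (fun y : ℝ => (y:ℂ)⁻¹ * er (-(A / y))) (Ioi 0) := by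
    apply ContinuousOn.mul
    · apply ContinuousOn.inv₀ Complex.continuous_ofReal.continuousOn
      intro y hy; exact_mod_cast (ne_of_gt hy)
    · apply continuous_er.comp_continuousOn
      exact (continuousOn_const.div continuousOn_id fun y hy => (ne_of_gt hy)).neg
  have hb0 : 0 ≤ b := ha.trans hab
  constructor
  · rw [IntegrableOn, integrable_indicator_iff measurableSet_Ici, IntegrableOn, Measure.restrict_restrict measurableSet_Ici]
    have : IntegrableOn (fun y : ℝ => (y:ℂ)⁻¹ * er (-(A / y))) (Icc Y b) :=
      (hcont.mono fun y hy => lt_of_lt_of_le hY hy.1).integrableOn_compact isCompact_Icc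
    exact this.mono_set fun y hy => ⟨hy.1, hy.2.2⟩
  · rw [setIntegral_indicator measurableSet_Ici]
    rcases lt_or_ge a Y with h | h
    · have e : Ioc a b ∩ Ici Y = Icc Y b := by
        ext y; simp only [mem_inter_iff, mem_Ioc, mem_Ici, mem_Icc]
        constructor
        · rintro ⟨⟨_, h2⟩, h3⟩; exact ⟨h3, h2⟩
        · rintro ⟨h3, h2⟩; exact ⟨⟨by linarith, h2⟩, h3⟩
      rw [e]
      rcases le_or_gt Y b with h' | h'
      · rw [integral_Icc_eq_integral_Ioc, ← intervalIntegral.integral_of_le h']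
        exact osc_core A Y b hA hY h'
      · rw [Icc_eq_empty (by linarith)]; simp; positivity
    · have e : Ioc a b ∩ Ici Y = Ioc a b := by
        rw [inter_eq_left]; intro y hy; exact h.trans hy.1.le
      rw [e, ← intervalIntegral.integral_of_le hab]
      exact osc_core A a b hA (by linarith) hab

lemma sum_inv_sq : ∃ Z : ℝ, 0 ≤ Z ∧ ∀ (K i : ℕ), ∑ j ∈ Finset.range K, 1 / ((i:ℝ) - j) ^ 2 ≤ Z := by
  have hs : Summable fun n : ℤ => 1 / (n:ℝ) ^ 2 := Real.summable_one_div_int_pow.2 (by norm_num)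
  refine ⟨∑' n : ℤ, 1 / (n:ℝ) ^ 2, tsum_nonneg fun n => by positivity, fun K i => ?_⟩
  have hinj : Set.InjOn (fun j : ℕ => (i:ℤ) - j) (Finset.range K) := by
    intro a _ b _ h; simp only at h; omega
  have := hs.sum_le_tsum (Finset.image (fun j : ℕ => (i:ℤ) - j) (Finset.range K)) fun n _ => by positivity
  rw [Finset.sum_image hinj] at this
  push_cast at this
  exact this

/-- terms of the dual sum -/
noncomputable def vt (p : ℤ) (q J : ℕ) (i : ℕ) (y : ℝ) : ℂ :=
  if ((i:ℝ) + 1) / (2 * J * q ^ 2) ≤ y then er (-((i + 1) ^ 2 / (2 * (2 * y * q ^ 2)))) * gaussTau p q ((i + 1 : ℕ) : ℤ) else 0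

lemma dual_vt (p : ℤ) (q n : ℕ) (hq : 1 ≤ q) (hJ : 1 ≤ n / q) (y b : ℝ) (hy : 0 < y) (hyb : y ≤ b) :
    dual p q n y = kap (2 * y * q ^ 2) * ∑ i ∈ Finset.range ⌊(n / q : ℕ) * (2 * b * q ^ 2)⌋₊, vt p q (n / q) i y := by
  unfold dual
  congr 1
  set J := n / q with hJd
  have hq0 : (0:ℝ) < q := by positivity
  have hJ0 : (0:ℝ) < J := by positivity
  have hcond : ∀ i : ℕ, i < ⌊(J:ℝ) * (2 * y * q ^ 2)⌋₊ ↔ ((i:ℝ) + 1) / (2 * J * q ^ 2) ≤ y := by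
    intro i
    rw [← Nat.succ_le_iff, Nat.le_floor_iff (by positivity), div_le_iff₀ (by positivity)]
    push_cast
    constructor <;> intro h <;> linarith
  have hsub : Finset.range ⌊(J:ℝ) * (2 * y * q ^ 2)⌋₊ ⊆ Finset.range ⌊(J:ℝ) * (2 * b * q ^ 2)⌋₊ := by
    apply Finset.range_subset_range.2
    apply Nat.floor_le_floor
    gcongr
  rw [← Finset.sum_subset hsub (f := fun i => vt p q J i y)]
  · apply Finset.sum_congr rfl
    intro i hi
    unfold vt
    rw [if_pos ((hcond i).1 (Finset.mem_range.1 hi))]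
  · intro i _ hi
    unfold vt
    rw [if_neg]
    rw [← hcond]
    simpa using hi

lemma tau_bound : ∃ C : ℝ, 1 ≤ C ∧ ∀ (q : ℕ) (p : ℤ), 1 ≤ q → IsCoprime p (q:ℤ) → ∀ m : ℤ, ‖gaussTau p q m‖ ≤ C * Real.sqrt q := by
  obtain ⟨C, hC, h⟩ := LF
  refine ⟨C, hC, fun q p hq hc m => ?_⟩
  rw [gaussTau_eq]
  exact h q p hq hc _ q le_rfl


/-- off-diagonal coefficient -/
noncomputable def oc (p : ℤ) (q i j : ℕ) : ℂ :=
  if i = j then 0 else gaussTau p q ((i + 1 : ℕ) : ℤ) * (starRingEnd ℂ) (gaussTau p q ((j + 1 : ℕ) : ℤ)) / (2 * (q:ℂ) ^ 2)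

noncomputable def oA (q i j : ℕ) : ℝ := (((i:ℝ) + 1) ^ 2 - ((j:ℝ) + 1) ^ 2) / (4 * (q:ℝ) ^ 2)

noncomputable def oY (q J i j : ℕ) : ℝ := max (((i:ℝ) + 1) / (2 * J * q ^ 2)) (((j:ℝ) + 1) / (2 * J * q ^ 2))

noncomputable def off (p : ℤ) (q J K : ℕ) (y : ℝ) : ℂ :=
  ∑ i ∈ Finset.range K, ∑ j ∈ Finset.range K, oc p q i j *
    indicator (Ici (oY q J i j)) (fun y : ℝ => (y:ℂ)⁻¹ * er (-(oA q i j / y))) y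

lemma vt_off (p : ℤ) (q J i j : ℕ) (hq : 1 ≤ q) (hij : i ≠ j) (y : ℝ) (hy : 0 < y) :
    ((2 * y * q ^ 2 : ℝ) : ℂ)⁻¹ * (vt p q J i y * (starRingEnd ℂ) (vt p q J j y)) =
    oc p q i j * indicator (Ici (oY q J i j)) (fun y : ℝ => (y:ℂ)⁻¹ * er (-(oA q i j / y))) y := by
  have hq0 : (q:ℝ) ≠ 0 := by positivity
  have hq0' : (q:ℂ) ≠ 0 := by exact_mod_cast hq0
  have hy' : (y:ℂ) ≠ 0 := by exact_mod_cast hy.ne'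
  unfold vt oc
  rw [if_neg hij]
  by_cases h1 : ((i:ℝ) + 1) / (2 * J * q ^ 2) ≤ y
  · by_cases h2 : ((j:ℝ) + 1) / (2 * J * q ^ 2) ≤ y
    · rw [if_pos h1, if_pos h2, indicator_of_mem (show y ∈ Ici (oY q J i j) from max_le h1 h2), map_mul, ← er_neg]
      have e : er (-(oA q i j / y)) = er (-((i + 1) ^ 2 / (2 * (2 * y * q ^ 2)))) * er (-(-((j + 1) ^ 2 / (2 * (2 * y * q ^ 2))))) := by
        rw [← er_add]; congr 1; unfold oA; field_simp; ring
      rw [e]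
      push_cast
      field_simp
    · rw [if_neg h2, indicator_of_notMem]
      · simp
      · intro h; exact h2 ((le_max_right _ _).trans h)
  · rw [if_neg h1, indicator_of_notMem]
    · simp
    · intro h; exact h1 ((le_max_left _ _).trans h)

lemma vt_diag (p : ℤ) (q J K : ℕ) (hq : 1 ≤ q) (hJ : 1 ≤ J) (y C : ℝ) (hy : 0 < y) (hC : 0 ≤ C)
    (ht : ∀ m : ℤ, ‖gaussTau p q m‖ ≤ C * Real.sqrt q) :
    (2 * y * q ^ 2 : ℝ)⁻¹ * ∑ i ∈ Finset.range K, ‖vt p q J i y‖ ^ 2 ≤ C ^ 2 * (J * q) := by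
  have hq0 : (0:ℝ) < q := by positivity
  have hJ0 : (0:ℝ) < J := by positivity
  have hx : 0 < 2 * y * q ^ 2 := by positivity
  have h1 : ∑ i ∈ Finset.range K, ‖vt p q J i y‖ ^ 2 ≤ ∑ i ∈ Finset.range K, if i < ⌊(J:ℝ) * (2 * y * q ^ 2)⌋₊ then C ^ 2 * q else 0 := by
    apply Finset.sum_le_sum
    intro i _
    have hcond : i < ⌊(J:ℝ) * (2 * y * q ^ 2)⌋₊ ↔ ((i:ℝ) + 1) / (2 * J * q ^ 2) ≤ y := by
      rw [← Nat.succ_le_iff, Nat.le_floor_iff (by positivity), div_le_iff₀ (by positivity)]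
      push_cast
      constructor <;> intro h <;> linarith
    unfold vt
    by_cases h : ((i:ℝ) + 1) / (2 * J * q ^ 2) ≤ y
    · rw [if_pos h, if_pos (hcond.2 h), norm_mul, norm_er, one_mul]
      calc _ ≤ (C * Real.sqrt q) ^ 2 := by gcongr; exact ht _
        _ = _ := by rw [mul_pow, Real.sq_sqrt hq0.le]
    · rw [if_neg h, if_neg (fun h' => h (hcond.1 h'))]; simp
  have h2 : (∑ i ∈ Finset.range K, if i < ⌊(J:ℝ) * (2 * y * q ^ 2)⌋₊ then C ^ 2 * (q:ℝ) else 0) ≤ (J * (2 * y * q ^ 2)) * (C ^ 2 * q) := by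
    rw [← Finset.sum_filter, Finset.sum_const, nsmul_eq_mul]
    gcongr
    have : (Finset.filter (fun i => i < ⌊(J:ℝ) * (2 * y * q ^ 2)⌋₊) (Finset.range K)).card ≤ ⌊(J:ℝ) * (2 * y * q ^ 2)⌋₊ := by
      refine (Finset.card_le_card (t := Finset.range ⌊(J:ℝ) * (2 * y * q ^ 2)⌋₊) ?_).trans (by simp)
      intro i hi; simpa using (Finset.mem_filter.1 hi).2
    exact (Nat.cast_le.2 this).trans (Nat.floor_le (by positivity))
  rw [inv_mul_le_iff₀ hx]
  calc _ ≤ _ := h1.trans h2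
    _ = _ := by ring

lemma dual_sq (p : ℤ) (q n : ℕ) (hq : 1 ≤ q) (hJ : 1 ≤ n / q) (y b C : ℝ) (hy : 0 < y) (hyb : y ≤ b) (hC : 0 ≤ C)
    (ht : ∀ m : ℤ, ‖gaussTau p q m‖ ≤ C * Real.sqrt q) :
    ‖dual p q n y‖ ^ 2 ≤ C ^ 2 * n + (off p q (n / q) ⌊(n / q : ℕ) * (2 * b * q ^ 2)⌋₊ y).re := by
  have hq0 : (0:ℝ) < q := by positivity
  have hx : 0 < 2 * y * q ^ 2 := by positivity
  rw [dual_vt p q n hq hJ y b hy hyb]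
  set J := n / q with hJd
  set K := ⌊(J:ℝ) * (2 * b * q ^ 2)⌋₊ with hK
  rw [norm_mul, mul_pow, norm_kap _ hx, Real.sq_sqrt (by positivity), one_div]
  have hJq : (J:ℝ) * q ≤ n := by exact_mod_cast Nat.div_mul_le_self n q
  have hd := vt_diag p q J K hq hJ y C hy hC ht
  have key : (((2 * y * q ^ 2 : ℝ)⁻¹ * ‖∑ i ∈ Finset.range K, vt p q J i y‖ ^ 2 : ℝ) : ℂ) =
      (((2 * y * q ^ 2 : ℝ)⁻¹ * ∑ i ∈ Finset.range K, ‖vt p q J i y‖ ^ 2 : ℝ) : ℂ) + off p q J K y := by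
    have e1 : ((‖∑ i ∈ Finset.range K, vt p q J i y‖ ^ 2 : ℝ) : ℂ) = ∑ i ∈ Finset.range K, ∑ j ∈ Finset.range K, vt p q J i y * (starRingEnd ℂ) (vt p q J j y) := by
      rw [Complex.ofReal_pow, ← Complex.mul_conj', map_sum, Finset.sum_mul_sum]
    rw [Complex.ofReal_mul, e1, Complex.ofReal_mul, Finset.mul_sum, Complex.ofReal_sum, Finset.mul_sum]
    unfold off
    rw [← Finset.sum_add_distrib]
    apply Finset.sum_congr rfl
    intro i hi
    rw [Finset.mul_sum, ← Finset.add_sum_erase _ _ hi, ← Finset.add_sum_erase (Finset.range K) (fun j => oc p q i j * _) hi]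
    have e2 : oc p q i i = 0 := by unfold oc; rw [if_pos rfl]
    rw [e2, zero_mul, zero_add]
    congr 1
    · rw [Complex.mul_conj', Complex.ofReal_pow, Complex.ofReal_inv]
    · apply Finset.sum_congr rfl
      intro j hj
      rw [Complex.ofReal_inv]
      exact vt_off p q J i j hq (Finset.ne_of_mem_erase hj).symm y hy
  have key2 := congrArg Complex.re key
  rw [Complex.ofReal_re, Complex.add_re, Complex.ofReal_re] at key2
  rw [key2]
  have : C ^ 2 * ((J:ℝ) * q) ≤ C ^ 2 * n := by gcongr
  linarith

lemma off_int (p : ℤ) (q J K : ℕ) (hq : 1 ≤ q) (hJ : 1 ≤ J) (a b C Z : ℝ) (ha : 0 ≤ a) (hab : a ≤ b) (hC : 0 ≤ C)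
    (ht : ∀ m : ℤ, ‖gaussTau p q m‖ ≤ C * Real.sqrt q)
    (hZ : ∀ (K i : ℕ), ∑ j ∈ Finset.range K, 1 / ((i:ℝ) - j) ^ 2 ≤ Z) :
    IntegrableOn (off p q J K) (Ioc a b) ∧ ‖∫ y in Ioc a b, off p q J K y‖ ≤ 2 * C ^ 2 * q * b * Z * K := by
  have hq0 : (0:ℝ) < q := by positivity
  have hJ0 : (0:ℝ) < J := by positivity
  have hb : 0 ≤ b := ha.trans hab
  have hA : ∀ i j : ℕ, i ≠ j → oA q i j ≠ 0 ∧ ((i:ℝ) - j) ^ 2 / (4 * q ^ 2) ≤ |oA q i j| := by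
    intro i j hij
    have h1 : ((i:ℝ) - j) ^ 2 ≤ |((i:ℝ) + 1) ^ 2 - ((j:ℝ) + 1) ^ 2| := by
      have e : ((i:ℝ) + 1) ^ 2 - ((j:ℝ) + 1) ^ 2 = ((i:ℝ) - j) * (i + j + 2) := by ring
      rw [e, abs_mul, ← sq_abs, sq]
      apply mul_le_mul_of_nonneg_left _ (abs_nonneg _)
      rw [abs_le, abs_of_nonneg (by positivity)]
      have := Nat.cast_nonneg (α := ℝ) i
      have := Nat.cast_nonneg (α := ℝ) j
      constructor <;> linarith
    have h2 : ((i:ℝ) - j) ^ 2 / (4 * q ^ 2) ≤ |oA q i j| := by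
      unfold oA
      rw [abs_div, abs_of_pos (show (0:ℝ) < 4 * q ^ 2 by positivity)]
      gcongr
    refine ⟨fun h0 => ?_, h2⟩
    rw [h0, abs_zero] at h2
    have : (0:ℝ) < ((i:ℝ) - j) ^ 2 / (4 * q ^ 2) := by
      have : (i:ℝ) - j ≠ 0 := sub_ne_zero.2 (by exact_mod_cast hij)
      positivity
    linarith
  have hY : ∀ i j : ℕ, 0 < oY q J i j := fun i j => lt_max_of_lt_left (by positivity)
  have hterm : ∀ i j : ℕ, IntegrableOn (fun y => oc p q i j * indicator (Ici (oY q J i j)) (fun y : ℝ => (y:ℂ)⁻¹ * er (-(oA q i j / y))) y) (Ioc a b) ∧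
     ‖∫ y in Ioc a b, oc p q i j * indicator (Ici (oY q J i j)) (fun y : ℝ => (y:ℂ)⁻¹ * er (-(oA q i j / y))) y‖ ≤ 2 * C ^ 2 * q * b * (1 / ((i:ℝ) - j) ^ 2) := by
    intro i j
    by_cases hij : i = j
    · have : oc p q i j = 0 := by unfold oc; rw [if_pos hij]
      simp only [this, zero_mul]
      refine ⟨integrableOn_zero, ?_⟩
      simp only [integral_zero, norm_zero]
      positivity
    · obtain ⟨h0, h2⟩ := hA i j hij
      obtain ⟨o1, o2⟩ := osc_ind (oA q i j) (oY q J i j) a b h0 (hY i j) ha hab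
      refine ⟨o1.const_mul _, ?_⟩
      have hpos : (0:ℝ) < ((i:ℝ) - j) ^ 2 := by
        have : (i:ℝ) - j ≠ 0 := sub_ne_zero.2 (by exact_mod_cast hij)
        positivity
      rw [integral_const_mul, norm_mul]
      have hoc : ‖oc p q i j‖ ≤ C ^ 2 / (2 * q) := by
        unfold oc
        rw [if_neg hij, norm_div, norm_mul, RCLike.norm_conj, norm_mul, norm_pow, Complex.norm_natCast, Complex.norm_ofNat]
        calc _ ≤ (C * Real.sqrt q) * (C * Real.sqrt q) / (2 * q ^ 2) := by
              gcongr
              · exact ht _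
              · exact ht _
          _ = C ^ 2 * (Real.sqrt q) ^ 2 / (2 * q ^ 2) := by ring
          _ = _ := by rw [Real.sq_sqrt hq0.le]; field_simp
      calc _ ≤ C ^ 2 / (2 * q) * (b / (((i:ℝ) - j) ^ 2 / (4 * q ^ 2))) := by
            gcongr
            refine o2.trans ?_
            gcongr
        _ = _ := by field_simp; ring
  constructor
  · unfold off
    exact integrable_finsetSum _ fun i _ => integrable_finsetSum _ fun j _ => (hterm i j).1
  · unfold off
    rw [integral_finsetSum _ fun i _ => integrable_finsetSum _ fun j _ => (hterm i j).1]
    calc _ ≤ ∑ i ∈ Finset.range K, 2 * C ^ 2 * q * b * Z := by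
          apply norm_sum_le_of_le
          intro i _
          rw [integral_finsetSum _ fun j _ => (hterm i j).1]
          calc _ ≤ ∑ j ∈ Finset.range K, 2 * C ^ 2 * q * b * (1 / ((i:ℝ) - j) ^ 2) := norm_sum_le_of_le _ fun j _ => (hterm i j).2
            _ = 2 * C ^ 2 * q * b * ∑ j ∈ Finset.range K, (1 / ((i:ℝ) - j) ^ 2) := by rw [Finset.mul_sum]
            _ ≤ _ := by gcongr; exact hZ K i
      _ = _ := by rw [Finset.sum_const, Finset.card_range, nsmul_eq_mul]; ring

lemma DD_L2_pos : ∃ C : ℝ, 1 ≤ C ∧ ∀ (q : ℕ) (p : ℤ), 1 ≤ q → IsCoprime p (q:ℤ) → ∀ H : ℝ, 0 < H → H ≤ ((q:ℝ) ^ 2)⁻¹ →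
    ∀ n : ℕ, 1 ≤ 8 * (n * Real.sqrt H) → ∀ a b : ℝ, 0 ≤ a → a ≤ b → b ≤ 5 * Real.sqrt H / q → b - a ≤ 2 * H →
    ∫ y in Ioc a b, ‖DD p q n y‖ ^ 2 ≤ C * (n * H) := by
  obtain ⟨C1, hC1, h1⟩ := DD_dual
  obtain ⟨C2, hC2, h2⟩ := tau_bound
  obtain ⟨Z, hZ0, hZ⟩ := sum_inv_sq
  refine ⟨4 * C1 ^ 2 + 4 * C2 ^ 2 + 200 * C2 ^ 2 * Z, by nlinarith [mul_nonneg (sq_nonneg C2) hZ0], fun q p hq hc H hH hHq n hn a b ha hab hb hba => ?_⟩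
  have hq0 : (0:ℝ) < q := by positivity
  have hsH : 0 < Real.sqrt H := Real.sqrt_pos.2 hH
  have hsq : Real.sqrt H ^ 2 = H := Real.sq_sqrt hH.le
  have hsHq : Real.sqrt H * q ≤ 1 := by
    rw [← abs_of_pos (mul_pos hsH hq0), ← sq_le_one_iff_abs_le_one, mul_pow, hsq]
    calc _ ≤ ((q:ℝ) ^ 2)⁻¹ * q ^ 2 := by gcongr
      _ = 1 := by field_simp
  have hqn : (q:ℝ) ≤ 8 * n := by
    by_contra h
    push Not at h
    nlinarith
  have hb5 : b ≤ 5 / q ^ 2 := by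
    refine hb.trans ?_
    rw [div_le_div_iff₀ hq0 (by positivity)]
    nlinarith
  have hb0 : 0 ≤ b := ha.trans hab
  have hnH : 0 ≤ n * H := by positivity
  set U : ℝ := 2 * C1 ^ 2 * n + 2 * C2 ^ 2 * n with hU
  have main : ∃ w : ℝ → ℝ, IntegrableOn w (Ioc a b) ∧ (∀ y ∈ Ioc a b, ‖DD p q n y‖ ^ 2 ≤ U + w y) ∧ ∫ y in Ioc a b, w y ≤ 200 * C2 ^ 2 * Z * (n * H) := by
    have hdd : ∀ y ∈ Ioc a b, ‖DD p q n y‖ ^ 2 ≤ 2 * C1 ^ 2 * n + 2 * ‖dual p q n y‖ ^ 2 := by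
      intro y hy
      have := h1 q p hq hc y (by linarith [hy.1]) (by linarith [hy.2]) n hqn
      have h3 : ‖DD p q n y‖ ≤ C1 * Real.sqrt n + ‖dual p q n y‖ := by
        calc _ = ‖(DD p q n y - dual p q n y) + dual p q n y‖ := by rw [sub_add_cancel]
          _ ≤ _ := (norm_add_le _ _).trans (by gcongr)
      have h4 : Real.sqrt n ^ 2 = n := Real.sq_sqrt (by positivity)
      calc _ ≤ (C1 * Real.sqrt n + ‖dual p q n y‖) ^ 2 := by gcongr
        _ ≤ 2 * (C1 * Real.sqrt n) ^ 2 + 2 * ‖dual p q n y‖ ^ 2 := by nlinarith [sq_nonneg (C1 * Real.sqrt n - ‖dual p q n y‖)]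
        _ = _ := by rw [mul_pow, h4]; ring
    by_cases hJ : 1 ≤ n / q
    · set J := n / q with hJd
      set K := ⌊(J:ℝ) * (2 * b * q ^ 2)⌋₊ with hK
      obtain ⟨o1, o2⟩ := off_int p q J K hq hJ a b C2 Z ha hab (by linarith) (h2 q p hq hc) hZ
      refine ⟨fun y => 2 * (off p q J K y).re, o1.re.const_mul 2, fun y hy => ?_, ?_⟩
      · have := dual_sq p q n hq hJ y b C2 (by linarith [hy.1]) hy.2 (by linarith) (h2 q p hq hc)
        have := hdd y hy
        simp only [hU]; linarith
      · rw [integral_const_mul]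
        have e : ∫ y in Ioc a b, (off p q J K y).re = (∫ y in Ioc a b, off p q J K y).re := integral_re o1
        rw [e]
        have hJq : (J:ℝ) * q ≤ n := by exact_mod_cast Nat.div_mul_le_self n q
        have hqb : q * b ≤ 5 * Real.sqrt H := by rw [le_div_iff₀ hq0] at hb; linarith
        have hKb : (K:ℝ) ≤ 10 * (n * Real.sqrt H) := by
          refine (Nat.floor_le (by positivity)).trans ?_
          calc _ = 2 * ((J * q) * (q * b)) := by ring
            _ ≤ 2 * (n * (5 * Real.sqrt H)) := by gcongr
            _ = _ := by ring
        calc _ ≤ 2 * (2 * C2 ^ 2 * q * b * Z * K) := by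
              gcongr
              exact (Complex.re_le_norm _).trans o2
          _ = 4 * C2 ^ 2 * Z * ((q * b) * K) := by ring
          _ ≤ 4 * C2 ^ 2 * Z * ((5 * Real.sqrt H) * (10 * (n * Real.sqrt H))) := by gcongr
          _ = 200 * C2 ^ 2 * Z * (n * Real.sqrt H ^ 2) := by ring
          _ = _ := by rw [hsq]
    · refine ⟨fun _ => 0, integrableOn_zero, fun y hy => ?_, ?_⟩
      · have h0 : n / q = 0 := Nat.lt_one_iff.1 (not_le.1 hJ)
        have : dual p q n y = 0 := by unfold dual; rw [h0]; simp
        have h5 := hdd y hy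
        rw [this] at h5
        simp only [norm_zero] at h5
        have : 0 ≤ 2 * C2 ^ 2 * n := by positivity
        simp only [hU]; linarith
      · rw [integral_zero]; positivity
  obtain ⟨w, w1, w2, w3⟩ := main
  have hUi : IntegrableOn (fun _ : ℝ => U) (Ioc a b) := integrableOn_const (by simp)
  calc _ ≤ ∫ y in Ioc a b, (U + w y) := by
        apply integral_mono_of_nonneg
        · exact Eventually.of_forall fun y => by positivity
        · exact hUi.add w1
        · filter_upwards [self_mem_ae_restrict measurableSet_Ioc] with y hy using w2 y hy
    _ = (b - a) * U + ∫ y in Ioc a b, w y := by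
        rw [integral_add hUi w1]; simp [hab]
    _ ≤ 2 * H * U + 200 * C2 ^ 2 * Z * (n * H) := by
        gcongr
    _ = _ := by simp only [hU]; ring

lemma DD_conj (p : ℤ) (q n : ℕ) (y : ℝ) : DD (-p) q n (-y) = (starRingEnd ℂ) (DD p q n y) := by
  have ht : gaussTau (-p) q 0 = (starRingEnd ℂ) (gaussTau p q 0) := by
    rw [gaussTau_eq, gaussTau_eq, map_sum]
    apply Finset.sum_congr rfl
    intro b _
    rw [← er_neg]; congr 1; push_cast; ring
  unfold DD
  rw [map_sub, map_sum, map_mul, map_div₀, ht, intervalIntegral.integral_of_le (Nat.cast_nonneg n), intervalIntegral.integral_of_le (Nat.cast_nonneg n), ← integral_conj]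
  congr 1
  · apply Finset.sum_congr rfl
    intro j _
    rw [← er_neg]; congr 1; push_cast; ring
  · congr 1
    · simp
    · congr 1
      funext u
      rw [← er_neg]; congr 1; ring

lemma DD_cont (p : ℤ) (q n : ℕ) : Continuous (DD p q n) := by
  unfold DD
  apply Continuous.sub
  · exact continuous_finsetSum _ fun j _ => continuous_er.comp (by fun_prop)
  · apply continuous_const.mul
    apply intervalIntegral.continuous_parametric_intervalIntegral_of_continuous'
    exact continuous_er.comp (by fun_prop)

lemma DD_L2 : ∃ C : ℝ, 1 ≤ C ∧ ∀ (q : ℕ) (p : ℤ), 1 ≤ q → IsCoprime p (q:ℤ) → ∀ H : ℝ, 0 < H → H ≤ ((q:ℝ) ^ 2)⁻¹ →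
    ∀ n : ℕ, 1 ≤ 8 * (n * Real.sqrt H) → ∀ a b : ℝ, a ≤ b → -(5 * Real.sqrt H / q) ≤ a → b ≤ 5 * Real.sqrt H / q → b - a ≤ 2 * H →
    ∫ y in a..b, ‖DD p q n y‖ ^ 2 ≤ C * (n * H) := by
  obtain ⟨C, hC, h⟩ := DD_L2_pos
  refine ⟨2 * C, by linarith, fun q p hq hc H hH hHq n hn a b hab ha hb hba => ?_⟩
  have hpos : ∀ a b : ℝ, 0 ≤ a → a ≤ b → b ≤ 5 * Real.sqrt H / q → b - a ≤ 2 * H → ∫ y in a..b, ‖DD p q n y‖ ^ 2 ≤ C * (n * H) := by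
    intro a b h1 h2 h3 h4
    rw [intervalIntegral.integral_of_le h2]
    exact h q p hq hc H hH hHq n hn a b h1 h2 h3 h4
  have hneg : ∀ a b : ℝ, b ≤ 0 → a ≤ b → -(5 * Real.sqrt H / q) ≤ a → b - a ≤ 2 * H → ∫ y in a..b, ‖DD p q n y‖ ^ 2 ≤ C * (n * H) := by
    intro a b h1 h2 h3 h4
    have e : ∫ y in a..b, ‖DD p q n y‖ ^ 2 = ∫ y in a..b, (fun z => ‖DD (-p) q n z‖ ^ 2) (-y) := by
      apply intervalIntegral.integral_congr
      intro y _
      simp only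
      rw [DD_conj, RCLike.norm_conj]
    rw [e, intervalIntegral.integral_comp_neg (fun z => ‖DD (-p) q n z‖ ^ 2), intervalIntegral.integral_of_le (by linarith)]
    exact h q (-p) hq hc.neg_left H hH hHq n hn (-b) (-a) (by linarith) (by linarith) (by linarith) (by linarith)
  have hi : ∀ c d : ℝ, IntervalIntegrable (fun y => ‖DD p q n y‖ ^ 2) volume c d := fun c d =>
    ((DD_cont p q n).norm.pow 2).intervalIntegrable c d
  have hz : 0 ≤ C * (n * H) := by positivity
  rcases le_or_gt 0 a with h0 | h0
  · linarith [hpos a b h0 hab hb hba]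
  · rcases le_or_gt b 0 with h1 | h1
    · linarith [hneg a b h1 hab ha hba]
    · rw [← intervalIntegral.integral_add_adjacent_intervals (hi a 0) (hi 0 b)]
      linarith [hneg a 0 le_rfl h0.le ha (by linarith), hpos 0 b le_rfl h1.le hb (by linarith)]


noncomputable def st (φ : ℝ → ℂ) (p : ℤ) (q : ℕ) (y : ℝ) (n : ℕ) : ℂ :=
  φ (n + 1) * er ((n + 1) ^ 2 * (p / q + y)) - gaussTau p q 0 / q * ∫ t in (n:ℝ)..(n + 1), φ t * er (t ^ 2 * y)

lemma alpha_le (p : ℤ) (q : ℕ) : ‖gaussTau p q 0 / q‖ ≤ 1 := by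
  rw [norm_div, Complex.norm_natCast]
  apply div_le_one_of_le₀ _ (Nat.cast_nonneg q)
  rw [gaussTau_eq]
  refine (norm_sum_le _ _).trans ?_
  simp [norm_er]

lemma DD_succ (p : ℤ) (q n : ℕ) (y : ℝ) : DD p q (n + 1) y - DD p q n y =
    er ((n + 1) ^ 2 * (p / q + y)) - gaussTau p q 0 / q * ∫ t in (n:ℝ)..(n + 1), er (t ^ 2 * y) := by
  unfold DD
  rw [Finset.sum_range_succ]
  have := intervalIntegral.integral_add_adjacent_intervals ((cont_sq y).intervalIntegrable (μ := volume) 0 n)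
    ((cont_sq y).intervalIntegrable (μ := volume) n (n + 1))
  push_cast
  rw [← this]
  ring

lemma DD_zero (p : ℤ) (q : ℕ) (y : ℝ) : DD p q 0 y = 0 := by simp [DD]

lemma DD_succ_le (p : ℤ) (q n : ℕ) (y : ℝ) : ‖DD p q (n + 1) y‖ ≤ ‖DD p q n y‖ + 2 := by
  have h := DD_succ p q n y
  have h1 : ‖∫ t in (n:ℝ)..(n + 1), er (t ^ 2 * y)‖ ≤ 1 := by
    have := intervalIntegral.norm_integral_le_of_norm_le_const (a := (n:ℝ)) (b := n + 1) (f := fun t : ℝ => er (t ^ 2 * y)) (C := 1)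
      (fun t _ => by rw [norm_er])
    simpa using this
  have h2 : ‖DD p q (n + 1) y - DD p q n y‖ ≤ 2 := by
    rw [h]
    refine (norm_sub_le _ _).trans ?_
    rw [norm_er, norm_mul]
    have := mul_le_mul (alpha_le p q) h1 (norm_nonneg _) zero_le_one
    linarith
  calc _ = ‖DD p q n y + (DD p q (n + 1) y - DD p q n y)‖ := by congr 1; ring
    _ ≤ _ := (norm_add_le _ _).trans (by gcongr)

lemma st_eq (φ : ℝ → ℂ) (p : ℤ) (q : ℕ) (y : ℝ) (n : ℕ) (hi : ContinuousOn φ (Icc (n:ℝ) (n + 1))) :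
    st φ p q y n = φ (n + 1) * (DD p q (n + 1) y - DD p q n y) +
      gaussTau p q 0 / q * ∫ t in (n:ℝ)..(n + 1), (φ (n + 1) - φ t) * er (t ^ 2 * y) := by
  have i1 : IntervalIntegrable (fun t : ℝ => φ t * er (t ^ 2 * y)) volume n (n + 1) := by
    apply ContinuousOn.intervalIntegrable
    rw [uIcc_of_le (by linarith)]
    exact hi.mul (cont_sq y).continuousOn
  have i2 : IntervalIntegrable (fun t : ℝ => φ (n + 1) * er (t ^ 2 * y)) volume n (n + 1) :=
    (continuous_const.mul (cont_sq y)).intervalIntegrable _ _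
  have e : ∫ t in (n:ℝ)..(n + 1), (φ (n + 1) - φ t) * er (t ^ 2 * y) =
      φ (n + 1) * (∫ t in (n:ℝ)..(n + 1), er (t ^ 2 * y)) - ∫ t in (n:ℝ)..(n + 1), φ t * er (t ^ 2 * y) := by
    rw [← intervalIntegral.integral_const_mul, ← intervalIntegral.integral_sub i2 i1]
    congr 1; funext t; ring
  rw [e, DD_succ]
  unfold st
  ring

lemma SBP (φ : ℝ → ℂ) (p : ℤ) (q : ℕ) (y : ℝ) (M N : ℕ) (hMN : M ≤ N) (e : ℕ → ℝ)
    (hi : ∀ n ∈ Finset.Ico M N, ContinuousOn φ (Icc (n:ℝ) (n + 1)))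
    (he : ∀ n ∈ Finset.Ico M N, ∀ t ∈ Icc (n:ℝ) (n + 1), ‖φ (n + 1) - φ t‖ ≤ e n) :
    ‖∑ n ∈ Finset.Ico M N, st φ p q y n‖ ≤ ‖φ N‖ * ‖DD p q N y‖ + ‖φ M‖ * ‖DD p q M y‖ +
      ∑ n ∈ Finset.Ico M N, e n * ‖DD p q n y‖ + ∑ n ∈ Finset.Ico M N, e n := by
  have key : ∑ n ∈ Finset.Ico M N, st φ p q y n = (φ N * DD p q N y - φ M * DD p q M y) -
      ∑ n ∈ Finset.Ico M N, (φ (n + 1) - φ n) * DD p q n y +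
      ∑ n ∈ Finset.Ico M N, gaussTau p q 0 / q * ∫ t in (n:ℝ)..(n + 1), (φ (n + 1) - φ t) * er (t ^ 2 * y) := by
    have t1 := Finset.sum_Ico_sub (f := fun n : ℕ => φ n * DD p q n y) hMN
    rw [← t1, ← Finset.sum_sub_distrib, ← Finset.sum_add_distrib]
    apply Finset.sum_congr rfl
    intro n hn
    rw [st_eq φ p q y n (hi n hn)]
    push_cast
    ring
  rw [key]
  have b1 : ‖∑ n ∈ Finset.Ico M N, (φ (n + 1) - φ n) * DD p q n y‖ ≤ ∑ n ∈ Finset.Ico M N, e n * ‖DD p q n y‖ := by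
    apply norm_sum_le_of_le
    intro n hn
    rw [norm_mul]
    gcongr
    exact he n hn n ⟨le_rfl, by linarith⟩
  have b2 : ‖∑ n ∈ Finset.Ico M N, gaussTau p q 0 / q * ∫ t in (n:ℝ)..(n + 1), (φ (n + 1) - φ t) * er (t ^ 2 * y)‖ ≤ ∑ n ∈ Finset.Ico M N, e n := by
    apply norm_sum_le_of_le
    intro n hn
    rw [norm_mul]
    have := intervalIntegral.norm_integral_le_of_norm_le_const (a := (n:ℝ)) (b := n + 1) (f := fun t : ℝ => (φ (n + 1) - φ t) * er (t ^ 2 * y)) (C := e n)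
      (fun t ht => by
        rw [uIoc_of_le (by linarith)] at ht
        rw [norm_mul, norm_er, mul_one]
        exact he n hn t ⟨ht.1.le, ht.2⟩)
    rw [add_sub_cancel_left, abs_one, mul_one] at this
    calc _ ≤ 1 * e n := mul_le_mul (alpha_le p q) this (norm_nonneg _) zero_le_one
      _ = _ := one_mul _
  refine (norm_add_le _ _).trans (add_le_add ((norm_sub_le _ _).trans (add_le_add ((norm_sub_le _ _).trans (le_of_eq ?_)) b1)) b2)
  rw [norm_mul, norm_mul]

/-- low-range weight -/
noncomputable def psiw (s h : ℝ) (t : ℝ) : ℂ := ((t ^ (-s) : ℝ) : ℂ) * (er (t ^ 2 * (2 * h)) - er (t ^ 2 * h))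

lemma psiw_zero (s h : ℝ) : psiw s h 0 = 0 := by simp [psiw]

lemma er_diff_le (h t : ℝ) : ‖er (t ^ 2 * (2 * h)) - er (t ^ 2 * h)‖ ≤ 2 * π * (|h| * t ^ 2) := by
  refine (er_lip _ _).trans (le_of_eq ?_)
  have : t ^ 2 * (2 * h) - t ^ 2 * h = h * t ^ 2 := by ring
  rw [this, abs_mul, abs_of_nonneg (sq_nonneg t)]

lemma rpow_aux (s t : ℝ) (ht : 0 < t) : t ^ (-s) * t = t ^ (1 - s) ∧ t ^ (-s - 1) * t ^ 2 = t ^ (1 - s) ∧ t ^ (-s) * t ^ 2 = t ^ (1 - s) * t := by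
  refine ⟨?_, ?_, ?_⟩
  · rw [← Real.rpow_add_one ht.ne']; congr 1; ring
  · rw [← Real.rpow_natCast, ← Real.rpow_add ht]; congr 1; push_cast; ring
  · rw [← Real.rpow_add_one ht.ne', ← Real.rpow_natCast, ← Real.rpow_add ht]; congr 1; push_cast; ring

lemma psiw_le (s h t : ℝ) (ht : 0 < t) : ‖psiw s h t‖ ≤ 2 * π * |h| * (t ^ (1 - s) * t) := by
  unfold psiw
  rw [norm_mul, Complex.norm_real, Real.norm_of_nonneg (by positivity)]
  calc _ ≤ t ^ (-s) * (2 * π * (|h| * t ^ 2)) := by gcongr; exact er_diff_le h t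
    _ = 2 * π * |h| * (t ^ (-s) * t ^ 2) := by ring
    _ = _ := by rw [(rpow_aux s t ht).2.2]

lemma psiw_deriv (s h t : ℝ) (ht : 0 < t) : HasDerivAt (psiw s h)
    (((-s * t ^ (-s - 1) : ℝ) : ℂ) * (er (t ^ 2 * (2 * h)) - er (t ^ 2 * h)) +
      ((t ^ (-s) : ℝ) : ℂ) * (((2 * t * (2 * h) : ℝ) : ℂ) * (2 * π * I * er (t ^ 2 * (2 * h))) - ((2 * t * h : ℝ) : ℂ) * (2 * π * I * er (t ^ 2 * h)))) t := by
  have a1 : HasDerivAt (fun t : ℝ => ((t ^ (-s) : ℝ) : ℂ)) ((-s * t ^ (-s - 1) : ℝ) : ℂ) t :=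
    (Real.hasDerivAt_rpow_const (Or.inl ht.ne')).ofReal_comp
  have a2 : ∀ c : ℝ, HasDerivAt (fun t : ℝ => er (t ^ 2 * c)) (((2 * t * c : ℝ) : ℂ) * (2 * π * I * er (t ^ 2 * c))) t := by
    intro c
    have b0 : HasDerivAt (fun t : ℝ => t ^ 2 * c) (2 * t * c) t := by
      have := (hasDerivAt_pow 2 t).mul_const c
      simpa using this
    have := (hasDerivAt_er (t ^ 2 * c)).scomp t b0
    simp only [Complex.real_smul] at this; exact this
  exact a1.mul ((a2 (2 * h)).sub (a2 h))

lemma psiw_deriv_le (s h t : ℝ) (hs0 : 0 ≤ s) (hs1 : s ≤ 1) (ht : 0 < t) :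
    ‖(((-s * t ^ (-s - 1) : ℝ) : ℂ) * (er (t ^ 2 * (2 * h)) - er (t ^ 2 * h)) +
      ((t ^ (-s) : ℝ) : ℂ) * (((2 * t * (2 * h) : ℝ) : ℂ) * (2 * π * I * er (t ^ 2 * (2 * h))) - ((2 * t * h : ℝ) : ℂ) * (2 * π * I * er (t ^ 2 * h))))‖ ≤ 14 * π * |h| * t ^ (1 - s) := by
  obtain ⟨r1, r2, r3⟩ := rpow_aux s t ht
  have hpi := Real.pi_pos
  have e1 : ‖((-s * t ^ (-s - 1) : ℝ) : ℂ) * (er (t ^ 2 * (2 * h)) - er (t ^ 2 * h))‖ ≤ 2 * π * |h| * t ^ (1 - s) := by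
    rw [norm_mul, Complex.norm_real, norm_mul, norm_neg, Real.norm_of_nonneg hs0, Real.norm_of_nonneg (by positivity)]
    calc _ ≤ 1 * t ^ (-s - 1) * (2 * π * (|h| * t ^ 2)) := by gcongr; exact er_diff_le h t
      _ = 2 * π * |h| * (t ^ (-s - 1) * t ^ 2) := by ring
      _ = _ := by rw [r2]
  have e2 : ‖((t ^ (-s) : ℝ) : ℂ) * (((2 * t * (2 * h) : ℝ) : ℂ) * (2 * π * I * er (t ^ 2 * (2 * h))) - ((2 * t * h : ℝ) : ℂ) * (2 * π * I * er (t ^ 2 * h)))‖ ≤ 12 * π * |h| * t ^ (1 - s) := by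
    rw [norm_mul, Complex.norm_real, Real.norm_of_nonneg (by positivity)]
    have hn : ∀ c d : ℝ, ‖((c:ℝ):ℂ) * (2 * π * I * er d)‖ = |c| * (2 * π) := by
      intro c d
      rw [norm_mul, norm_mul, norm_er, Complex.norm_real, Real.norm_eq_abs]
      simp [abs_of_pos hpi]
    calc _ ≤ t ^ (-s) * (|2 * t * (2 * h)| * (2 * π) + |2 * t * h| * (2 * π)) := by
          gcongr
          refine (norm_sub_le _ _).trans (le_of_eq ?_)
          rw [hn, hn]
      _ = 12 * π * |h| * (t ^ (-s) * t) := by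
          simp only [abs_mul, abs_of_pos ht, abs_two]; ring
      _ = _ := by rw [r1]
  refine (norm_add_le _ _).trans ((add_le_add e1 e2).trans (le_of_eq (by ring)))

lemma psiw_lip (s h t b : ℝ) (hs0 : 0 ≤ s) (hs1 : s ≤ 1) (ht : 0 ≤ t) (htb : t ≤ b) :
    ‖psiw s h b - psiw s h t‖ ≤ 14 * π * |h| * b ^ (1 - s) * (b - t) := by
  rcases ht.eq_or_lt with h0 | h0
  · subst h0
    rw [psiw_zero, sub_zero, sub_zero]
    rcases htb.eq_or_lt with h1 | h1
    · subst h1; rw [psiw_zero]; simp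
    · refine (psiw_le s h b h1).trans ?_
      have : 0 ≤ π * |h| * (b ^ (1 - s) * b) := by positivity
      nlinarith
  · have := (convex_Icc t b).norm_image_sub_le_of_norm_hasDerivWithin_le (f := psiw s h) (C := 14 * π * |h| * b ^ (1 - s))
      (fun x hx => (psiw_deriv s h x (h0.trans_le hx.1)).hasDerivWithinAt)
      (fun x hx => (psiw_deriv_le s h x hs0 hs1 (h0.trans_le hx.1)).trans (by
        have : 0 < x := h0.trans_le hx.1
        have h3 := hx.2
        have : 0 ≤ 1 - s := by linarith
        gcongr))
      (left_mem_Icc.2 htb) (right_mem_Icc.2 htb)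
    rwa [Real.norm_of_nonneg (by linarith)] at this

lemma psiw_cont (s h : ℝ) (hs0 : 0 ≤ s) (hs1 : s ≤ 1) (b : ℝ) : ContinuousOn (psiw s h) (Icc 0 b) := by
  rcases lt_or_ge b 0 with hb | hb
  · rw [Icc_eq_empty (by linarith)]; exact continuousOn_empty _
  have hk : 0 ≤ 14 * π * |h| * b ^ (1 - s) := by positivity
  apply LipschitzOnWith.continuousOn (K := (14 * π * |h| * b ^ (1 - s)).toNNReal)
  apply LipschitzOnWith.of_dist_le_mul
  have aux : ∀ x y : ℝ, 0 ≤ x → x ≤ y → y ≤ b → ‖psiw s h y - psiw s h x‖ ≤ 14 * π * |h| * b ^ (1 - s) * (y - x) := by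
    intro x y h1 h2 h3
    refine (psiw_lip s h x y hs0 hs1 h1 h2).trans ?_
    have : 0 ≤ 1 - s := by linarith
    have : 0 ≤ y - x := by linarith
    have : 0 ≤ y := by linarith
    gcongr
  intro x hx y hy
  rw [dist_eq_norm, Real.dist_eq, Real.coe_toNNReal _ hk]
  rcases le_total x y with h1 | h1
  · rw [norm_sub_rev, abs_sub_comm, abs_of_nonneg (sub_nonneg.2 h1)]
    exact aux x y hx.1 h1 hy.2
  · rw [abs_of_nonneg (sub_nonneg.2 h1)]
    exact aux y x hy.1 h1 hx.2

/-- low range bound -/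
lemma low_bound (s h : ℝ) (hs0 : 0 ≤ s) (hs1 : s ≤ 1) (p : ℤ) (q : ℕ) (y B : ℝ) (hB : 0 ≤ B) (K : ℕ) (hK : 1 ≤ K)
    (hD : ∀ n ≤ K, ‖DD p q n y‖ ≤ B) :
    ‖∑ n ∈ Finset.range K, st (psiw s h) p q y n‖ ≤ 16 * π * |h| * ((K:ℝ) ^ (1 - s) * K) * (B + 1) := by
  have hK0 : (0:ℝ) < K := by positivity
  have hs2 : 0 ≤ 1 - s := by linarith
  have hh := SBP (psiw s h) p q y 0 K (Nat.zero_le _) (fun _ => 14 * π * |h| * (K:ℝ) ^ (1 - s))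
    (fun n hn => (psiw_cont s h hs0 hs1 (n + 1)).mono (Icc_subset_Icc_left (Nat.cast_nonneg n)))
    (fun n hn t ht => by
      have hnK : (n:ℝ) + 1 ≤ K := by exact_mod_cast (Finset.mem_Ico.1 hn).2
      refine (psiw_lip s h t (n + 1) hs0 hs1 ((Nat.cast_nonneg n).trans ht.1) ht.2).trans ?_
      calc _ ≤ 14 * π * |h| * (K:ℝ) ^ (1 - s) * 1 := by
            have := ht.1
            have := ht.2
            gcongr
            linarith
        _ = _ := mul_one _)
  rw [Nat.Ico_zero_eq_range, DD_zero, norm_zero, mul_zero, add_zero] at hh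
  refine hh.trans ?_
  have h1 : ‖psiw s h K‖ * ‖DD p q K y‖ ≤ 2 * π * |h| * ((K:ℝ) ^ (1 - s) * K) * B := by
    apply mul_le_mul (psiw_le s h K hK0) (hD K le_rfl) (norm_nonneg _) (by positivity)
  have h2 : ∑ n ∈ Finset.range K, 14 * π * |h| * (K:ℝ) ^ (1 - s) * ‖DD p q n y‖ ≤ 14 * π * |h| * ((K:ℝ) ^ (1 - s) * K) * B := by
    calc _ ≤ ∑ n ∈ Finset.range K, 14 * π * |h| * (K:ℝ) ^ (1 - s) * B := by
          apply Finset.sum_le_sum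
          intro n hn
          have := hD n (Finset.mem_range.1 hn).le
          gcongr
      _ = _ := by rw [Finset.sum_const, Finset.card_range, nsmul_eq_mul]; ring
  have h3 : ∑ n ∈ Finset.range K, 14 * π * |h| * (K:ℝ) ^ (1 - s) = 14 * π * |h| * ((K:ℝ) ^ (1 - s) * K) := by
    rw [Finset.sum_const, Finset.card_range, nsmul_eq_mul]; ring
  rw [h3]
  have : 0 ≤ π * |h| * ((K:ℝ) ^ (1 - s) * K) := by positivity
  nlinarith


noncomputable def phw (s : ℝ) (t : ℝ) : ℂ := ((t ^ (-s) : ℝ) : ℂ)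

noncomputable def aw (s : ℝ) (n : ℕ) : ℝ := (n:ℝ) ^ (-s) - ((n:ℝ) + 1) ^ (-s)

lemma aw_nonneg (s : ℝ) (hs : 0 ≤ s) (n : ℕ) (hn : 1 ≤ n) : 0 ≤ aw s n := by
  have hn0 : (0:ℝ) < n := by positivity
  unfold aw
  rw [sub_nonneg]
  exact Real.rpow_le_rpow_of_nonpos hn0 (by linarith) (by linarith)

lemma aw_sqrt (s : ℝ) (hs : 1 / 2 < s) (n : ℕ) (hn : 1 ≤ n) :
    aw s n * Real.sqrt n ≤ s / (s - 1 / 2) * ((n:ℝ) ^ (1 / 2 - s) - ((n:ℝ) + 1) ^ (1 / 2 - s)) := by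
  have hn0 : (0:ℝ) < n := by positivity
  have hn1 : (0:ℝ) < (n:ℝ) + 1 := by positivity
  have hs' : 0 < s - 1 / 2 := by linarith
  set r : ℝ := n / (n + 1) with hr
  have hr0 : 0 < r := by positivity
  have hu0 : 0 < r ^ (s - 1 / 2) := by positivity
  have bern := one_add_mul_self_le_rpow_one_add (s := r ^ (s - 1 / 2) - 1) (by linarith) (p := s / (s - 1 / 2))
    (by rw [le_div_iff₀ hs']; linarith)
  have e1 : (1 + (r ^ (s - 1 / 2) - 1)) ^ (s / (s - 1 / 2)) = r ^ s := by
    rw [add_sub_cancel, ← Real.rpow_mul hr0.le]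
    rw [mul_comm (s - 1 / 2), div_mul_cancel₀ _ hs'.ne']
  rw [e1] at bern
  have e2 : (n:ℝ) ^ (1 / 2 - s) * r ^ (s - 1 / 2) = ((n:ℝ) + 1) ^ (1 / 2 - s) := by
    rw [hr, Real.div_rpow hn0.le hn1.le, ← mul_div_assoc, ← Real.rpow_add hn0, show 1 / 2 - s = -(s - 1 / 2) by ring, Real.rpow_neg hn1.le]
    simp
  have e3 : (n:ℝ) ^ (1 / 2 - s) = (n:ℝ) ^ (-s) * Real.sqrt n := by
    rw [Real.sqrt_eq_rpow, ← Real.rpow_add hn0]; congr 1; ring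
  have e4 : (n:ℝ) ^ (-s) * r ^ s = ((n:ℝ) + 1) ^ (-s) := by
    rw [hr, Real.div_rpow hn0.le hn1.le, ← mul_div_assoc, ← Real.rpow_add hn0, Real.rpow_neg hn1.le]
    simp
  have e5 : aw s n * Real.sqrt n = (n:ℝ) ^ (1 / 2 - s) * (1 - r ^ s) := by
    unfold aw; rw [← e4, e3]; ring
  rw [e5, ← e2]
  have : 0 < (n:ℝ) ^ (1 / 2 - s) := by positivity
  calc _ ≤ (n:ℝ) ^ (1 / 2 - s) * (s / (s - 1 / 2) * (1 - r ^ (s - 1 / 2))) := by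
        gcongr; linarith
    _ = _ := by ring

lemma aw_sum (s : ℝ) (hs : 1 / 2 < s) (M N : ℕ) (hM : 1 ≤ M) (hMN : M ≤ N) :
    ∑ n ∈ Finset.Ico M N, aw s n * Real.sqrt n ≤ s / (s - 1 / 2) * (M:ℝ) ^ (1 / 2 - s) := by
  have hs' : 0 < s - 1 / 2 := by linarith
  have t1 := Finset.sum_Ico_sub (f := fun n : ℕ => -(n:ℝ) ^ (1 / 2 - s)) hMN
  calc _ ≤ ∑ n ∈ Finset.Ico M N, s / (s - 1 / 2) * ((n:ℝ) ^ (1 / 2 - s) - ((n:ℝ) + 1) ^ (1 / 2 - s)) :=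
        Finset.sum_le_sum fun n hn => aw_sqrt s hs n (hM.trans (Finset.mem_Ico.1 hn).1)
    _ = s / (s - 1 / 2) * ∑ n ∈ Finset.Ico M N, (-((n + 1 : ℕ):ℝ) ^ (1 / 2 - s) - -(n:ℝ) ^ (1 / 2 - s)) := by
        rw [Finset.mul_sum]
        apply Finset.sum_congr rfl
        intro n _; push_cast; ring
    _ = s / (s - 1 / 2) * (-(N:ℝ) ^ (1 / 2 - s) - -(M:ℝ) ^ (1 / 2 - s)) := by rw [t1]
    _ ≤ _ := by
        have : 0 ≤ (N:ℝ) ^ (1 / 2 - s) := by positivity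
        gcongr
        linarith

lemma aw_tel (s : ℝ) (M N : ℕ) (hMN : M ≤ N) :
    ∑ n ∈ Finset.Ico M N, aw s n ≤ (M:ℝ) ^ (-s) := by
  have t1 := Finset.sum_Ico_sub (f := fun n : ℕ => -(n:ℝ) ^ (-s)) hMN
  have : 0 ≤ (N:ℝ) ^ (-s) := by positivity
  calc _ = ∑ n ∈ Finset.Ico M N, (-((n + 1 : ℕ):ℝ) ^ (-s) - -(n:ℝ) ^ (-s)) := by
        apply Finset.sum_congr rfl
        intro n _; unfold aw; push_cast; ring
    _ ≤ _ := by rw [t1]; linarith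

lemma phw_cont (s : ℝ) (n : ℕ) (hn : 1 ≤ n) : ContinuousOn (phw s) (Icc (n:ℝ) (n + 1)) := by
  have hn0 : (0:ℝ) < n := by positivity
  unfold phw
  apply Complex.continuous_ofReal.comp_continuousOn
  exact continuousOn_id.rpow_const fun x hx => Or.inl (ne_of_gt (hn0.trans_le hx.1))

lemma norm_phw (s t : ℝ) (ht : 0 ≤ t) : ‖phw s t‖ = t ^ (-s) := by
  unfold phw; rw [Complex.norm_real, Real.norm_of_nonneg (by positivity)]

lemma high_ptw (s : ℝ) (hs : 1 / 2 < s) (p : ℤ) (q : ℕ) (y : ℝ) (M N : ℕ) (hM : 1 ≤ M) (hMN : M ≤ N) :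
    ‖∑ n ∈ Finset.Ico M N, st (phw s) p q y n‖ ≤ (N:ℝ) ^ (-s) * ‖DD p q N y‖ + (M:ℝ) ^ (-s) * ‖DD p q M y‖ +
      ∑ n ∈ Finset.Ico M N, aw s n * ‖DD p q n y‖ + (M:ℝ) ^ (-s) := by
  have h := SBP (phw s) p q y M N hMN (aw s)
    (fun n hn => phw_cont s n (hM.trans (Finset.mem_Ico.1 hn).1))
    (fun n hn t ht => by
      have hn1 : 1 ≤ n := hM.trans (Finset.mem_Ico.1 hn).1
      have hn0 : (0:ℝ) < n := by positivity
      have ht0 : 0 < t := hn0.trans_le ht.1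
      have h1 : t ^ (-s) ≤ (n:ℝ) ^ (-s) := Real.rpow_le_rpow_of_nonpos hn0 ht.1 (by linarith)
      have h2 : ((n:ℝ) + 1) ^ (-s) ≤ t ^ (-s) := Real.rpow_le_rpow_of_nonpos ht0 ht.2 (by linarith)
      unfold phw aw
      rw [← Complex.ofReal_sub, Complex.norm_real, Real.norm_eq_abs, abs_le]
      constructor <;> linarith)
  rw [norm_phw _ _ (Nat.cast_nonneg N), norm_phw _ _ (Nat.cast_nonneg M)] at h
  linarith [aw_tel s M N hMN]

lemma high_L2 (s : ℝ) (hs : 1 / 2 < s) : ∃ C : ℝ, 1 ≤ C ∧ ∀ (q : ℕ) (p : ℤ), 1 ≤ q → IsCoprime p (q:ℤ) → ∀ H : ℝ, 0 < H → H ≤ ((q:ℝ) ^ 2)⁻¹ →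
    ∀ M N : ℕ, 1 ≤ M → M ≤ N → 1 ≤ 8 * (M * Real.sqrt H) → ∃ G : ℝ → ℝ, Continuous G ∧
      (∀ y, ‖∑ n ∈ Finset.Ico M N, st (phw s) p q y n‖ ^ 2 ≤ G y) ∧
      ∀ a b : ℝ, a ≤ b → -(5 * Real.sqrt H / q) ≤ a → b ≤ 5 * Real.sqrt H / q → b - a ≤ 2 * H →
        ∫ y in a..b, G y ≤ C * (H * (M:ℝ) ^ (1 - 2 * s)) := by
  obtain ⟨C, hC, hL⟩ := DD_L2
  set c : ℝ := s / (s - 1 / 2) with hc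
  have hs' : 0 < s - 1 / 2 := by linarith
  have hc0 : 0 ≤ c := by rw [hc]; apply div_nonneg <;> linarith
  refine ⟨4 * (2 * C + C * c ^ 2 + 2), by nlinarith [mul_nonneg (by linarith : 0 ≤ C) (sq_nonneg c)], fun q p hq hcp H hH hHq M N hM hMN hMH => ?_⟩
  have hM0 : (0:ℝ) < M := by positivity
  have hM1 : (1:ℝ) ≤ M := by exact_mod_cast hM
  have hN0 : (0:ℝ) < N := by exact_mod_cast (hM.trans hMN)
  have hMNr : (M:ℝ) ≤ N := by exact_mod_cast hMN
  set φN : ℝ := (N:ℝ) ^ (-s) with hφN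
  set φM : ℝ := (M:ℝ) ^ (-s) with hφM
  set S : ℝ := ∑ n ∈ Finset.Ico M N, aw s n * Real.sqrt n with hS
  set m : ℝ := (M:ℝ) ^ (1 - 2 * s) with hm
  have ha0 : ∀ n ∈ Finset.Ico M N, 0 ≤ aw s n := fun n hn => aw_nonneg s (by linarith) n (hM.trans (Finset.mem_Ico.1 hn).1)
  have hn0 : ∀ n ∈ Finset.Ico M N, (0:ℝ) < n := fun n hn => by exact_mod_cast (hM.trans (Finset.mem_Ico.1 hn).1)
  have hS0 : 0 ≤ S := Finset.sum_nonneg fun n hn => mul_nonneg (ha0 n hn) (Real.sqrt_nonneg _)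
  have hφN2 : φN ^ 2 * N ≤ m := by
    have : φN ^ 2 * N = (N:ℝ) ^ (1 - 2 * s) := by
      rw [hφN, ← Real.rpow_natCast, ← Real.rpow_mul hN0.le, ← Real.rpow_add_one hN0.ne']; congr 1; push_cast; ring
    rw [this]
    exact Real.rpow_le_rpow_of_nonpos hM0 hMNr (by linarith)
  have hφM2 : φM ^ 2 * M = m := by
    rw [hφM, ← Real.rpow_natCast, ← Real.rpow_mul hM0.le, ← Real.rpow_add_one hM0.ne']; congr 1; push_cast; ring
  have hm0 : 0 ≤ m := by positivity
  have hφM3 : φM ^ 2 ≤ m := by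
    rw [← hφM2]; nlinarith [sq_nonneg φM]
  have hS2 : S ^ 2 ≤ c ^ 2 * m := by
    have h1 := aw_sum s hs M N hM hMN
    calc S ^ 2 ≤ (c * (M:ℝ) ^ (1 / 2 - s)) ^ 2 := by gcongr
      _ = c ^ 2 * m := by
        rw [mul_pow, hm, ← Real.rpow_natCast ((M:ℝ) ^ (1 / 2 - s)), ← Real.rpow_mul hM0.le]
        congr 2; push_cast; ring
  refine ⟨fun y => 4 * (φN ^ 2 * ‖DD p q N y‖ ^ 2 + φM ^ 2 * ‖DD p q M y‖ ^ 2 + S * (∑ n ∈ Finset.Ico M N, aw s n / Real.sqrt n * ‖DD p q n y‖ ^ 2) + φM ^ 2), ?_, ?_, ?_⟩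
  · have hk : ∀ n, Continuous fun y => ‖DD p q n y‖ ^ 2 := fun n => (DD_cont p q n).norm.pow 2
    exact continuous_const.mul ((((continuous_const.mul (hk N)).add (continuous_const.mul (hk M))).add
      (continuous_const.mul (continuous_finsetSum _ fun n _ => continuous_const.mul (hk n)))).add continuous_const)
  · intro y
    have h1 := high_ptw s hs p q y M N hM hMN
    have cs : (∑ n ∈ Finset.Ico M N, aw s n * ‖DD p q n y‖) ^ 2 ≤ S * (∑ n ∈ Finset.Ico M N, aw s n / Real.sqrt n * ‖DD p q n y‖ ^ 2) := by
      apply Finset.sum_sq_le_sum_mul_sum_of_sq_le_mul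
      · intro n hn; exact mul_nonneg (ha0 n hn) (Real.sqrt_nonneg _)
      · intro n hn; have := ha0 n hn; positivity
      · intro n hn
        have : 0 < Real.sqrt n := Real.sqrt_pos.2 (hn0 n hn)
        apply le_of_eq
        field_simp
    set x1 := (N:ℝ) ^ (-s) * ‖DD p q N y‖ with hx1
    set x2 := (M:ℝ) ^ (-s) * ‖DD p q M y‖ with hx2
    set x3 := ∑ n ∈ Finset.Ico M N, aw s n * ‖DD p q n y‖ with hx3
    calc _ ≤ (x1 + x2 + x3 + φM) ^ 2 := by gcongr
      _ ≤ 4 * (x1 ^ 2 + x2 ^ 2 + x3 ^ 2 + φM ^ 2) := by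
          nlinarith [sq_nonneg (x1 - x2), sq_nonneg (x1 - x3), sq_nonneg (x1 - φM), sq_nonneg (x2 - x3), sq_nonneg (x2 - φM), sq_nonneg (x3 - φM)]
      _ ≤ _ := by
          rw [hx1, hx2, mul_pow, mul_pow]
          linarith
  · intro a b hab ha hb hba
    have hi : ∀ n, IntervalIntegrable (fun y => ‖DD p q n y‖ ^ 2) volume a b := fun n =>
      ((DD_cont p q n).norm.pow 2).intervalIntegrable a b
    have hD : ∀ n : ℕ, M ≤ n → ∫ y in a..b, ‖DD p q n y‖ ^ 2 ≤ C * (n * H) := by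
      intro n hn
      apply hL q p hq hcp H hH hHq n _ a b hab ha hb hba
      refine hMH.trans ?_
      have : (M:ℝ) ≤ n := by exact_mod_cast hn
      gcongr
    have hsum : IntervalIntegrable (fun y => ∑ n ∈ Finset.Ico M N, aw s n / Real.sqrt n * ‖DD p q n y‖ ^ 2) volume a b :=
      (continuous_finsetSum _ fun n _ => continuous_const.mul ((DD_cont p q n).norm.pow 2)).intervalIntegrable a b
    rw [intervalIntegral.integral_const_mul, intervalIntegral.integral_add ((((hi N).const_mul _).add ((hi M).const_mul _)).add (hsum.const_mul _)) (by simp),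
      intervalIntegral.integral_add (((hi N).const_mul _).add ((hi M).const_mul _)) (hsum.const_mul _),
      intervalIntegral.integral_add ((hi N).const_mul _) ((hi M).const_mul _),
      intervalIntegral.integral_const_mul, intervalIntegral.integral_const_mul, intervalIntegral.integral_const_mul,
      intervalIntegral.integral_const, smul_eq_mul, intervalIntegral.integral_finsetSum (fun n _ => (hi n).const_mul _)]
    have s1 : φN ^ 2 * ∫ y in a..b, ‖DD p q N y‖ ^ 2 ≤ C * H * m := by
      calc _ ≤ φN ^ 2 * (C * (N * H)) := by gcongr; exact hD N hMN
        _ = C * H * (φN ^ 2 * N) := by ring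
        _ ≤ _ := by gcongr
    have s2 : φM ^ 2 * ∫ y in a..b, ‖DD p q M y‖ ^ 2 ≤ C * H * m := by
      calc _ ≤ φM ^ 2 * (C * (M * H)) := by gcongr; exact hD M le_rfl
        _ = C * H * (φM ^ 2 * M) := by ring
        _ = _ := by rw [hφM2]
    have s3 : S * ∑ n ∈ Finset.Ico M N, ∫ y in a..b, aw s n / Real.sqrt n * ‖DD p q n y‖ ^ 2 ≤ C * H * (c ^ 2 * m) := by
      calc _ ≤ S * ∑ n ∈ Finset.Ico M N, C * H * (aw s n * Real.sqrt n) := by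
            gcongr with n hn
            rw [intervalIntegral.integral_const_mul]
            have h0 : 0 < Real.sqrt n := Real.sqrt_pos.2 (hn0 n hn)
            have h1 : Real.sqrt n ^ 2 = n := Real.sq_sqrt (hn0 n hn).le
            have h2 := ha0 n hn
            calc _ ≤ aw s n / Real.sqrt n * (C * (n * H)) := by gcongr; exact hD n (Finset.mem_Ico.1 hn).1
              _ = aw s n / Real.sqrt n * (C * (Real.sqrt n ^ 2 * H)) := by rw [h1]
              _ = _ := by field_simp
        _ = C * H * S ^ 2 := by rw [← Finset.mul_sum]; ring
        _ ≤ _ := by gcongr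
    have s4 : (b - a) * φM ^ 2 ≤ 2 * H * m := by gcongr
    have : 4 * (2 * C + C * c ^ 2 + 2) * (H * m) = 4 * (C * H * m + C * H * m + C * H * (c ^ 2 * m) + 2 * H * m) := by ring
    rw [this]
    gcongr


lemma er_eq_exp (t : ℝ) : er t = Complex.exp (2 * π * I * t) := by
  unfold er ee; rfl

lemma FsN_eq (s : ℝ) (N : ℕ) (x : ℝ) : FsN s N x = ∑ n ∈ Finset.range N, phw s (n + 1) * er ((n + 1) ^ 2 * x) := by
  induction N with
  | zero => simp [FsN]
  | succ N ih =>
    rw [Finset.sum_range_succ, ← ih]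
    unfold FsN
    rw [Finset.sum_Icc_succ_top (by omega)]
    congr 1
    unfold phw
    rw [er_eq_exp]
    push_cast
    congr 2
    ring

lemma fMain_eq (s δ h : ℝ) (hs0 : 0 ≤ s) (hs1 : s ≤ 1) (N : ℕ) :
    fMain s δ N h = ∑ n ∈ Finset.range N, ∫ t in (n:ℝ)..(n + 1), psiw s h t * er (t ^ 2 * δ) := by
  have e : fMain s δ N h = ∫ t in (0:ℝ)..N, psiw s h t * er (t ^ 2 * δ) := by
    unfold fMain psiw
    congr 1
    funext t
    rw [mul_assoc _ (er _ - er _), sub_mul, ← er_add, ← er_add, er_eq_exp, er_eq_exp]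
    push_cast
    congr 3 <;> ring
  rw [e]
  have h := intervalIntegral.sum_integral_adjacent_intervals (μ := volume) (f := fun t => psiw s h t * er (t ^ 2 * δ)) (a := fun n : ℕ => (n:ℝ)) (n := N)
    (fun k _ => by
      apply ContinuousOn.intervalIntegrable
      rw [uIcc_of_le (by push_cast; linarith)]
      exact ((psiw_cont s h hs0 hs1 _).mono (Icc_subset_Icc_left (Nat.cast_nonneg k))).mul (cont_sq δ).continuousOn)
  push_cast at h
  exact h.symm

lemma g_eq (s δ h : ℝ) (hs0 : 0 ≤ s) (hs1 : s ≤ 1) (p : ℤ) (q N : ℕ) :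
    FsN s N ((p : ℝ) / q + δ + 2 * h) - FsN s N ((p : ℝ) / q + δ + h) -
      gaussTheta p q 0 / (Real.sqrt q : ℂ) * fMain s δ (N : ℝ) h = ∑ n ∈ Finset.range N, st (psiw s h) p q δ n := by
  have e1 : gaussTheta p q 0 / (Real.sqrt q : ℂ) = gaussTau p q 0 / q := by
    unfold gaussTheta
    rw [div_div, ← Complex.ofReal_mul, Real.mul_self_sqrt (Nat.cast_nonneg q), Complex.ofReal_natCast]
  rw [e1, FsN_eq, FsN_eq, fMain_eq s δ h hs0 hs1, Finset.mul_sum, ← Finset.sum_sub_distrib, ← Finset.sum_sub_distrib]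
  apply Finset.sum_congr rfl
  intro n _
  unfold st
  congr 1
  unfold phw psiw
  rw [mul_assoc, sub_mul, ← er_add, ← er_add, ← mul_sub]
  congr 3 <;> ring

lemma st_split (s δ h : ℝ) (p : ℤ) (q n : ℕ) (hn : 1 ≤ n) :
    st (psiw s h) p q δ n = st (phw s) p q (δ + 2 * h) n - st (phw s) p q (δ + h) n := by
  have i1 : ∀ y : ℝ, IntervalIntegrable (fun t : ℝ => phw s t * er (t ^ 2 * y)) volume n (n + 1) := by
    intro y
    apply ContinuousOn.intervalIntegrable
    rw [uIcc_of_le (by linarith)]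
    exact (phw_cont s n hn).mul (cont_sq y).continuousOn
  have e : ∫ t in (n:ℝ)..(n + 1), psiw s h t * er (t ^ 2 * δ) =
      (∫ t in (n:ℝ)..(n + 1), phw s t * er (t ^ 2 * (δ + 2 * h))) - ∫ t in (n:ℝ)..(n + 1), phw s t * er (t ^ 2 * (δ + h)) := by
    rw [← intervalIntegral.integral_sub (i1 _) (i1 _)]
    congr 1
    funext t
    unfold phw psiw
    rw [mul_assoc, sub_mul, ← er_add, ← er_add, ← mul_sub]
    congr 3 <;> ring
  have e2 : psiw s h (n + 1) * er ((n + 1) ^ 2 * (p / q + δ)) = phw s (n + 1) * er ((n + 1) ^ 2 * (p / q + (δ + 2 * h))) - phw s (n + 1) * er ((n + 1) ^ 2 * (p / q + (δ + h))) := by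
    unfold phw psiw
    rw [mul_assoc, sub_mul, ← er_add, ← er_add, ← mul_sub]
    congr 3 <;> ring
  unfold st
  rw [e, e2]
  ring

lemma ann_int (H : ℝ) (hH : 0 < H) (U : ℝ → ℝ) (hU : Continuous U) : Integrable U (annMeasure H) ∧
    ∫ h, U h ∂ annMeasure H = (2 * H)⁻¹ * ((∫ h in (-(2 * H))..(-H), U h) + ∫ h in H..(2 * H), U h) := by
  have i1 : IntegrableOn U (Icc (-(2 * H)) (-H)) := hU.continuousOn.integrableOn_compact isCompact_Icc
  have i2 : IntegrableOn U (Icc H (2 * H)) := hU.continuousOn.integrableOn_compact isCompact_Icc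
  have hd : Disjoint (Icc (-(2 * H)) (-H)) (Icc H (2 * H)) := by
    rw [Set.disjoint_left]
    intro x hx hx'
    linarith [hx.2, hx'.1]
  unfold annMeasure
  constructor
  · apply Integrable.smul_measure (i1.union i2)
    simp [hH]
  · rw [integral_smul_measure, setIntegral_union hd measurableSet_Icc i1 i2, integral_Icc_eq_integral_Ioc, integral_Icc_eq_integral_Ioc,
      ← intervalIntegral.integral_of_le (by linarith), ← intervalIntegral.integral_of_le (by linarith), ENNReal.toReal_inv,
      ENNReal.toReal_ofReal (by linarith), smul_eq_mul]

lemma ann_sub (δ H : ℝ) (hH : 0 < H) (G : ℝ → ℝ) (hG : Continuous G) (L T R : ℝ) (hR : |δ| + 4 * H ≤ R)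
    (hT : ∀ a b : ℝ, a ≤ b → -R ≤ a → b ≤ R → b - a ≤ 2 * H → ∫ y in a..b, G y ≤ T) :
    ∫ h, (3 * L ^ 2 + 3 * G (δ + 2 * h) + 3 * G (δ + h)) ∂ annMeasure H ≤ 3 * L ^ 2 + 9 / 2 * (T / H) := by
  have hU : Continuous fun h : ℝ => 3 * L ^ 2 + 3 * G (δ + 2 * h) + 3 * G (δ + h) := by fun_prop
  rw [(ann_int H hH _ hU).2]
  have key : ∀ a b : ℝ, a ≤ b → -(2 * H) ≤ a → b ≤ 2 * H → b - a = H →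
      ∫ h in a..b, (3 * L ^ 2 + 3 * G (δ + 2 * h) + 3 * G (δ + h)) ≤ 3 * L ^ 2 * H + 9 / 2 * T := by
    intro a b hab ha hb hba
    have c1 : Continuous fun h : ℝ => 3 * G (δ + 2 * h) := by fun_prop
    have c2 : Continuous fun h : ℝ => 3 * G (δ + h) := by fun_prop
    rw [intervalIntegral.integral_add ((show Continuous fun h : ℝ => 3 * L ^ 2 + 3 * G (δ + 2 * h) from continuous_const.add c1).intervalIntegrable _ _) (c2.intervalIntegrable _ _),
      intervalIntegral.integral_add (continuous_const.intervalIntegrable _ _) (c1.intervalIntegrable _ _),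
      intervalIntegral.integral_const, intervalIntegral.integral_const_mul, intervalIntegral.integral_const_mul,
      intervalIntegral.integral_comp_add_mul G two_ne_zero, intervalIntegral.integral_comp_add_left, hba]
    have hδ := abs_le.1 (le_refl |δ|)
    have t1 := hT (δ + 2 * a) (δ + 2 * b) (by linarith) (by linarith) (by linarith) (by linarith)
    have t2 := hT (δ + a) (δ + b) (by linarith) (by linarith) (by linarith) (by linarith)
    simp only [smul_eq_mul]
    linarith
  have k1 := key (-(2 * H)) (-H) (by linarith) (by linarith) (by linarith) (by ring)
  have k2 := key H (2 * H) (by linarith) (by linarith) (by linarith) (by ring)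
  calc _ ≤ (2 * H)⁻¹ * ((3 * L ^ 2 * H + 9 / 2 * T) + (3 * L ^ 2 * H + 9 / 2 * T)) := by gcongr
    _ = _ := by field_simp; ring

lemma pow_low (s H : ℝ) (q K : ℕ) (hs1 : s ≤ 1) (hH : 0 < H) (hHq : Real.sqrt H * q ≤ 1) (hK : (K:ℝ) ≤ 2 / Real.sqrt H) (hK1 : 1 ≤ K) :
    H * ((K:ℝ) ^ (1 - s) * K) * Real.sqrt q ≤ 4 ^ (1 - s) * 4 * H ^ ((s - 1 / 2) / 2) := by
  set r := Real.sqrt H with hr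
  have hr0 : 0 < r := Real.sqrt_pos.2 hH
  have hHr : H = r ^ (2:ℝ) := by
    rw [Real.rpow_two, hr, Real.sq_sqrt hH.le]
  have hs2 : 0 ≤ 1 - s := by linarith
  have k1 : (K:ℝ) ^ (1 - s) ≤ 4 ^ (1 - s) * r ^ (s - 1) := by
    calc (K:ℝ) ^ (1 - s) ≤ (4 / r) ^ (1 - s) := by
          apply Real.rpow_le_rpow (by positivity) (hK.trans _) hs2
          gcongr; norm_num
      _ = _ := by
          rw [Real.div_rpow (by norm_num) hr0.le, show s - 1 = -(1 - s) by ring, Real.rpow_neg hr0.le, div_eq_mul_inv]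
  have k2 : (K:ℝ) ≤ 4 * r ^ (-1:ℝ) := by
    rw [Real.rpow_neg_one, ← div_eq_mul_inv]
    refine hK.trans ?_
    gcongr; norm_num
  have k3 : Real.sqrt q ≤ r ^ (-(1 / 2) : ℝ) := by
    rw [Real.rpow_neg hr0.le, ← Real.sqrt_eq_rpow, ← Real.sqrt_inv]
    apply Real.sqrt_le_sqrt
    rw [← one_div, le_div_iff₀ hr0]
    linarith
  calc _ ≤ H * ((4 ^ (1 - s) * r ^ (s - 1)) * (4 * r ^ (-1:ℝ))) * r ^ (-(1 / 2) : ℝ) := by gcongr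
    _ = 4 ^ (1 - s) * 4 * (r ^ (2:ℝ) * r ^ (s - 1) * r ^ (-1:ℝ) * r ^ (-(1 / 2) : ℝ)) := by rw [hHr]; ring
    _ = _ := by
      rw [← Real.rpow_add hr0, ← Real.rpow_add hr0, ← Real.rpow_add hr0]
      congr 1
      rw [hHr, ← Real.rpow_mul hr0.le]
      congr 1; ring

lemma final_arith (CL C2 H σ : ℝ) (hH : 0 < H) (hCL0 : 0 < CL) (hC2 : 1 ≤ C2) :
    3 * (CL * σ) ^ 2 + 9 / 2 * (C2 * (H * (8 * σ ^ 2)) / H) ≤ ((2 * CL + 6 * C2) * σ) ^ 2 := by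
  have e : C2 * (H * (8 * σ ^ 2)) / H = 8 * C2 * σ ^ 2 := by field_simp
  rw [e]
  have h1 : 3 * CL ^ 2 + 36 * C2 ≤ (2 * CL + 6 * C2) ^ 2 := by
    nlinarith [mul_pos hCL0 (by linarith : 0 < C2)]
  have h2 := mul_le_mul_of_nonneg_right h1 (sq_nonneg σ)
  nlinarith

set_option maxHeartbeats 1000000 in
lemma assembly (s : ℝ) (hs : s ∈ Set.Ioc (1/2 : ℝ) 1) :
    ∃ C : ℝ, 0 < C ∧
      ∀ (p : ℤ) (q : ℕ), 1 ≤ q → IsCoprime p (q : ℤ) →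
        ∀ H : ℝ, 0 < H → H ≤ ((q : ℝ) ^ 2)⁻¹ →
          ∀ δ : ℝ, |δ| ≤ Real.sqrt H / q →
            ∀ N : ℕ, 1 ≤ N →
              Real.sqrt (∫ h,
                  ‖FsN s N ((p : ℝ) / q + δ + 2 * h) - FsN s N ((p : ℝ) / q + δ + h) -
                      gaussTheta p q 0 / (Real.sqrt q : ℂ) * fMain s δ (N : ℝ) h‖ ^ 2
                    ∂ annMeasure H) ≤
                C * H ^ ((s - 1/2) / 2) := by
  obtain ⟨hs0, hs1⟩ := hs
  obtain ⟨C1, hC1, h1⟩ := DD_small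
  obtain ⟨C2, hC2, h2⟩ := high_L2 s hs0
  set c4 : ℝ := 4 ^ (1 - s) * 4 with hc4
  have hc40 : 0 < c4 := by positivity
  set CL : ℝ := 32 * π * (C1 + 3) * c4 with hCL
  have hpi := Real.pi_pos
  have hCL0 : 0 < CL := by have : 0 < C1 + 3 := by linarith
                           positivity
  refine ⟨2 * CL + 6 * C2, by linarith, fun p q hq hcp H hH hHq δ hδ N hN => ?_⟩
  have hq0 : (0:ℝ) < q := by positivity
  have hq1 : (1:ℝ) ≤ q := by exact_mod_cast hq
  have hsH : 0 < Real.sqrt H := Real.sqrt_pos.2 hH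
  have hsq : Real.sqrt H ^ 2 = H := Real.sq_sqrt hH.le
  have hsHq : Real.sqrt H * q ≤ 1 := by
    rw [← abs_of_pos (mul_pos hsH hq0), ← sq_le_one_iff_abs_le_one, mul_pow, hsq]
    calc _ ≤ ((q:ℝ) ^ 2)⁻¹ * q ^ 2 := by gcongr
      _ = 1 := by field_simp
  have hsH1 : Real.sqrt H ≤ 1 := by nlinarith
  set σ : ℝ := H ^ ((s - 1 / 2) / 2) with hσ
  have hσ0 : 0 < σ := by positivity
  have hHR : |δ| + 4 * H ≤ 5 * Real.sqrt H / q := by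
    have : H ≤ Real.sqrt H / q := by rw [le_div_iff₀ hq0]; nlinarith
    have e : 5 * Real.sqrt H / q = 5 * (Real.sqrt H / q) := by ring
    rw [e]; linarith
  have hδ5 : |δ| ≤ 5 / (q:ℝ) ^ 2 := by
    refine hδ.trans ?_
    rw [div_le_div_iff₀ hq0 (by positivity)]
    nlinarith
  set M : ℕ := ⌈1 / (8 * Real.sqrt H)⌉₊ with hM
  have hMpos : 1 ≤ M := Nat.one_le_iff_ne_zero.2 (Nat.ceil_pos.2 (by positivity)).ne'
  have hMge : 1 / (8 * Real.sqrt H) ≤ M := Nat.le_ceil _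
  have hMlt : (M:ℝ) < 1 / (8 * Real.sqrt H) + 1 := Nat.ceil_lt_add_one (by positivity)
  have hM8 : 1 ≤ 8 * (M * Real.sqrt H) := by
    rw [div_le_iff₀ (by positivity)] at hMge; linarith
  have hM2 : (M:ℝ) ≤ 2 / Real.sqrt H := by
    rw [le_div_iff₀ hsH]
    have : (1 / (8 * Real.sqrt H) + 1) * Real.sqrt H = 1 / 8 + Real.sqrt H := by field_simp
    nlinarith
  -- low-range bound on DD
  have hsmall : ∀ n : ℕ, n < M → ‖DD p q n δ‖ ≤ C1 * Real.sqrt q := by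
    intro n hn
    apply h1 q p hq hcp δ hδ5 n
    have h3 : (n:ℝ) < 1 / (8 * Real.sqrt H) := Nat.lt_ceil.1 hn
    rw [lt_div_iff₀ (by positivity)] at h3
    rw [le_div_iff₀ hq0] at hδ
    calc 8 * |δ| * n * q = 8 * n * (|δ| * q) := by ring
      _ ≤ 8 * n * Real.sqrt H := by gcongr
      _ ≤ 1 := by linarith
  have hB : ∀ n : ℕ, n ≤ M → ‖DD p q n δ‖ ≤ C1 * Real.sqrt q + 2 := by
    intro n hn
    rcases hn.lt_or_eq with h | h
    · linarith [hsmall n h]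
    · obtain ⟨k, hk⟩ : ∃ k, n = k + 1 := ⟨n - 1, by omega⟩
      rw [hk]
      have := DD_succ_le p q k δ
      have := hsmall k (by omega)
      linarith
  have hsq1 : 1 ≤ Real.sqrt q := Real.one_le_sqrt.2 hq1
  have hlow : ∀ h : ℝ, |h| ≤ 2 * H → ∀ K : ℕ, 1 ≤ K → K ≤ M → ‖∑ n ∈ Finset.range K, st (psiw s h) p q δ n‖ ≤ CL * σ := by
    intro h hh K hK hKM
    have hK2 : (K:ℝ) ≤ 2 / Real.sqrt H := le_trans (by exact_mod_cast hKM) hM2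
    have hp := pow_low s H q K hs1 hH hsHq hK2 hK
    calc _ ≤ 16 * π * |h| * ((K:ℝ) ^ (1 - s) * K) * ((C1 * Real.sqrt q + 2) + 1) :=
          low_bound s h (by linarith) hs1 p q δ _ (by positivity) K hK fun n hn => hB n (hn.trans hKM)
      _ ≤ 16 * π * (2 * H) * ((K:ℝ) ^ (1 - s) * K) * ((C1 + 3) * Real.sqrt q) := by
          gcongr
          linarith
      _ = 32 * π * (C1 + 3) * (H * ((K:ℝ) ^ (1 - s) * K) * Real.sqrt q) := by ring
      _ ≤ 32 * π * (C1 + 3) * (c4 * σ) := by gcongr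
      _ = _ := by rw [hCL]; ring
  have hm : H * (M:ℝ) ^ (1 - 2 * s) ≤ H * (8 * σ ^ 2) := by
    gcongr
    have e8 : (0:ℝ) < 1 / (8 * Real.sqrt H) := by positivity
    calc (M:ℝ) ^ (1 - 2 * s) ≤ (1 / (8 * Real.sqrt H)) ^ (1 - 2 * s) := Real.rpow_le_rpow_of_nonpos e8 hMge (by linarith)
      _ = 8 ^ (2 * s - 1) * σ ^ 2 := by
          rw [one_div, Real.inv_rpow (by positivity), ← Real.rpow_neg (by positivity), Real.mul_rpow (by norm_num) hsH.le,
            Real.sqrt_eq_rpow, ← Real.rpow_mul hH.le, hσ, ← Real.rpow_natCast (H ^ _), ← Real.rpow_mul hH.le]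
          congr 1
          · congr 1; ring
          · congr 1; push_cast; ring
      _ ≤ 8 ^ (1:ℝ) * σ ^ 2 := by
          gcongr
          · norm_num
          · linarith
      _ = _ := by rw [Real.rpow_one]
  obtain ⟨G, hGc, hG1, hG2⟩ : ∃ G : ℝ → ℝ, Continuous G ∧
      (∀ h : ℝ, |h| ≤ 2 * H → ‖∑ n ∈ Finset.range N, st (psiw s h) p q δ n‖ ^ 2 ≤ 3 * (CL * σ) ^ 2 + 3 * G (δ + 2 * h) + 3 * G (δ + h)) ∧
      ∀ a b : ℝ, a ≤ b → -(5 * Real.sqrt H / q) ≤ a → b ≤ 5 * Real.sqrt H / q → b - a ≤ 2 * H →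
        ∫ y in a..b, G y ≤ C2 * (H * (8 * σ ^ 2)) := by
    rcases le_total N M with hNM | hMN
    · refine ⟨fun _ => 0, continuous_const, fun h hh => ?_, fun a b _ _ _ _ => ?_⟩
      · have := hlow h hh N hN hNM
        calc _ ≤ (CL * σ) ^ 2 := by gcongr
          _ ≤ _ := by nlinarith [sq_nonneg (CL * σ)]
      · simp only [intervalIntegral.integral_zero]; positivity
    · obtain ⟨G, g1, g2, g3⟩ := h2 q p hq hcp H hH hHq M N hMpos hMN hM8
      refine ⟨G, g1, fun h hh => ?_, fun a b k1 k2 k3 k4 => (g3 a b k1 k2 k3 k4).trans (by gcongr)⟩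
      have hl := hlow h hh M hMpos le_rfl
      rw [← Finset.sum_range_add_sum_Ico _ hMN]
      have e : ∑ n ∈ Finset.Ico M N, st (psiw s h) p q δ n = ∑ n ∈ Finset.Ico M N, st (phw s) p q (δ + 2 * h) n - ∑ n ∈ Finset.Ico M N, st (phw s) p q (δ + h) n := by
        rw [← Finset.sum_sub_distrib]
        exact Finset.sum_congr rfl fun n hn => st_split s δ h p q n (hMpos.trans (Finset.mem_Ico.1 hn).1)
      rw [e]
      set x := ∑ n ∈ Finset.range M, st (psiw s h) p q δ n
      set z1 := ∑ n ∈ Finset.Ico M N, st (phw s) p q (δ + 2 * h) n with hz1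
      set z2 := ∑ n ∈ Finset.Ico M N, st (phw s) p q (δ + h) n with hz2
      have b1 : ‖z1‖ ^ 2 ≤ G (δ + 2 * h) := g2 _
      have b2 : ‖z2‖ ^ 2 ≤ G (δ + h) := g2 _
      calc _ ≤ (CL * σ + ‖z1‖ + ‖z2‖) ^ 2 := by
            gcongr
            refine (norm_add_le _ _).trans ?_
            linarith [norm_sub_le z1 z2]
        _ ≤ 3 * (CL * σ) ^ 2 + 3 * ‖z1‖ ^ 2 + 3 * ‖z2‖ ^ 2 := by
            nlinarith [sq_nonneg (CL * σ - ‖z1‖), sq_nonneg (CL * σ - ‖z2‖), sq_nonneg (‖z1‖ - ‖z2‖)]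
        _ ≤ _ := by linarith
  have hUc : Continuous fun h : ℝ => 3 * (CL * σ) ^ 2 + 3 * G (δ + 2 * h) + 3 * G (δ + h) := by fun_prop
  have hfin := ann_sub δ H hH G hGc (CL * σ) (C2 * (H * (8 * σ ^ 2))) (5 * Real.sqrt H / q) hHR hG2
  apply Real.sqrt_le_iff.2
  refine ⟨by positivity, ?_⟩
  calc _ ≤ ∫ h, (3 * (CL * σ) ^ 2 + 3 * G (δ + 2 * h) + 3 * G (δ + h)) ∂ annMeasure H := by
        apply integral_mono_of_nonneg
        · exact Eventually.of_forall fun h => by positivity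
        · exact (ann_int H hH _ hUc).1
        · unfold annMeasure
          apply Measure.ae_smul_measure
          filter_upwards [self_mem_ae_restrict (measurableSet_Icc.union measurableSet_Icc)] with h hh
          rw [g_eq s δ h (by linarith) hs1]
          apply hG1
          rw [abs_le]
          rcases hh with hh | hh <;> constructor <;> linarith [hh.1, hh.2]
    _ ≤ 3 * (CL * σ) ^ 2 + 9 / 2 * (C2 * (H * (8 * σ ^ 2)) / H) := hfin
    _ ≤ _ := final_arith CL C2 H σ hH hCL0 hC2


end Helpers

/-- Proposition 5.3: `L²`-average bound for the oscillating part. For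
`s ∈ (1/2,1]` there is a constant `C > 0`, depending only on `s`, such that for all coprime
`p, q` with `q ≥ 1`, all `0 < H ≤ q^{-2}`, all `δ` with `|δ| ≤ √H/q` and all `N ≥ 1`, the
function `g_{s,N}(h) = F_{s,N}(p/q+δ+2h) - F_{s,N}(p/q+δ+h) - (θ_0/√q) f_{s,N}(h)`
satisfies `‖g_{s,N}‖_{L²(μ̃_H)} ≤ C H^{(s-1/2)/2}`. -/
theorem L2_average_bound (s : ℝ) (hs : s ∈ Set.Ioc (1/2 : ℝ) 1) :
    ∃ C : ℝ, 0 < C ∧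
      ∀ (p : ℤ) (q : ℕ), 1 ≤ q → IsCoprime p (q : ℤ) →
        ∀ H : ℝ, 0 < H → H ≤ ((q : ℝ) ^ 2)⁻¹ →
          ∀ δ : ℝ, |δ| ≤ Real.sqrt H / q →
            ∀ N : ℕ, 1 ≤ N →
              Real.sqrt (∫ h,
                  ‖FsN s N ((p : ℝ) / q + δ + 2 * h) - FsN s N ((p : ℝ) / q + δ + h) -
                      gaussTheta p q 0 / (Real.sqrt q : ℂ) * fMain s δ (N : ℝ) h‖ ^ 2
                    ∂ annMeasure H) ≤
                C * H ^ ((s - 1/2) / 2) := by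
  exact assembly s hs
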